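/- There exists a universal constant C > 0 such that for every N ≥ 1, if A is Haar-distributed on SO(2N+1) and Q_N(A) = 2 Σ_{k≥1} (Tr(A^k) − 1)²/k², then |E[Q_N(A)] − 2 log(2N) − (2γ + 2 + π²/4)| ≤ C/N and |Var(Q_N(A)) − (4π²/3 + 14 ζ(3))| ≤ C/N, where γ is the Euler–Mascheroni constant and ζ is the Riemann zeta function. -/

import Mathlib

open MeasureTheory ProbabilityTheory Matrix

noncomputable section

instance matrixMeasurableSpace {m n α : Type*} [MeasurableSpace α] :
    MeasurableSpace (Matrix m n α) :=
  show MeasurableSpace (m → n → α) from inferInstance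

/-- `Q_N(A) = 2 Σ_{k≥1} (Tr(A^k) − 1)²/k²`. -/
def Q (N : ℕ) (A : Matrix (Fin (2 * N + 1)) (Fin (2 * N + 1)) ℝ) : ℝ :=
  2 * ∑' k : ℕ, ((A ^ (k + 1)).trace - 1) ^ 2 / ((k : ℝ) + 1) ^ 2

set_option linter.unusedSectionVars false

namespace SOOdd

section Group

open MvPolynomial

variable {n : Type*} [Fintype n] [DecidableEq n]

/-- The one-parameter group generated by `X`, when `X ^ 3 = -X`. -/
def rot (X : Matrix n n ℝ) (t : ℝ) : Matrix n n ℝ :=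
  1 + Real.sin t • X + (1 - Real.cos t) • X ^ 2

lemma rot_add {X : Matrix n n ℝ} (hX : X ^ 3 = -X) (s t : ℝ) :
    rot X (s + t) = rot X s * rot X t := by
  have h3 : X ^ 2 * X = -X := by rw [← hX]; noncomm_ring
  have h3' : X * X ^ 2 = -X := by rw [← hX]; noncomm_ring
  have h4 : X ^ 2 * X ^ 2 = -X ^ 2 := by
    calc X ^ 2 * X ^ 2 = X * (X ^ 2 * X) := by noncomm_ring
      _ = -X ^ 2 := by rw [h3]; noncomm_ring
  have h2 : X * X = X ^ 2 := by noncomm_ring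
  simp only [rot, Real.sin_add, Real.cos_add, mul_add, add_mul, one_mul, mul_one,
    smul_mul_smul_comm, h3, h3', h4, h2]
  module

@[simp] lemma rot_zero (X : Matrix n n ℝ) : rot X 0 = 1 := by simp [rot]

lemma rot_mem {X : Matrix n n ℝ} (hX : X ^ 3 = -X) (hXt : Xᵀ = -X) (t : ℝ) :
    rot X t ∈ specialOrthogonalGroup n ℝ := by
  have htr : ∀ t, (rot X t)ᵀ = rot X (-t) := by
    intro t
    simp [rot, transpose_pow, hXt]
  have hinv : ∀ t, rot X t * (rot X t)ᵀ = 1 := by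
    intro t
    rw [htr, ← rot_add hX]; simp
  refine mem_specialOrthogonalGroup_iff.2 ⟨(mem_orthogonalGroup_iff n ℝ).2 (hinv t), ?_⟩
  · have h := congrArg Matrix.det (hinv (t / 2))
    rw [det_mul, det_transpose, det_one] at h
    have : t = t / 2 + t / 2 := by ring
    rw [this, rot_add hX, det_mul, h]

/-- `F'` is the derivative of `F` along the left translations by `rot X t`; both functions are
measurable and bounded on the special orthogonal group. -/
structure DerivAlong (X : Matrix n n ℝ) (F F' : Matrix n n ℝ → ℝ) : Prop where
  meas : Measurable F
  meas' : Measurable F'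
  bdd : ∃ B, ∀ A ∈ specialOrthogonalGroup n ℝ, |F A| ≤ B
  bdd' : ∃ B, ∀ A ∈ specialOrthogonalGroup n ℝ, |F' A| ≤ B
  deriv : ∀ A, HasDerivAt (fun t => F (rot X t * A)) (F' A) 0

lemma bdd_add {s : Set (Matrix n n ℝ)} {F G : Matrix n n ℝ → ℝ}
    (hF : ∃ B, ∀ A ∈ s, |F A| ≤ B) (hG : ∃ B, ∀ A ∈ s, |G A| ≤ B) :
    ∃ B, ∀ A ∈ s, |F A + G A| ≤ B := by
  obtain ⟨B, hB⟩ := hF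
  obtain ⟨C, hC⟩ := hG
  exact ⟨B + C, fun A hA => (abs_add_le _ _).trans (add_le_add (hB A hA) (hC A hA))⟩

lemma bdd_mul {s : Set (Matrix n n ℝ)} {F G : Matrix n n ℝ → ℝ}
    (hF : ∃ B, ∀ A ∈ s, |F A| ≤ B) (hG : ∃ B, ∀ A ∈ s, |G A| ≤ B) :
    ∃ B, ∀ A ∈ s, |F A * G A| ≤ B := by
  obtain ⟨B, hB⟩ := hF
  obtain ⟨C, hC⟩ := hG
  refine ⟨B * C, fun A hA => ?_⟩
  rw [abs_mul]
  exact mul_le_mul (hB A hA) (hC A hA) (abs_nonneg _) ((abs_nonneg _).trans (hB A hA))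

namespace DerivAlong

variable {X : Matrix n n ℝ} {F F' G G' : Matrix n n ℝ → ℝ}

lemma const (c : ℝ) : DerivAlong X (fun _ => c) (fun _ => 0) where
  meas := measurable_const
  meas' := measurable_const
  bdd := ⟨|c|, fun _ _ => le_rfl⟩
  bdd' := ⟨0, by simp⟩
  deriv _ := hasDerivAt_const _ _

lemma add (hF : DerivAlong X F F') (hG : DerivAlong X G G') :
    DerivAlong X (fun A => F A + G A) (fun A => F' A + G' A) where
  meas := hF.meas.add hG.meas
  meas' := hF.meas'.add hG.meas'
  bdd := bdd_add hF.bdd hG.bdd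
  bdd' := bdd_add hF.bdd' hG.bdd'
  deriv A := (hF.deriv A).add (hG.deriv A)

lemma mul (hF : DerivAlong X F F') (hG : DerivAlong X G G') :
    DerivAlong X (fun A => F A * G A) (fun A => F' A * G A + F A * G' A) where
  meas := hF.meas.mul hG.meas
  meas' := (hF.meas'.mul hG.meas).add (hF.meas.mul hG.meas')
  bdd := bdd_mul hF.bdd hG.bdd
  bdd' := bdd_add (bdd_mul hF.bdd' hG.bdd) (bdd_mul hF.bdd hG.bdd')
  deriv A := by
    have h := (hF.deriv A).fun_mul (hG.deriv A)
    simpa only [rot_zero, one_mul] using h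

lemma sum {ι : Type*} (s : Finset ι) {F F' : ι → Matrix n n ℝ → ℝ}
    (h : ∀ i ∈ s, DerivAlong X (F i) (F' i)) :
    DerivAlong X (fun A => ∑ i ∈ s, F i A) (fun A => ∑ i ∈ s, F' i A) := by
  classical
  induction s using Finset.induction_on with
  | empty => simpa using const 0
  | insert i s hi ih =>
    simp only [Finset.sum_insert hi]
    exact (h i (by simp)).add (ih fun j hj => h j (by simp [hj]))

lemma congr (hF : DerivAlong X F F') (h : ∀ A, F A = G A) (h' : ∀ A, F' A = G' A) :
    DerivAlong X G G' := by
  obtain rfl : F = G := funext h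
  obtain rfl : F' = G' := funext h'
  exact hF

end DerivAlong

lemma measurable_entry (i j : n) : Measurable fun A : Matrix n n ℝ => A i j :=
  (measurable_pi_apply j).comp (measurable_pi_apply i)

lemma abs_entry_le {A : Matrix n n ℝ} (hA : A ∈ specialOrthogonalGroup n ℝ) (i j : n) :
    |A i j| ≤ 1 := by
  have h : A ∈ unitaryGroup n ℝ := (mem_specialOrthogonalGroup_iff.1 hA).1
  simpa using entry_norm_bound_of_unitary (𝕜 := ℝ) h i j

lemma measurable_mul_entry (X : Matrix n n ℝ) (i j : n) :
    Measurable fun A : Matrix n n ℝ => (X * A) i j := by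
  simp only [mul_apply]
  exact Finset.measurable_sum _ fun l _ => (measurable_entry l j).const_mul _

lemma derivAlong_entry (X : Matrix n n ℝ) (i j : n) :
    DerivAlong X (fun A => A i j) (fun A => (X * A) i j) where
  meas := measurable_entry i j
  meas' := measurable_mul_entry X i j
  bdd := ⟨1, fun A hA => abs_entry_le hA i j⟩
  bdd' := by
    refine ⟨∑ l, |X i l|, fun A hA => ?_⟩
    rw [mul_apply]
    refine (Finset.abs_sum_le_sum_abs _ _).trans (Finset.sum_le_sum fun l _ => ?_)
    rw [abs_mul]
    exact mul_le_of_le_one_right (abs_nonneg _) (abs_entry_le hA l j)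
  deriv A := by
    have h : ∀ t, (rot X t * A) i j =
        A i j + Real.sin t * (X * A) i j + (1 - Real.cos t) * (X ^ 2 * A) i j := by
      intro t
      simp [rot, add_mul]
    simp only [h]
    have h1 := (((Real.hasDerivAt_sin 0).mul_const ((X * A) i j)).const_add (A i j)).fun_add
      (((Real.hasDerivAt_cos 0).const_sub 1).mul_const ((X ^ 2 * A) i j))
    simpa using h1

lemma derivAlong_pow (X : Matrix n n ℝ) (k : ℕ) (i j : n) :
    DerivAlong X (fun A => (A ^ k) i j)
      (fun A => ∑ m ∈ Finset.range k, (A ^ m * X * A ^ (k - m)) i j) := by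
  induction k generalizing i j with
  | zero => simpa using DerivAlong.const ((1 : Matrix n n ℝ) i j)
  | succ k ih =>
    refine (DerivAlong.sum Finset.univ fun l _ => (ih i l).mul (derivAlong_entry X l j)).congr
      (fun A => by rw [pow_succ, mul_apply]) fun A => ?_
    rw [Finset.sum_add_distrib, ← mul_apply, Finset.sum_range_succ]
    have : ∑ l, (∑ m ∈ Finset.range k, (A ^ m * X * A ^ (k - m)) i l) * A l j =
        ∑ m ∈ Finset.range k, (A ^ m * X * A ^ (k + 1 - m)) i j := by
      simp only [Finset.sum_mul]
      rw [Finset.sum_comm]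
      refine Finset.sum_congr rfl fun m hm => ?_
      have hm' : k + 1 - m = (k - m) + 1 := by
        have := Finset.mem_range.1 hm; omega
      rw [← mul_apply, hm', pow_succ, ← mul_assoc]
    rw [this]
    simp [mul_assoc]

lemma DerivAlong.integral_eq_zero {X : Matrix n n ℝ} {F F' : Matrix n n ℝ → ℝ}
    (h : DerivAlong X F F') (hX : X ^ 3 = -X) (hXt : Xᵀ = -X)
    {μ : Measure (Matrix n n ℝ)} [IsProbabilityMeasure μ]
    (hμ : ∀ᵐ A ∂μ, A ∈ specialOrthogonalGroup n ℝ)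
    (hinv : ∀ g ∈ specialOrthogonalGroup n ℝ, μ.map (fun A => g * A) = μ) :
    ∫ A, F' A ∂μ = 0 := by
  obtain ⟨B, hB⟩ := h.bdd
  obtain ⟨B', hB'⟩ := h.bdd'
  have hmul : ∀ g : Matrix n n ℝ, Measurable fun A : Matrix n n ℝ => g * A := fun g =>
    measurable_pi_lambda _ fun i => measurable_pi_lambda _ fun j => measurable_mul_entry g i j
  have key := hasDerivAt_integral_of_dominated_loc_of_deriv_le (μ := μ) (𝕜 := ℝ) (x₀ := 0)
    (s := Set.univ) (F := fun t A => F (rot X t * A)) (F' := fun t A => F' (rot X t * A))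
    (bound := fun _ => B') Filter.univ_mem
    (Filter.Eventually.of_forall fun t => (h.meas.comp (hmul _)).aestronglyMeasurable)
    (by
      refine Integrable.of_bound (C := B) (h.meas.comp (hmul _)).aestronglyMeasurable ?_
      filter_upwards [hμ] with A hA
      simpa using hB A hA)
    (h.meas'.comp (hmul _)).aestronglyMeasurable
    (by
      filter_upwards [hμ] with A hA t _
      exact hB' _ (mul_mem (rot_mem hX hXt t) hA))
    (integrable_const _)
    (by
      filter_upwards with A t _
      have h0 := h.deriv (rot X t * A)
      have h1 : HasDerivAt (fun s : ℝ => s - t) 1 t := (hasDerivAt_id t).sub_const t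
      have h2 := HasDerivAt.comp_of_eq t h0 h1 (by simp)
      rw [mul_one] at h2
      refine h2.congr_of_eventuallyEq (Filter.Eventually.of_forall fun s => ?_)
      simp only [Function.comp]
      rw [← mul_assoc, ← rot_add hX]; simp)
  have hconst : ∀ t, ∫ A, F (rot X t * A) ∂μ = ∫ A, F A ∂μ := by
    intro t
    conv_rhs => rw [← hinv _ (rot_mem hX hXt t)]
    rw [integral_map (hmul _).aemeasurable h.meas.aestronglyMeasurable]
  have h1 := key.2
  simp only [hconst, rot_zero, one_mul] at h1
  exact h1.unique (hasDerivAt_const _ _)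

/-- The generator of the rotations in the `(i, j)` plane. -/
def gen (i j : n) : Matrix n n ℝ := single i j 1 - single j i 1

lemma gen_transpose (i j : n) : (gen i j)ᵀ = -gen i j := by
  simp [gen]

lemma gen_pow_three (i j : n) : gen i j ^ 3 = -gen i j := by
  by_cases h : i = j
  · subst h; simp [gen]
  · have h' : j ≠ i := fun e => h e.symm
    simp [gen, pow_succ, sub_mul, mul_sub, single_mul_single_of_ne, h, h']
    abel

/-- Power traces of a matrix as values of polynomials in countably many variables. -/
def evM (A : Matrix n n ℝ) : MvPolynomial ℕ ℝ →ₐ[ℝ] ℝ := aeval fun k => (A ^ k).trace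

end Group

section LoopEquation

open MvPolynomial

/-- The derivation part of the `k`-th loop equation. -/
def loopDer (k : ℕ) : Derivation ℝ (MvPolynomial ℕ ℝ) (MvPolynomial ℕ ℝ) :=
  mkDerivation ℝ fun l => C (l : ℝ) * (X ((k - l) + (l - k)) - X (k + l))

/-- The multiplicative part of the `k`-th loop equation. -/
def loopCoeff (k : ℕ) : MvPolynomial ℕ ℝ :=
  ∑ m ∈ Finset.range k, (X ((2 * m - k) + (k - 2 * m)) - X m * X (k - m))

variable {n : Type*} [Fintype n] [DecidableEq n]

lemma pow_mul_transpose_pow {A : Matrix n n ℝ} (hA : A ∈ specialOrthogonalGroup n ℝ) (k l : ℕ) :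
    (A ^ k * (A ^ l)ᵀ).trace = (A ^ ((k - l) + (l - k))).trace := by
  have h1 : ∀ m, A ^ m * (A ^ m)ᵀ = 1 := by
    intro m
    have := (mem_specialOrthogonalGroup_iff.1 (pow_mem hA m)).1
    exact (mem_orthogonalGroup_iff n ℝ).1 this
  rcases le_total l k with h | h
  · obtain ⟨d, rfl⟩ := Nat.exists_eq_add_of_le h
    have : l + d - l + (l - (l + d)) = d := by omega
    rw [this, add_comm l d, pow_add, mul_assoc, h1, mul_one]
  · obtain ⟨d, rfl⟩ := Nat.exists_eq_add_of_le h
    have : k - (k + d) + (k + d - k) = d := by omega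
    rw [this, pow_add, transpose_mul, trace_mul_comm, mul_assoc, ← trace_transpose]
    have h2 : (A ^ k)ᵀ * A ^ k = 1 := mul_eq_one_comm.1 (h1 k)
    rw [transpose_mul, transpose_mul, transpose_transpose, trace_mul_comm, h2,
      mul_one, transpose_transpose]

lemma sum_gen_entry (M L : Matrix n n ℝ) :
    ∑ i, ∑ j, (M * (gen i j : Matrix n n ℝ) * L : Matrix n n ℝ) j i =
      (M * Lᵀ).trace - M.trace * L.trace := by
  have h : ∀ i j, (M * (gen i j : Matrix n n ℝ) * L : Matrix n n ℝ) j i =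
      M j i * L j i - M j j * L i i := by
    intro i j
    simp [gen, mul_sub, sub_mul, mul_apply, single_apply, Finset.sum_ite_eq, ite_and]
  simp only [h, Finset.sum_sub_distrib]
  congr 1
  · rw [Finset.sum_comm]
    simp [trace, mul_apply]
  · simp only [trace, diag]
    rw [Finset.sum_mul_sum, Finset.sum_comm]

lemma sum_mul_trace_gen (M L : Matrix n n ℝ) :
    ∑ i, ∑ j, M j i * (gen i j * L).trace = (M * Lᵀ).trace - (M * L).trace := by
  have h : ∀ i j, (gen i j * L).trace = L j i - L i j := by
    intro i j
    simp [gen, sub_mul, trace_sub, trace_single_mul]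
  simp only [h, mul_sub, Finset.sum_sub_distrib]
  congr 1
  · rw [Finset.sum_comm]
    simp [trace, mul_apply]
  · rw [Finset.sum_comm]
    simp [trace, mul_apply]

lemma derivAlong_trace (X : Matrix n n ℝ) (k : ℕ) :
    DerivAlong X (fun A => (A ^ k).trace) (fun A => k * (X * A ^ k).trace) := by
  refine (DerivAlong.sum Finset.univ fun i _ => derivAlong_pow X k i i).congr (fun A => rfl)
    fun A => ?_
  rw [Finset.sum_comm]
  have : ∀ m ∈ Finset.range k, ∑ i, (A ^ m * X * A ^ (k - m)) i i = (X * A ^ k).trace := by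
    intro m hm
    change (A ^ m * X * A ^ (k - m)).trace = _
    rw [trace_mul_comm, ← mul_assoc, ← pow_add, trace_mul_comm]
    congr 3
    have := Finset.mem_range.1 hm; omega
  rw [Finset.sum_congr rfl this]
  simp

lemma exists_derivAlong_evM (h : MvPolynomial ℕ ℝ) :
    ∃ D : n → n → Matrix n n ℝ → ℝ,
      (∀ i j, DerivAlong (gen i j) (fun A => evM A h) (D i j)) ∧
      ∀ k, ∀ A ∈ specialOrthogonalGroup n ℝ,
        ∑ i, ∑ j, (A ^ k) j i * D i j A = evM A (loopDer k h) := by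
  induction h using MvPolynomial.induction_on with
  | C c =>
    refine ⟨fun _ _ _ => 0, fun i j => ?_, fun k A _ => ?_⟩
    · simpa [evM] using DerivAlong.const c
    · simp [MvPolynomial.derivation_C]
  | add p q hp hq =>
    obtain ⟨D, hD, hD'⟩ := hp
    obtain ⟨E, hE, hE'⟩ := hq
    refine ⟨fun i j A => D i j A + E i j A, fun i j => ?_, fun k A hA => ?_⟩
    · simpa using (hD i j).add (hE i j)
    · simp only [mul_add, Finset.sum_add_distrib, hD' k A hA, hE' k A hA, map_add]
  | mul_X p l hp =>
    obtain ⟨D, hD, hD'⟩ := hp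
    refine ⟨fun i j A => D i j A * (A ^ l).trace + evM A p * (l * (gen i j * A ^ l).trace),
      fun i j => ?_, fun k A hA => ?_⟩
    · refine ((hD i j).mul (derivAlong_trace _ l)).congr (fun A => ?_) fun A => rfl
      simp [evM]
    · have h1 := hD' k A hA
      have h2 := sum_mul_trace_gen (A ^ k) (A ^ l)
      rw [pow_mul_transpose_pow hA, ← pow_add] at h2
      have h3 : evM A (loopDer k (p * X l)) =
          evM A (loopDer k p) * (A ^ l).trace +
            evM A p * (l * ((A ^ ((k - l) + (l - k))).trace - (A ^ (k + l)).trace)) := by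
        simp [loopDer, Derivation.leibniz, mkDerivation_X, evM]
        ring
      rw [h3, ← h1, ← h2]
      simp only [Finset.sum_mul, Finset.mul_sum]
      simp only [← Finset.sum_add_distrib]
      refine Finset.sum_congr rfl fun i _ => Finset.sum_congr rfl fun j _ => ?_
      ring

/-- The loop equations satisfied by the power traces of a Haar-distributed matrix. -/
theorem integral_loop {μ : Measure (Matrix n n ℝ)} [IsProbabilityMeasure μ]
    (hμ : ∀ᵐ A ∂μ, A ∈ specialOrthogonalGroup n ℝ)
    (hinv : ∀ g ∈ specialOrthogonalGroup n ℝ, μ.map (fun A => g * A) = μ)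
    (k : ℕ) (h : MvPolynomial ℕ ℝ) :
    ∫ A, evM A (loopCoeff k * h + loopDer k h) ∂μ = 0 := by
  obtain ⟨D, hD, hD'⟩ := exists_derivAlong_evM (n := n) h
  have hder := fun i j => (derivAlong_pow (gen i j) k j i).mul (hD i j)
  have hzero := fun i j => (hder i j).integral_eq_zero (gen_pow_three i j) (gen_transpose i j)
    hμ hinv
  have hInt : ∀ i j, Integrable (fun A => (∑ m ∈ Finset.range k,
      (A ^ m * gen i j * A ^ (k - m)) j i) * evM A h + (A ^ k) j i * D i j A) μ := by
    intro i j
    obtain ⟨B, hB⟩ := (hder i j).bdd'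
    refine Integrable.of_bound (C := B) (hder i j).meas'.aestronglyMeasurable ?_
    filter_upwards [hμ] with A hA
    exact hB A hA
  have hsum : ∫ A, ∑ i, ∑ j, ((∑ m ∈ Finset.range k,
      (A ^ m * gen i j * A ^ (k - m)) j i) * evM A h + (A ^ k) j i * D i j A) ∂μ = 0 := by
    rw [integral_finsetSum _ fun i _ => integrable_finsetSum _ fun j _ => hInt i j]
    refine Finset.sum_eq_zero fun i _ => ?_
    rw [integral_finsetSum _ fun j _ => hInt i j]
    exact Finset.sum_eq_zero fun j _ => hzero i j
  rw [← hsum]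
  refine integral_congr_ae ?_
  filter_upwards [hμ] with A hA
  simp only [Finset.sum_add_distrib, hD' k A hA, ← Finset.sum_mul, map_add, map_mul]
  congr 2
  simp_rw [Finset.sum_comm (s := Finset.univ) (t := Finset.range k)]
  simp only [loopCoeff, map_sum, map_sub, map_mul, evM, aeval_X]
  refine Finset.sum_congr rfl fun m hm => ?_
  have hm' := Finset.mem_range.1 hm
  rw [sum_gen_entry, pow_mul_transpose_pow hA]
  congr 3
  omega

lemma evM_meas_bdd (h : MvPolynomial ℕ ℝ) :
    (Measurable fun A : Matrix n n ℝ => evM A h) ∧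
      ∃ B, ∀ A ∈ specialOrthogonalGroup n ℝ, |evM A h| ≤ B := by
  obtain ⟨F', hF⟩ : ∃ F', DerivAlong (0 : Matrix n n ℝ) (fun A => evM A h) F' := by
    induction h using MvPolynomial.induction_on with
    | C c => exact ⟨_, by simpa [evM] using DerivAlong.const c⟩
    | add p q hp hq =>
      obtain ⟨D, hD⟩ := hp
      obtain ⟨E, hE⟩ := hq
      exact ⟨_, by simpa using hD.add hE⟩
    | mul_X p l hp =>
      obtain ⟨D, hD⟩ := hp
      exact ⟨_, (hD.mul (derivAlong_trace _ l)).congr (fun A => by simp [evM]) fun A => rfl⟩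
  exact ⟨hF.meas, hF.bdd⟩

lemma integrable_evM {μ : Measure (Matrix n n ℝ)} [IsProbabilityMeasure μ]
    (hμ : ∀ᵐ A ∂μ, A ∈ specialOrthogonalGroup n ℝ) (h : MvPolynomial ℕ ℝ) :
    Integrable (fun A => evM A h) μ := by
  obtain ⟨hm, B, hB⟩ := evM_meas_bdd (n := n) h
  refine Integrable.of_bound (C := B) hm.aestronglyMeasurable ?_
  filter_upwards [hμ] with A hA
  exact hB A hA

end LoopEquation

section Spectrum

open Polynomial

lemma card_roots_charpoly {m : ℕ} (B : Matrix (Fin m) (Fin m) ℂ) :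
    Multiset.card B.charpoly.roots = m := by
  rw [← (IsAlgClosed.splits B.charpoly).natDegree_eq_card_roots, charpoly_natDegree_eq_dim,
    Fintype.card_fin]

lemma det_sub_scalar {m : ℕ} (B : Matrix (Fin m) (Fin m) ℂ) (a : ℂ) :
    (B - algebraMap ℂ _ a).det = (B.charpoly.roots.map fun z => z - a).prod := by
  have h1 : (B - algebraMap ℂ _ a) = -(scalar (Fin m) a - B) := by
    simp [algebraMap_eq_diagonal, scalar_apply]
  have h2 : B.charpoly.eval a = (B.charpoly.roots.map fun z => a - z).prod := by
    conv_lhs => rw [(IsAlgClosed.splits B.charpoly).eq_prod_roots_of_monic (charpoly_monic B)]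
    rw [eval_multiset_prod, Multiset.map_map]
    simp
  rw [h1, det_neg, ← eval_charpoly, h2, Fintype.card_fin]
  have h3 : ∀ s : Multiset ℂ, (s.map fun z => z - a).prod =
      (-1) ^ Multiset.card s * (s.map fun z => a - z).prod := by
    intro s
    induction s using Multiset.induction_on with
    | empty => simp
    | cons b s ih => simp only [Multiset.map_cons, Multiset.prod_cons, Multiset.card_cons, ih]; ring
  rw [h3, card_roots_charpoly]

lemma det_aeval {m : ℕ} (B : Matrix (Fin m) (Fin m) ℂ) (p : ℂ[X]) :
    (aeval B p).det = (B.charpoly.roots.map fun z => p.eval z).prod := by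
  have h1 : ∀ s : Multiset ℂ, (aeval B (s.map fun a => X - C a).prod).det =
      (B.charpoly.roots.map fun z => (s.map fun a => X - C a).prod.eval z).prod := by
    intro s
    induction s using Multiset.induction_on with
    | empty => simp
    | cons b s ih =>
      simp only [Multiset.map_cons, Multiset.prod_cons, map_mul, det_mul, ih, eval_mul,
        Multiset.prod_map_mul, map_sub, aeval_X, aeval_C, det_sub_scalar, eval_sub, eval_X, eval_C]
  rw [(IsAlgClosed.splits p).eq_prod_roots]
  simp only [map_mul, det_mul, h1, eval_mul, Multiset.prod_map_mul, aeval_C, eval_C]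
  congr 1
  simp [algebraMap_eq_diagonal, card_roots_charpoly]

lemma trace_pow_eq_sum_roots {m : ℕ} (B : Matrix (Fin m) (Fin m) ℂ) (k : ℕ) :
    (B ^ k).trace = (B.charpoly.roots.map fun z => z ^ k).sum := by
  have h : (B ^ k).charpoly =
      ((B.charpoly.roots.map fun z => z ^ k).map fun a => X - C a).prod := by
    refine Polynomial.funext fun y => ?_
    have h1 := det_aeval B (C y - X ^ k)
    simp only [map_sub, aeval_C, map_pow, aeval_X, eval_sub, eval_C, eval_pow, eval_X] at h1
    rw [eval_charpoly, eval_multiset_prod, Multiset.map_map, Multiset.map_map]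
    simp only [Function.comp_apply, eval_sub, eval_C, eval_X]
    exact h1
  rw [trace_eq_sum_roots_charpoly, h, roots_multiset_prod_X_sub_C]

open scoped Matrix.Norms.L2Operator in
lemma mul_conj_of_mem_roots {m : ℕ} {A : Matrix (Fin m) (Fin m) ℝ}
    (hA : A ∈ specialOrthogonalGroup (Fin m) ℝ) {z : ℂ}
    (hz : z ∈ (A.map (algebraMap ℝ ℂ)).charpoly.roots) : z * (starRingEnd ℂ) z = 1 := by
  have h1 : A * Aᵀ = 1 := (mem_orthogonalGroup_iff _ ℝ).1 (mem_specialOrthogonalGroup_iff.1 hA).1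
  have h2 : A.map (algebraMap ℝ ℂ) ∈ unitary (Matrix (Fin m) (Fin m) ℂ) := by
    refine mem_unitaryGroup_iff.2 ?_
    have h3 := congrArg (fun M : Matrix (Fin m) (Fin m) ℝ => M.map (algebraMap ℝ ℂ)) h1
    have h4 : star (A.map (algebraMap ℝ ℂ)) = Aᵀ.map (algebraMap ℝ ℂ) := by
      ext i j
      simp [star_apply]
    rw [h4, ← Matrix.map_mul, h1]
    simp
  have h5 := spectrum.subset_circle_of_unitary h2
    (mem_spectrum_of_isRoot_charpoly (isRoot_of_mem_roots hz))
  have h6 : ‖z‖ = 1 := by simpa using h5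
  rw [Complex.mul_conj, Complex.normSq_eq_norm_sq, h6]
  simp

lemma roots_map_conj {m : ℕ} (A : Matrix (Fin m) (Fin m) ℝ) :
    (A.map (algebraMap ℝ ℂ)).charpoly.roots.map (starRingEnd ℂ) =
      (A.map (algebraMap ℝ ℂ)).charpoly.roots := by
  rw [← (IsAlgClosed.splits _).roots_map, ← charpoly_map]
  congr 2
  ext i j
  simp

lemma exists_multiset_angles (s : Multiset ℂ) (h1 : ∀ z ∈ s, z * (starRingEnd ℂ) z = 1)
    (h2 : s.map (starRingEnd ℂ) = s) (h3 : s.prod = 1) (N : ℕ)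
    (h4 : Multiset.card s = 2 * N + 1) :
    ∃ t : Multiset ℝ, Multiset.card t = N ∧
      ∀ k : ℕ, (s.map fun z => z ^ k).sum =
        1 + 2 * (t.map fun x : ℝ => Complex.cos (k * x)).sum := by
  set P := s.filter fun z => 0 < z.im with hP
  have hneg : (s.filter fun z => z.im < 0) = P.map (starRingEnd ℂ) := by
    conv_lhs => rw [← h2]
    rw [Multiset.filter_map]
    simp [hP]
  set R := s.filter fun z => z.im = 0 with hR
  have hs : s = P + P.map (starRingEnd ℂ) + R := by
    ext z
    rw [← hneg]
    simp only [Multiset.count_add, hP, hR, Multiset.count_filter]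
    rcases lt_trichotomy z.im 0 with h | h | h
    · simp [h, h.not_gt, h.ne]
    · simp [h]
    · simp [h, h.not_gt, h.ne']
  have hRmem : ∀ z ∈ R, z = 1 ∨ z = -1 := by
    intro z hz
    obtain ⟨hz1, hz2⟩ := Multiset.mem_filter.1 hz
    have h := h1 z hz1
    rw [Complex.conj_eq_iff_im.2 hz2] at h
    exact mul_self_eq_one_iff.1 h
  have hRrep : R = Multiset.replicate (R.count 1) 1 + Multiset.replicate (R.count (-1)) (-1) := by
    ext z
    simp only [Multiset.count_add, Multiset.count_replicate]
    by_cases hz : z ∈ R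
    · rcases hRmem z hz with rfl | rfl
      · have : (-1 : ℂ) ≠ 1 := by norm_num
        simp [this]
      · have : (1 : ℂ) ≠ -1 := by norm_num
        simp [this]
    · rw [Multiset.count_eq_zero_of_notMem hz]
      by_cases ha : 1 = z
      · subst ha
        have : (-1 : ℂ) ≠ 1 := by norm_num
        simp [this, hz]
      · by_cases hb : -1 = z
        · subst hb
          simp [ha, hz]
        · simp [ha, hb]
  set p := R.count 1
  set q := R.count (-1)
  have hPprod : (P + P.map (starRingEnd ℂ)).prod = 1 := by
    rw [Multiset.prod_add]
    have : P.prod * (P.map (starRingEnd ℂ)).prod = (P.map fun z => z * (starRingEnd ℂ) z).prod := by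
      rw [Multiset.prod_map_mul, Multiset.map_id']
    rw [this]
    refine Multiset.prod_eq_one fun x hx => ?_
    obtain ⟨z, hz, rfl⟩ := Multiset.mem_map.1 hx
    exact h1 z (Multiset.mem_of_mem_filter hz)
  have hq : Even q := by
    rw [hs, Multiset.prod_add, hPprod, hRrep, Multiset.prod_add, Multiset.prod_replicate,
      Multiset.prod_replicate, one_pow, one_mul, one_mul] at h3
    by_contra hodd
    rw [(Nat.not_even_iff_odd.1 hodd).neg_one_pow] at h3
    norm_num at h3
  have hcard : 2 * Multiset.card P + (p + q) = 2 * N + 1 := by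
    rw [← h4, hs, hRrep]
    simp
    ring
  obtain ⟨b, hb⟩ := hq
  obtain ⟨a, ha⟩ : ∃ a, p = 2 * a + 1 := ⟨p / 2, by omega⟩
  refine ⟨P.map Complex.arg + (Multiset.replicate a 0 + Multiset.replicate b Real.pi), ?_, ?_⟩
  · simp; omega
  · intro k
    have hsum : (s.map fun z => z ^ k).sum =
        (P.map fun z => z ^ k + ((starRingEnd ℂ) z) ^ k).sum + (p + q * (-1) ^ k) := by
      conv_lhs => rw [hs, hRrep]
      simp only [Multiset.map_add, Multiset.sum_add, Multiset.map_replicate,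
        Multiset.sum_replicate, Multiset.map_map, Multiset.sum_map_add]
      simp
    have hPk : (P.map fun z => z ^ k + ((starRingEnd ℂ) z) ^ k).sum =
        2 * (P.map fun z => Complex.cos (k * z.arg)).sum := by
      rw [← Multiset.sum_map_mul_left]
      congr 1
      refine Multiset.map_congr rfl fun z hz => ?_
      have hn : ‖z‖ = 1 := by
        have h := h1 z (Multiset.mem_of_mem_filter hz)
        rw [Complex.mul_conj, Complex.normSq_eq_norm_sq] at h
        have h' : ‖z‖ ^ 2 = 1 := by exact_mod_cast h
        nlinarith [norm_nonneg z]
      have hz' : z = Complex.exp (z.arg * Complex.I) := by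
        conv_lhs => rw [← Complex.norm_mul_exp_arg_mul_I z, hn]
        simp
      rw [Complex.two_cos, ← map_pow]
      conv_lhs => rw [hz', ← Complex.exp_nat_mul, ← Complex.exp_conj]
      simp only [map_mul, Complex.conj_I, Complex.conj_ofReal, map_natCast]
      congr 2 <;> ring
    rw [hsum, hPk, ha, hb]
    simp only [Multiset.map_add, Multiset.map_map, Multiset.sum_add, Multiset.map_replicate,
      Multiset.sum_replicate, Function.comp_def]
    have : Complex.cos (k * Real.pi) = (-1) ^ k := by
      rw [← Complex.ofReal_natCast, ← Complex.ofReal_mul, ← Complex.ofReal_cos,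
        Real.cos_nat_mul_pi]
      simp
    rw [this]
    simp
    ring

/-- The nontrivial eigenangles of an odd special orthogonal matrix. -/
theorem exists_angles {N : ℕ} {A : Matrix (Fin (2 * N + 1)) (Fin (2 * N + 1)) ℝ}
    (hA : A ∈ specialOrthogonalGroup (Fin (2 * N + 1)) ℝ) :
    ∃ θ : Fin N → ℝ, ∀ k : ℕ, (A ^ k).trace = 1 + 2 * ∑ j, Real.cos (k * θ j) := by
  set B := A.map (algebraMap ℝ ℂ) with hB
  obtain ⟨t, ht, hk⟩ := exists_multiset_angles B.charpoly.roots
    (fun z hz => mul_conj_of_mem_roots hA hz) (roots_map_conj A)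
    (by
      rw [← det_eq_prod_roots_charpoly]
      have h := (algebraMap ℝ ℂ).map_det A
      rw [(mem_specialOrthogonalGroup_iff.1 hA).2, map_one] at h
      exact h.symm) N (card_roots_charpoly B)
  have hlen : t.toList.length = N := by simp [ht]
  refine ⟨fun j => t.toList.get (Fin.cast hlen.symm j), fun k => ?_⟩
  have h1 : (B ^ k).trace = (((A ^ k).trace : ℝ) : ℂ) := by
    have : B ^ k = (A ^ k).map (algebraMap ℝ ℂ) := by
      have := map_pow (algebraMap ℝ ℂ).mapMatrix A k
      exact this.symm
    rw [this]
    simp [trace]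
  have h2 : (t.map fun x : ℝ => Complex.cos (k * x)).sum =
      ((∑ j : Fin N, Real.cos (k * t.toList.get (Fin.cast hlen.symm j)) : ℝ) : ℂ) := by
    have h3 : ∑ j : Fin N, Real.cos (k * t.toList.get (Fin.cast hlen.symm j)) =
        (t.map fun x : ℝ => Real.cos (k * x)).sum := by
      subst hlen
      conv_rhs => rw [← t.coe_toList]
      rw [Multiset.map_coe, Multiset.sum_coe, ← Fin.sum_univ_fun_getElem]
      rfl
    rw [h3, ← Complex.ofRealHom_eq_coe, map_multiset_sum, Multiset.map_map]
    simp
  have h4 := hk k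
  rw [← trace_pow_eq_sum_roots, h1, h2] at h4
  exact_mod_cast h4

end Spectrum

section Torus

open MvPolynomial

variable {N : ℕ}

lemma sin_mul_cos_half (k : ℕ) (x : ℝ) :
    Real.sin (k * x) * Real.cos (x / 2) = Real.sin (x / 2) *
      ∑ m ∈ Finset.range k, (Real.cos (m * x) + Real.cos ((m + 1 : ℕ) * x)) := by
  induction k with
  | zero => simp
  | succ k ih =>
    rw [Finset.sum_range_succ, mul_add, ← ih]
    push_cast
    obtain ⟨y, hy⟩ : ∃ y, y = (k : ℝ) * x + x / 2 := ⟨_, rfl⟩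
    have h1 : ((k : ℝ) + 1) * x = y + x / 2 := by rw [hy]; ring
    have h2 : (k : ℝ) * x = y - x / 2 := by rw [hy]; ring
    rw [h1, h2, Real.sin_add, Real.sin_sub, Real.cos_add, Real.cos_sub]
    ring

/-- `∑_{m < k} cos (m x) cos ((k - m) y)`. -/
def cosConv (k : ℕ) (x y : ℝ) : ℝ :=
  ∑ m ∈ Finset.range k, Real.cos (m * x) * Real.cos ((k - m : ℕ) * y)

lemma sin_mul_sin_sub (k : ℕ) (x y : ℝ) :
    Real.sin x * Real.sin (k * x) - Real.sin y * Real.sin (k * y) =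
      -(Real.cos x - Real.cos y) * (cosConv k x y + cosConv k y x) := by
  have h1 : cosConv k y x = ∑ m ∈ Finset.range k,
      Real.cos (((m : ℝ) + 1) * x) * Real.cos (((k : ℝ) - m - 1) * y) := by
    rw [cosConv, ← Finset.sum_range_reflect]
    refine Finset.sum_congr rfl fun m hm => ?_
    have hm' := Finset.mem_range.1 hm
    have e1 : k - (k - 1 - m) = m + 1 := by omega
    have e2 : ((k - 1 - m : ℕ) : ℝ) = k - m - 1 := by
      rw [Nat.cast_sub (by omega), Nat.cast_sub (by omega)]; push_cast; ring
    rw [e1, e2, mul_comm]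
    push_cast
    rfl
  have h2 : cosConv k x y = ∑ m ∈ Finset.range k,
      Real.cos (m * x) * Real.cos (((k : ℝ) - m) * y) := by
    refine Finset.sum_congr rfl fun m hm => ?_
    rw [Nat.cast_sub (Finset.mem_range.1 hm).le]
  have h3 : ∀ M : ℕ, (Real.cos x - Real.cos y) * ∑ m ∈ Finset.range M,
      (Real.cos (m * x) * Real.cos (((k : ℝ) - m) * y) +
        Real.cos (((m : ℝ) + 1) * x) * Real.cos (((k : ℝ) - m - 1) * y)) =
      Real.sin y * Real.sin (k * y) - (Real.sin x * Real.sin (M * x) *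
        Real.cos (((k : ℝ) - M) * y) + Real.sin y * Real.cos (M * x) *
        Real.sin (((k : ℝ) - M) * y)) := by
    intro M
    induction M with
    | zero => simp
    | succ M ih =>
      rw [Finset.sum_range_succ, mul_add, ih]
      push_cast
      have e1 : ((k : ℝ) - (M + 1)) * y = (k - M) * y - y := by ring
      have e2 : ((k : ℝ) - M - 1) * y = (k - M) * y - y := by ring
      have e3 : ((M : ℝ) + 1) * x = M * x + x := by ring
      rw [e1, e2, e3]
      set u := ((k : ℝ) - M) * y
      set v := (M : ℝ) * x
      rw [Real.sin_add, Real.cos_add, Real.sin_sub, Real.cos_sub]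
      have hx := Real.sin_sq_add_cos_sq x
      have hy := Real.sin_sq_add_cos_sq y
      linear_combination (Real.sin y * Real.cos v * Real.sin u +
          Real.cos u * Real.cos v * Real.cos y) * hx +
        (Real.sin x * Real.sin v * Real.cos u - Real.cos u * Real.cos v * Real.cos x) * hy
  have h4 := h3 k
  rw [Finset.sum_add_distrib, ← h1, ← h2] at h4
  simp only [sub_self, zero_mul, Real.cos_zero, Real.sin_zero, mul_one, mul_zero, add_zero] at h4
  linarith


/-- The power traces as functions of the eigenangles. -/
def pT (k : ℕ) (θ : Fin N → ℝ) : ℝ := 1 + 2 * ∑ j, Real.cos (k * θ j)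

/-- Values of polynomials in the power traces, as functions of the eigenangles. -/
def evT (θ : Fin N → ℝ) : MvPolynomial ℕ ℝ →ₐ[ℝ] ℝ := aeval fun k => pT k θ

/-- The square root of the Weyl density. -/
def weyl (θ : Fin N → ℝ) : ℝ :=
  (∏ i, Real.sin (θ i / 2)) * ∏ i, ∏ j ∈ Finset.Ioi i, (Real.cos (θ j) - Real.cos (θ i))

/-- The direction `(sin (k θ_j))_j`. -/
def sinDir (k : ℕ) (θ : Fin N → ℝ) : Fin N → ℝ := fun j => Real.sin (k * θ j)

lemma hasLineDerivAt_prod {ι : Type*} (s : Finset ι) {f : ι → (Fin N → ℝ) → ℝ} {c : ι → ℝ}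
    {θ v : Fin N → ℝ} (h : ∀ i ∈ s, HasLineDerivAt ℝ (f i) (f i θ * c i) θ v) :
    HasLineDerivAt ℝ (fun θ => ∏ i ∈ s, f i θ) ((∏ i ∈ s, f i θ) * ∑ i ∈ s, c i) θ v := by
  classical
  induction s using Finset.induction_on with
  | empty =>
    simp only [Finset.prod_empty, Finset.sum_empty, mul_zero]
    exact hasDerivAt_const _ _
  | insert i s hi ih =>
    simp only [Finset.prod_insert hi, Finset.sum_insert hi]
    have h1 := HasDerivAt.fun_mul (h i (by simp)) (ih fun j hj => h j (by simp [hj]))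
    simp only [zero_smul, add_zero] at h1
    refine HasDerivAt.congr_deriv h1 ?_
    ring

lemma hasLineDerivAt_coord (j : Fin N) (θ v : Fin N → ℝ) :
    HasDerivAt (fun t : ℝ => (θ + t • v) j) (v j) 0 := by
  have h : HasDerivAt (fun t : ℝ => θ j + t * v j) (1 * v j) 0 :=
    ((hasDerivAt_id (0 : ℝ)).mul_const (v j)).const_add (θ j)
  simpa using h

/-- The logarithmic derivative of the square root of the Weyl density along `sinDir k`. -/
def weylCoeff (k : ℕ) (θ : Fin N → ℝ) : ℝ :=
  (∑ j, (1 / 2 : ℝ) * ∑ m ∈ Finset.range k,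
      (Real.cos (m * θ j) + Real.cos ((m + 1 : ℕ) * θ j))) +
    ∑ i, ∑ j ∈ Finset.Ioi i, (cosConv k (θ j) (θ i) + cosConv k (θ i) (θ j))

lemma hasLineDerivAt_weyl (k : ℕ) (θ : Fin N → ℝ) :
    HasLineDerivAt ℝ weyl (weyl θ * weylCoeff k θ) θ (sinDir k θ) := by
  have h1 : HasLineDerivAt ℝ (fun θ : Fin N → ℝ => ∏ i, Real.sin (θ i / 2))
      ((∏ i, Real.sin (θ i / 2)) * (∑ j, (1 / 2 : ℝ) * ∑ m ∈ Finset.range k,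
      (Real.cos (m * θ j) + Real.cos ((m + 1 : ℕ) * θ j)))) θ (sinDir k θ) := by
    refine hasLineDerivAt_prod _ fun j _ => ?_
    have h := ((hasLineDerivAt_coord j θ (sinDir k θ)).div_const 2).sin
    refine HasDerivAt.congr_deriv h ?_
    have := sin_mul_cos_half k (θ j)
    simp only [zero_smul, add_zero, sinDir]
    linear_combination (1 / 2 : ℝ) * this
  have h2 : HasLineDerivAt ℝ
      (fun θ : Fin N → ℝ => ∏ i, ∏ j ∈ Finset.Ioi i, (Real.cos (θ j) - Real.cos (θ i)))
      ((∏ i, ∏ j ∈ Finset.Ioi i, (Real.cos (θ j) - Real.cos (θ i))) *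
        ∑ i, ∑ j ∈ Finset.Ioi i, (cosConv k (θ j) (θ i) + cosConv k (θ i) (θ j)))
      θ (sinDir k θ) := by
    refine hasLineDerivAt_prod _ fun i _ => hasLineDerivAt_prod _ fun j _ => ?_
    have h := (hasLineDerivAt_coord j θ (sinDir k θ)).cos.fun_sub
      (hasLineDerivAt_coord i θ (sinDir k θ)).cos
    refine HasDerivAt.congr_deriv h ?_
    have := sin_mul_sin_sub k (θ j) (θ i)
    simp only [zero_smul, add_zero, sinDir]
    linear_combination -this
  have h3 := HasDerivAt.fun_mul h1 h2
  simp only [zero_smul, add_zero] at h3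
  refine HasDerivAt.congr_deriv h3 ?_
  simp only [weyl, weylCoeff]
  ring

lemma hasLineDerivAt_pT (k l : ℕ) (θ : Fin N → ℝ) :
    HasLineDerivAt ℝ (pT l) (-(l : ℝ) / 2 * (pT ((k - l) + (l - k)) θ - pT (k + l) θ))
      θ (sinDir k θ) := by
  have h : HasDerivAt (fun t : ℝ => pT l (θ + t • sinDir k θ)) _ 0 :=
    ((HasDerivAt.fun_sum fun j (_ : j ∈ Finset.univ) =>
      ((hasLineDerivAt_coord j θ (sinDir k θ)).const_mul (l : ℝ)).cos).const_mul 2).const_add 1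
  refine HasDerivAt.congr_deriv h ?_
  simp only [zero_smul, add_zero, sinDir, pT]
  have h1 : ∀ x : ℝ, Real.cos (((k - l) + (l - k) : ℕ) * x) - Real.cos ((k + l : ℕ) * x) =
      2 * (Real.sin (l * x) * Real.sin (k * x)) := by
    intro x
    have h2 : Real.cos (((k - l) + (l - k) : ℕ) * x) = Real.cos (k * x - l * x) := by
      rcases le_total k l with h | h
      · obtain ⟨d, rfl⟩ := Nat.exists_eq_add_of_le h
        have : k - (k + d) + (k + d - k) = d := by omega
        rw [this, ← Real.cos_neg]
        congr 1
        push_cast; ring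
      · obtain ⟨d, rfl⟩ := Nat.exists_eq_add_of_le h
        have : l + d - l + (l - (l + d)) = d := by omega
        rw [this]
        congr 1
        push_cast; ring
    rw [h2, Nat.cast_add, add_mul, Real.cos_add, Real.cos_sub]
    ring
  have h3 := Finset.sum_congr (rfl : (Finset.univ : Finset (Fin N)) = _) fun j _ => h1 (θ j)
  rw [Finset.sum_sub_distrib, ← Finset.mul_sum] at h3
  have h4 : ∑ i, -Real.sin (l * θ i) * (l * Real.sin (k * θ i)) =
      -(l : ℝ) * ∑ i, Real.sin (l * θ i) * Real.sin (k * θ i) := by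
    rw [Finset.mul_sum]
    exact Finset.sum_congr rfl fun _ _ => by ring
  rw [h4]
  linear_combination (l : ℝ) * h3

lemma hasLineDerivAt_evT (k : ℕ) (F : MvPolynomial ℕ ℝ) (θ : Fin N → ℝ) :
    HasLineDerivAt ℝ (fun θ => evT θ F) (-(1 / 2) * evT θ (loopDer k F)) θ (sinDir k θ) := by
  induction F using MvPolynomial.induction_on with
  | C c =>
    simp only [evT, aeval_C, loopDer, derivation_C, map_zero, mul_zero]
    exact hasDerivAt_const _ _
  | add p q hp hq =>
    have h := HasDerivAt.fun_add hp hq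
    simp only [map_add, mul_add]
    exact h
  | mul_X p l hp =>
    have h := HasDerivAt.fun_mul hp (hasLineDerivAt_pT k l θ)
    have e : ∀ θ : Fin N → ℝ, evT θ (X l) = pT l θ := fun θ => by simp [evT]
    simp only [map_mul, e]
    refine HasDerivAt.congr_deriv h ?_
    simp only [Derivation.leibniz, loopDer, mkDerivation_X, map_add, map_mul, map_sub, e,
      smul_eq_mul, zero_smul, add_zero]
    simp [evT]
    ring

lemma evT_loopCoeff (k : ℕ) (θ : Fin N → ℝ) :
    evT θ (loopCoeff k) + k * (pT k θ - 1) = -4 * weylCoeff k θ := by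
  have h1 : ∑ i, ∑ j ∈ Finset.Ioi i, (cosConv k (θ j) (θ i) + cosConv k (θ i) (θ j)) =
      ∑ i, ∑ j, cosConv k (θ j) (θ i) - ∑ i, cosConv k (θ i) (θ i) := by
    rw [Finset.sum_sum_Ioi_add_eq_sum_sum_off_diag fun i j => cosConv k (θ i) (θ j),
      ← Finset.sum_sub_distrib]
    refine Finset.sum_congr rfl fun i _ => ?_
    rw [← Finset.sum_add_sum_compl {i}]
    simp
  have h2 : ∑ i, ∑ j, cosConv k (θ j) (θ i) = ∑ m ∈ Finset.range k,
      (∑ j, Real.cos (m * θ j)) * ∑ j, Real.cos ((k - m : ℕ) * θ j) := by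
    simp only [cosConv]
    simp_rw [Finset.sum_comm (s := Finset.univ) (t := Finset.range k)]
    refine Finset.sum_congr rfl fun m _ => ?_
    rw [Finset.sum_mul_sum, Finset.sum_comm]
  have h3 : ∑ i, cosConv k (θ i) (θ i) = ∑ m ∈ Finset.range k, (1 / 2 : ℝ) *
      (∑ j, Real.cos (k * θ j) + ∑ j, Real.cos (((2 * m - k) + (k - 2 * m) : ℕ) * θ j)) := by
    simp only [cosConv]
    rw [Finset.sum_comm]
    refine Finset.sum_congr rfl fun m hm => ?_
    rw [← Finset.sum_add_distrib, Finset.mul_sum]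
    refine Finset.sum_congr rfl fun j _ => ?_
    have hm' := Finset.mem_range.1 hm
    have e1 : (k : ℝ) * θ j = m * θ j + (k - m : ℕ) * θ j := by
      rw [Nat.cast_sub hm'.le]; ring
    have e2 : Real.cos (((2 * m - k) + (k - 2 * m) : ℕ) * θ j) =
        Real.cos (m * θ j - (k - m : ℕ) * θ j) := by
      rcases le_total (2 * m) k with h | h
      · rw [show 2 * m - k + (k - 2 * m) = k - 2 * m by omega, ← Real.cos_neg, Nat.cast_sub h,
          Nat.cast_sub hm'.le]
        congr 1
        push_cast; ring
      · rw [show 2 * m - k + (k - 2 * m) = 2 * m - k by omega, Nat.cast_sub h,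
          Nat.cast_sub hm'.le]
        congr 1
        push_cast; ring
    rw [e2, e1, Real.cos_add, Real.cos_sub]
    ring
  have h4 : ∑ m ∈ Finset.range k, ∑ j, Real.cos ((m + 1 : ℕ) * θ j) =
      ∑ m ∈ Finset.range k, ∑ j, Real.cos ((k - m : ℕ) * θ j) := by
    rw [← Finset.sum_range_reflect]
    refine Finset.sum_congr rfl fun m hm => ?_
    have hm' := Finset.mem_range.1 hm
    rw [show k - 1 - m + 1 = k - m by omega]
  have h5 : ∑ j, (1 / 2 : ℝ) * ∑ m ∈ Finset.range k,
      (Real.cos (m * θ j) + Real.cos ((m + 1 : ℕ) * θ j)) = ∑ m ∈ Finset.range k, (1 / 2 : ℝ) *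
        (∑ j, Real.cos (m * θ j) + ∑ j, Real.cos ((k - m : ℕ) * θ j)) := by
    rw [← Finset.mul_sum, ← Finset.mul_sum, Finset.sum_comm]
    congr 1
    simp only [Finset.sum_add_distrib]
    rw [h4]
  rw [weylCoeff, h1, h2, h3, h5, ← Finset.sum_sub_distrib, ← Finset.sum_add_distrib,
    Finset.mul_sum]
  have h6 : (k : ℝ) * (pT k θ - 1) = ∑ m ∈ Finset.range k, (pT k θ - 1) := by
    rw [Finset.sum_const, Finset.card_range, nsmul_eq_mul]
  rw [h6]
  simp only [loopCoeff, map_sum, ← Finset.sum_add_distrib]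
  refine Finset.sum_congr rfl fun m hm => ?_
  simp only [evT, map_sub, map_mul, aeval_X, pT, Finset.sum_add_distrib]
  ring

end Torus

section Laplacian

open MvPolynomial

variable {N : ℕ}

/-- The Laplacian on the space of eigenangles. -/
def lap (f : (Fin N → ℝ) → ℝ) (θ : Fin N → ℝ) : ℝ :=
  ∑ j, deriv (deriv fun t : ℝ => f (θ + t • Pi.single j 1)) 0

lemma contDiff_line {f : (Fin N → ℝ) → ℝ} (hf : ContDiff ℝ 2 f) (θ v : Fin N → ℝ) :
    ContDiff ℝ 2 fun t : ℝ => f (θ + t • v) := by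
  fun_prop

lemma deriv_line {f : (Fin N → ℝ) → ℝ} (hf : ContDiff ℝ 2 f) (θ v : Fin N → ℝ) :
    deriv (fun t : ℝ => f (θ + t • v)) 0 = fderiv ℝ f θ v :=
  ((hf.differentiable (by norm_num) θ).hasFDerivAt.hasLineDerivAt v).deriv

lemma differentiable_deriv {u : ℝ → ℝ} (hu : ContDiff ℝ 2 u) : Differentiable ℝ (deriv u) := by
  have h : ContDiff ℝ (1 + 1) u := by rwa [one_add_one_eq_two]
  exact h.deriv'.differentiable one_ne_zero

lemma deriv_deriv_add {u v : ℝ → ℝ} (hu : ContDiff ℝ 2 u) (hv : ContDiff ℝ 2 v) (x : ℝ) :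
    deriv (deriv fun t => u t + v t) x = deriv (deriv u) x + deriv (deriv v) x := by
  have hu1 := hu.differentiable (by norm_num)
  have hv1 := hv.differentiable (by norm_num)
  have h : (deriv fun t => u t + v t) = fun t => deriv u t + deriv v t :=
    funext fun t => deriv_fun_add (hu1 t) (hv1 t)
  have hu2 := differentiable_deriv hu
  have hv2 := differentiable_deriv hv
  rw [h, deriv_fun_add (hu2 x) (hv2 x)]

lemma deriv_deriv_mul {u v : ℝ → ℝ} (hu : ContDiff ℝ 2 u) (hv : ContDiff ℝ 2 v) (x : ℝ) :
    deriv (deriv fun t => u t * v t) x =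
      deriv (deriv u) x * v x + 2 * (deriv u x * deriv v x) + u x * deriv (deriv v) x := by
  have hu1 := hu.differentiable (by norm_num)
  have hv1 := hv.differentiable (by norm_num)
  have h : (deriv fun t => u t * v t) = fun t => deriv u t * v t + u t * deriv v t :=
    funext fun t => deriv_fun_mul (hu1 t) (hv1 t)
  have hu2 := differentiable_deriv hu
  have hv2 := differentiable_deriv hv
  rw [h, deriv_fun_add ((hu2 x).fun_mul (hv1 x)) ((hu1 x).fun_mul (hv2 x)),
    deriv_fun_mul (hu2 x) (hv1 x), deriv_fun_mul (hu1 x) (hv2 x)]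
  ring

lemma lap_add {f g : (Fin N → ℝ) → ℝ} (hf : ContDiff ℝ 2 f) (hg : ContDiff ℝ 2 g)
    (θ : Fin N → ℝ) : lap (fun θ => f θ + g θ) θ = lap f θ + lap g θ := by
  simp only [lap, ← Finset.sum_add_distrib]
  exact Finset.sum_congr rfl fun j _ =>
    deriv_deriv_add (contDiff_line hf θ _) (contDiff_line hg θ _) 0

lemma lap_mul {f g : (Fin N → ℝ) → ℝ} (hf : ContDiff ℝ 2 f) (hg : ContDiff ℝ 2 g)
    (θ : Fin N → ℝ) : lap (fun θ => f θ * g θ) θ = lap f θ * g θ +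
      2 * ∑ j, fderiv ℝ f θ (Pi.single j 1) * fderiv ℝ g θ (Pi.single j 1) + f θ * lap g θ := by
  simp only [lap, Finset.sum_mul, Finset.mul_sum, ← Finset.sum_add_distrib]
  refine Finset.sum_congr rfl fun j _ => ?_
  rw [deriv_deriv_mul (contDiff_line hf θ _) (contDiff_line hg θ _) 0, deriv_line hf,
    deriv_line hg]
  simp

lemma lap_const_mul {f : (Fin N → ℝ) → ℝ} (c : ℝ) (θ : Fin N → ℝ) :
    lap (fun θ => c * f θ) θ = c * lap f θ := by
  simp only [lap, Finset.mul_sum]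
  refine Finset.sum_congr rfl fun j _ => ?_
  rw [← deriv_const_mul_field]
  congr 1
  ext t
  rw [deriv_const_mul_field]

lemma contDiff_pT (k : ℕ) : ContDiff ℝ 2 (pT (N := N) k) := by
  unfold pT; fun_prop

lemma contDiff_evT (F : MvPolynomial ℕ ℝ) : ContDiff ℝ 2 fun θ : Fin N → ℝ => evT θ F := by
  induction F using MvPolynomial.induction_on with
  | C c => simpa [evT] using contDiff_const
  | add p q hp hq => simpa using hp.add hq
  | mul_X p l hp =>
    have e : ∀ θ : Fin N → ℝ, evT θ (X l) = pT l θ := fun θ => by simp [evT]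
    simp only [map_mul, e]
    exact hp.mul (contDiff_pT l)

lemma contDiff_weyl : ContDiff ℝ 2 (weyl (N := N)) := by
  unfold weyl
  refine ContDiff.mul (contDiff_prod fun i _ => by fun_prop)
    (contDiff_prod fun i _ => contDiff_prod fun j _ => by fun_prop)

lemma hasDerivAt_pT_line (k : ℕ) (θ : Fin N → ℝ) (j : Fin N) (x : ℝ) :
    HasDerivAt (fun t : ℝ => pT k (θ + t • Pi.single j 1))
      (-2 * k * Real.sin (k * (θ j + x))) x := by
  have h1 : ∀ t : ℝ, pT k (θ + t • Pi.single j 1) = 1 + 2 * (Real.cos (k * (θ j + t)) +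
      ∑ i ∈ Finset.univ.erase j, Real.cos (k * θ i)) := by
    intro t
    rw [pT, ← Finset.add_sum_erase _ _ (Finset.mem_univ j)]
    congr 3
    · simp
    · refine Finset.sum_congr rfl fun i hi => ?_
      simp [Pi.single_eq_of_ne (Finset.ne_of_mem_erase hi)]
  simp only [h1]
  have h := ((((((hasDerivAt_id x).const_add (θ j)).const_mul (k : ℝ)).cos).add_const
    (∑ i ∈ Finset.univ.erase j, Real.cos (k * θ i))).const_mul 2).const_add 1
  refine h.congr_deriv ?_
  simp
  ring

lemma fderiv_pT (k : ℕ) (θ : Fin N → ℝ) (j : Fin N) :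
    fderiv ℝ (pT k) θ (Pi.single j 1) = -2 * k * sinDir k θ j := by
  rw [← deriv_line (contDiff_pT k), (hasDerivAt_pT_line k θ j 0).deriv]
  simp [sinDir]

lemma lap_pT (k : ℕ) (θ : Fin N → ℝ) : lap (pT k) θ = -(k : ℝ) ^ 2 * (pT k θ - 1) := by
  have h : ∀ j, deriv (deriv fun t : ℝ => pT k (θ + t • Pi.single j 1)) 0 =
      -2 * (k : ℝ) ^ 2 * Real.cos (k * θ j) := by
    intro j
    have h1 : (deriv fun t : ℝ => pT k (θ + t • Pi.single j 1)) =
        fun t => -2 * k * Real.sin (k * (θ j + t)) :=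
      funext fun t => (hasDerivAt_pT_line k θ j t).deriv
    rw [h1]
    have h2 := ((((hasDerivAt_id (0 : ℝ)).const_add (θ j)).const_mul (k : ℝ)).sin).const_mul
      (-2 * (k : ℝ))
    have h3 := h2.deriv
    simp only [id, add_zero, mul_one] at h3
    rw [h3]
    ring
  rw [lap, Finset.sum_congr rfl fun j _ => h j, ← Finset.mul_sum, pT]
  ring

lemma fderiv_eq_sum (f : (Fin N → ℝ) → ℝ) (θ v : Fin N → ℝ) :
    fderiv ℝ f θ v = ∑ j, v j * fderiv ℝ f θ (Pi.single j 1) := by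
  conv_lhs => rw [← Finset.univ_sum_single v, map_sum]
  refine Finset.sum_congr rfl fun j _ => ?_
  have : (Pi.single j (v j) : Fin N → ℝ) = v j • Pi.single j 1 := by
    rw [← Pi.single_smul]; simp
  rw [this, map_smul, smul_eq_mul]

lemma lap_mul_pT {f : (Fin N → ℝ) → ℝ} (hf : ContDiff ℝ 2 f) (k : ℕ) (θ : Fin N → ℝ) :
    lap (fun θ => f θ * pT k θ) θ = lap f θ * pT k θ - 4 * k * fderiv ℝ f θ (sinDir k θ) -
      k ^ 2 * (pT k θ - 1) * f θ := by
  rw [lap_mul hf (contDiff_pT k), lap_pT, fderiv_eq_sum f θ (sinDir k θ)]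
  simp only [fderiv_pT]
  have : ∑ j, fderiv ℝ f θ (Pi.single j 1) * (-2 * k * sinDir k θ j) =
      -2 * k * ∑ j, sinDir k θ j * fderiv ℝ f θ (Pi.single j 1) := by
    rw [Finset.mul_sum]
    exact Finset.sum_congr rfl fun _ _ => by ring
  rw [this]
  ring

/-- The second order operator on polynomials corresponding to the radial Laplacian. -/
def lapPoly (K : ℕ) (F : MvPolynomial ℕ ℝ) : MvPolynomial ℕ ℝ :=
  ∑ k ∈ Finset.range K, C (k : ℝ) * (loopCoeff k * pderiv k F + loopDer k (pderiv k F))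

lemma loopDer_eq_sum (F : MvPolynomial ℕ ℝ) : ∃ K₀, ∀ K ≥ K₀, ∀ l,
    loopDer l F = ∑ k ∈ Finset.range K,
      pderiv k F * (C (k : ℝ) * (X ((l - k) + (k - l)) - X (l + k))) := by
  induction F using MvPolynomial.induction_on with
  | C c => exact ⟨0, fun K _ l => by simp [loopDer]⟩
  | add p q hp hq =>
    obtain ⟨K₁, h₁⟩ := hp
    obtain ⟨K₂, h₂⟩ := hq
    refine ⟨max K₁ K₂, fun K hK l => ?_⟩
    rw [map_add, h₁ K (le_of_max_le_left hK) l, h₂ K (le_of_max_le_right hK) l,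
      ← Finset.sum_add_distrib]
    exact Finset.sum_congr rfl fun k _ => by rw [map_add]; ring
  | mul_X p i hp =>
    obtain ⟨K₁, h₁⟩ := hp
    refine ⟨max K₁ (i + 1), fun K hK l => ?_⟩
    have hi : i ∈ Finset.range K := Finset.mem_range.2 (le_of_max_le_right hK)
    have h2 : loopDer l (X i : MvPolynomial ℕ ℝ) =
        C (i : ℝ) * (X ((l - i) + (i - l)) - X (l + i)) := by simp [loopDer, mkDerivation_X]
    simp only [Derivation.leibniz, smul_eq_mul, pderiv_X, add_mul, Finset.sum_add_distrib]
    rw [h₁ K (le_of_max_le_left hK) l, h2, Finset.mul_sum]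
    congr 1
    · rw [Finset.sum_eq_single_of_mem i hi]
      · simp
      · intro b _ hb
        simp [hb.symm]
    · exact Finset.sum_congr rfl fun k _ => by ring

lemma fderiv_weyl_mul_evT (k : ℕ) (F : MvPolynomial ℕ ℝ) (θ : Fin N → ℝ) :
    fderiv ℝ (fun θ => weyl θ * evT θ F) θ (sinDir k θ) =
      weyl θ * (weylCoeff k θ * evT θ F - 1 / 2 * evT θ (loopDer k F)) := by
  rw [← deriv_line (contDiff_weyl.mul (contDiff_evT F))]
  have h := HasDerivAt.fun_mul (hasLineDerivAt_weyl k θ) (hasLineDerivAt_evT k F θ)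
  rw [h.deriv]
  simp only [zero_smul, add_zero]
  ring

lemma lap_weyl_mul_evT {c : ℝ} (hc : ∀ θ : Fin N → ℝ, lap weyl θ = -c * weyl θ)
    (F : MvPolynomial ℕ ℝ) : ∃ K₀, ∀ K ≥ K₀, ∀ θ : Fin N → ℝ,
      lap (fun θ => weyl θ * evT θ F) θ + c * (weyl θ * evT θ F) =
        weyl θ * evT θ (lapPoly K F) := by
  induction F using MvPolynomial.induction_on with
  | C a =>
    refine ⟨0, fun K _ θ => ?_⟩
    have h1 : lapPoly K (C a) = 0 := by simp [lapPoly]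
    have h2 : (fun θ : Fin N → ℝ => weyl θ * evT θ (C a)) = fun θ => a * weyl θ := by
      funext θ; simp [evT, mul_comm]
    rw [h1, h2, lap_const_mul, hc]
    simp [evT]
    ring
  | add p q hp hq =>
    obtain ⟨K₁, h₁⟩ := hp
    obtain ⟨K₂, h₂⟩ := hq
    refine ⟨max K₁ K₂, fun K hK θ => ?_⟩
    have h3 : lapPoly K (p + q) = lapPoly K p + lapPoly K q := by
      simp only [lapPoly, map_add, ← Finset.sum_add_distrib]
      exact Finset.sum_congr rfl fun k _ => by ring
    simp only [h3, map_add, mul_add]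
    rw [← h₁ K (le_of_max_le_left hK), ← h₂ K (le_of_max_le_right hK),
      lap_add (contDiff_weyl.mul (contDiff_evT p)) (contDiff_weyl.mul (contDiff_evT q))]
    ring
  | mul_X p l hp =>
    obtain ⟨K₁, h₁⟩ := hp
    obtain ⟨K₂, h₂⟩ := loopDer_eq_sum p
    refine ⟨max K₁ (max K₂ (l + 1)), fun K hK θ => ?_⟩
    have hl : l ∈ Finset.range K :=
      Finset.mem_range.2 (le_of_max_le_right (le_of_max_le_right hK))
    have e : ∀ θ : Fin N → ℝ, evT θ (X l) = pT l θ := fun θ => by simp [evT]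
    have h3 : lapPoly K (p * X l) = lapPoly K p * X l + C (l : ℝ) * (loopCoeff l * p) +
        C (2 * l : ℝ) * loopDer l p := by
      have h4 : ∀ k, loopDer k (X l : MvPolynomial ℕ ℝ) =
          C (l : ℝ) * (X ((k - l) + (l - k)) - X (k + l)) := by
        intro k; simp [loopDer, mkDerivation_X]
      have h5 : ∀ k : ℕ, C (k : ℝ) * (loopCoeff k * pderiv k (p * X l) +
          loopDer k (pderiv k (p * X l))) =
          C (k : ℝ) * (loopCoeff k * pderiv k p + loopDer k (pderiv k p)) * X l +
          C (l : ℝ) * (pderiv k p * (C (k : ℝ) * (X ((l - k) + (k - l)) - X (l + k)))) +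
          (if k = l then C (l : ℝ) * (loopCoeff l * p + loopDer l p) else 0) := by
        intro k
        rw [add_comm (l - k), add_comm l k]
        split_ifs with hkl
        · subst hkl
          simp only [Derivation.leibniz, smul_eq_mul, pderiv_X_self, mul_one, map_add, h4]
          ring
        · simp only [Derivation.leibniz, smul_eq_mul, pderiv_X_of_ne (Ne.symm hkl), mul_zero,
            zero_add, h4]
          ring
      simp only [lapPoly, h5, Finset.sum_add_distrib, Finset.sum_ite_eq', hl, if_true,
        ← Finset.sum_mul, ← Finset.mul_sum]
      rw [← h₂ K (le_of_max_le_left (le_of_max_le_right hK)) l, map_mul]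
      simp only [map_ofNat]
      ring
    have h6 := lap_mul_pT (contDiff_weyl.mul (contDiff_evT p)) l θ
    have h7 := h₁ K (le_of_max_le_left hK) θ
    have h8 := evT_loopCoeff l θ
    simp only [h3, map_mul, map_add, e]
    have h9 : ∀ a : ℝ, evT θ (C a) = a := fun a => by simp [evT]
    simp only [h9]
    have h10 : (fun θ : Fin N → ℝ => weyl θ * (evT θ p * pT l θ)) =
        fun θ => weyl θ * evT θ p * pT l θ := by funext θ; ring
    rw [h10, h6, fderiv_weyl_mul_evT]
    linear_combination (pT l θ) * h7 + (-(l : ℝ) * weyl θ * evT θ p) * h8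

lemma integral_lapPoly {n : Type*} [Fintype n] [DecidableEq n]
    {μ : Measure (Matrix n n ℝ)} [IsProbabilityMeasure μ]
    (hμ : ∀ᵐ A ∂μ, A ∈ specialOrthogonalGroup n ℝ)
    (hinv : ∀ g ∈ specialOrthogonalGroup n ℝ, μ.map (fun A => g * A) = μ)
    (K : ℕ) (F : MvPolynomial ℕ ℝ) : ∫ A, evM A (lapPoly K F) ∂μ = 0 := by
  simp only [lapPoly, map_sum]
  rw [integral_finsetSum _ fun k _ => integrable_evM hμ _]
  refine Finset.sum_eq_zero fun k _ => ?_
  have h : ∀ A : Matrix n n ℝ, evM A (C (k : ℝ)) = k := fun A => by simp [evM]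
  simp only [map_mul, h]
  rw [integral_const_mul, integral_loop hμ hinv, mul_zero]

end Laplacian

section Tensor

variable {N M : ℕ}

/-- The product of sines attached to a multi-index. -/
def sinProd (s : Fin N → Fin (N + M)) (θ : Fin N → ℝ) : ℝ :=
  ∏ i, Real.sin (((s i : ℕ) + 1 / 2 : ℝ) * θ i)

/-- The trigonometric polynomial attached to a tensor. -/
def realize (Ψ : (Fin N → Fin (N + M)) → ℝ) (θ : Fin N → ℝ) : ℝ :=
  ∑ s, Ψ s * sinProd s θ

/-- The multi-index `(0, 1, …, N - 1)`. -/
def ground (N M : ℕ) : Fin N → Fin (N + M) := Fin.castAdd M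

/-- The antisymmetrization of the multi-index `(0, 1, …, N - 1)`. -/
def vac (s : Fin N → Fin (N + M)) : ℝ :=
  ∑ σ : Equiv.Perm (Fin N), if s = ground N M ∘ σ then ((σ.sign : ℤ) : ℝ) else 0

/-- Antisymmetric tensors. -/
def Antisymm (Ψ : (Fin N → Fin (N + M)) → ℝ) : Prop :=
  ∀ (σ : Equiv.Perm (Fin N)) (s), Ψ (s ∘ σ) = ((σ.sign : ℤ) : ℝ) * Ψ s

lemma sum_vac_mul (f : (Fin N → Fin (N + M)) → ℝ) :
    ∑ s, vac s * f s = ∑ σ : Equiv.Perm (Fin N), ((σ.sign : ℤ) : ℝ) * f (ground N M ∘ σ) := by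
  simp only [vac, Finset.sum_mul, ite_mul, zero_mul]
  rw [Finset.sum_comm]
  simp

lemma ground_injective : Function.Injective (ground N M) := Fin.castAdd_injective N M

lemma ground_comp_injective {σ τ : Equiv.Perm (Fin N)}
    (h : ground N M ∘ σ = ground N M ∘ τ) : σ = τ :=
  Equiv.ext fun i => ground_injective (congrFun h i)

lemma vac_ground_comp (σ : Equiv.Perm (Fin N)) :
    vac (ground N M ∘ σ) = ((σ.sign : ℤ) : ℝ) := by
  rw [vac, Finset.sum_eq_single_of_mem σ (Finset.mem_univ σ)]
  · simp
  · intro τ _ hτ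
    rw [if_neg fun h => hτ (ground_comp_injective h).symm]

lemma vac_ground : vac (ground N M) = 1 := by
  simpa using vac_ground_comp (M := M) (1 : Equiv.Perm (Fin N))

lemma vac_eq_zero {s : Fin N → Fin (N + M)} (h : ∀ σ : Equiv.Perm (Fin N), s ≠ ground N M ∘ σ) :
    vac s = 0 :=
  Finset.sum_eq_zero fun σ _ => if_neg (h σ)

lemma Antisymm.eq_zero {Ψ : (Fin N → Fin (N + M)) → ℝ} (hΨ : Antisymm Ψ)
    {s : Fin N → Fin (N + M)} (hs : ¬ Function.Injective s) : Ψ s = 0 := by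
  simp only [Function.Injective, not_forall] at hs
  obtain ⟨i, j, hij, hne⟩ := hs
  have h := hΨ (Equiv.swap i j) s
  have h2 : s ∘ Equiv.swap i j = s := by
    funext k
    simp only [Function.comp_apply, Equiv.swap_apply_def]
    split_ifs with h1 h2
    · rw [h1, hij]
    · rw [h2, hij]
    · rfl
  rw [h2, Equiv.Perm.sign_swap hne] at h
  simp at h
  linarith

lemma exists_perm {s : Fin N → Fin (N + M)} (hs : Function.Injective s)
    (h : ∀ i, (s i : ℕ) < N) : ∃ σ : Equiv.Perm (Fin N), s = ground N M ∘ σ := by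
  let f : Fin N → Fin N := fun i => ⟨s i, h i⟩
  have hf : Function.Injective f := fun i j hij => hs (Fin.ext (by simpa [f] using hij))
  refine ⟨Equiv.ofBijective f (Finite.injective_iff_bijective.1 hf), ?_⟩
  funext i
  exact Fin.ext (by simp [f, ground])

lemma Antisymm.eq_vac {Ψ : (Fin N → Fin (N + M)) → ℝ} (hΨ : Antisymm Ψ)
    (h : ∀ s, Ψ s ≠ 0 → ∀ i, (s i : ℕ) < N) (s) : Ψ s = Ψ (ground N M) * vac s := by
  by_cases hs : ∃ σ : Equiv.Perm (Fin N), s = ground N M ∘ σ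
  · obtain ⟨σ, rfl⟩ := hs
    rw [hΨ, vac_ground_comp, mul_comm]
  · push Not at hs
    rw [vac_eq_zero hs, mul_zero]
    by_contra h0
    have h1 : Function.Injective s := by
      by_contra hi
      exact h0 (hΨ.eq_zero hi)
    obtain ⟨σ, hσ⟩ := exists_perm h1 (h s h0)
    exact hs σ hσ

lemma antisymm_vac : Antisymm (vac (N := N) (M := M)) := by
  intro σ s
  by_cases hs : ∃ τ : Equiv.Perm (Fin N), s = ground N M ∘ τ
  · obtain ⟨τ, rfl⟩ := hs
    have : (ground N M ∘ τ) ∘ σ = ground N M ∘ ((τ * σ : Equiv.Perm (Fin N))) := rfl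
    rw [this, vac_ground_comp, vac_ground_comp, map_mul]
    push_cast
    ring
  · push Not at hs
    rw [vac_eq_zero hs, vac_eq_zero, mul_zero]
    intro τ hτ
    refine hs (τ * σ⁻¹) ?_
    funext i
    have := congrFun hτ (σ⁻¹ i)
    simpa using this

/-- Monic polynomials representing `sin ((n + 1/2) θ) / sin (θ / 2)` in `cos θ`. -/
def sinPoly : ℕ → Polynomial ℝ
  | 0 => 1
  | 1 => Polynomial.X + Polynomial.C (1 / 2)
  | n + 2 => Polynomial.X * sinPoly (n + 1) - Polynomial.C (1 / 4) * sinPoly n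

lemma sinPoly_monic (n : ℕ) : (sinPoly n).Monic ∧ (sinPoly n).natDegree = n ∧
    (sinPoly (n + 1)).Monic ∧ (sinPoly (n + 1)).natDegree = n + 1 := by
  induction n with
  | zero =>
    refine ⟨Polynomial.monic_one, Polynomial.natDegree_one, ?_, ?_⟩
    · exact Polynomial.monic_X_add_C _
    · exact Polynomial.natDegree_X_add_C _
  | succ n ih =>
    obtain ⟨h1, h2, h3, h4⟩ := ih
    have h5 : (Polynomial.X * sinPoly (n + 1)).Monic := Polynomial.monic_X.mul h3
    have h6 : (Polynomial.X * sinPoly (n + 1)).natDegree = n + 2 := by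
      rw [Polynomial.monic_X.natDegree_mul h3, h4, Polynomial.natDegree_X]; ring
    have h7 : (Polynomial.C (1 / 4) * sinPoly n).degree <
        (Polynomial.X * sinPoly (n + 1)).degree := by
      refine Polynomial.degree_lt_degree ?_
      rw [h6]
      exact (Polynomial.natDegree_C_mul_le _ _).trans_lt (by omega)
    refine ⟨h3, h4, ?_, ?_⟩
    · exact h5.sub_of_left h7
    · have h8 := Polynomial.natDegree_sub_eq_left_of_natDegree_lt
        (p := Polynomial.X * sinPoly (n + 1)) (q := Polynomial.C (1 / 4) * sinPoly n)
        (by rw [h6]; exact (Polynomial.natDegree_C_mul_le _ _).trans_lt (by omega))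
      exact h8.trans h6

lemma sin_eq_sinPoly (n : ℕ) (x : ℝ) :
    Real.sin ((n + 1 / 2 : ℝ) * x) =
      2 ^ n * (Real.sin (x / 2) * (sinPoly n).eval (Real.cos x)) ∧
    Real.sin (((n + 1 : ℕ) + 1 / 2 : ℝ) * x) =
      2 ^ (n + 1) * (Real.sin (x / 2) * (sinPoly (n + 1)).eval (Real.cos x)) := by
  induction n with
  | zero =>
    constructor
    · simp [sinPoly]; ring_nf
    · have e1 : ((0 + 1 : ℕ) + 1 / 2 : ℝ) * x = x + x / 2 := by push_cast; ring
      have h1 : Real.sin x = 2 * Real.sin (x / 2) * Real.cos (x / 2) := by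
        rw [← Real.sin_two_mul]; ring_nf
      have h2 : Real.cos x = 2 * Real.cos (x / 2) ^ 2 - 1 := by
        rw [← Real.cos_two_mul]; ring_nf
      rw [e1, Real.sin_add, h1]
      simp only [sinPoly, zero_add, pow_one, Polynomial.eval_add, Polynomial.eval_X,
        Polynomial.eval_C]
      rw [h2]
      ring
  | succ n ih =>
    refine ⟨ih.2, ?_⟩
    have e1 : (((n + 1 + 1 : ℕ) : ℝ) + 1 / 2 : ℝ) * x = ((n + 1 : ℕ) + 1 / 2 : ℝ) * x + x := by
      push_cast; ring
    have e2 : ((n : ℝ) + 1 / 2 : ℝ) * x = ((n + 1 : ℕ) + 1 / 2 : ℝ) * x - x := by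
      push_cast; ring
    have h1 := ih.1
    have h2 := ih.2
    rw [e2, Real.sin_sub] at h1
    rw [e1, Real.sin_add]
    simp only [sinPoly, Polynomial.eval_sub, Polynomial.eval_mul, Polynomial.eval_X,
      Polynomial.eval_C]
    rw [pow_succ, pow_succ] at *
    linear_combination -h1 + 2 * Real.cos x * h2

lemma realize_vac (θ : Fin N → ℝ) :
    realize (M := M) vac θ = (∏ i : Fin N, (2 : ℝ) ^ (i : ℕ)) * weyl θ := by
  have h1 : realize (M := M) vac θ =
      (Matrix.of fun i j : Fin N => Real.sin (((i : ℕ) + 1 / 2 : ℝ) * θ j)).det := by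
    rw [realize, sum_vac_mul, Matrix.det_apply']
    rfl
  have h2 : (Matrix.of fun i j : Fin N => Real.sin (((i : ℕ) + 1 / 2 : ℝ) * θ j)) =
      Matrix.of fun i j : Fin N => (2 : ℝ) ^ (i : ℕ) * (Matrix.of fun i j : Fin N =>
        Real.sin (θ j / 2) * (Matrix.of fun i j : Fin N =>
          (sinPoly j).eval (Real.cos (θ i)))ᵀ i j) i j := by
    ext i j
    simpa using (sin_eq_sinPoly i (θ j)).1
  rw [h1, h2, Matrix.det_mul_column, Matrix.det_mul_row, Matrix.det_transpose,
    ← Matrix.det_eval_matrixOfPolynomials_eq_det_vandermonde (fun i => Real.cos (θ i))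
      (fun j : Fin N => sinPoly j) (fun i => (sinPoly_monic i).2.1)
      (fun i => (sinPoly_monic i).1), Matrix.det_vandermonde]
  rfl

lemma contDiff_sinProd (s : Fin N → Fin (N + M)) : ContDiff ℝ 2 (sinProd s) := by
  unfold sinProd
  exact contDiff_prod fun i _ => by fun_prop

lemma lap_sinProd (s : Fin N → Fin (N + M)) (θ : Fin N → ℝ) :
    lap (sinProd s) θ = -(∑ i, ((s i : ℕ) + 1 / 2 : ℝ) ^ 2) * sinProd s θ := by
  rw [lap, neg_mul, Finset.sum_mul, ← Finset.sum_neg_distrib]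
  refine Finset.sum_congr rfl fun j _ => ?_
  set c : ℝ := (s j : ℕ) + 1 / 2 with hc
  set R : ℝ := ∏ i ∈ Finset.univ.erase j, Real.sin (((s i : ℕ) + 1 / 2 : ℝ) * θ i) with hR
  have h1 : (fun t : ℝ => sinProd s (θ + t • Pi.single j 1)) =
      fun t => Real.sin (c * (θ j + t)) * R := by
    funext t
    rw [sinProd, ← Finset.mul_prod_erase _ _ (Finset.mem_univ j)]
    congr 1
    · simp [hc]
    · refine Finset.prod_congr rfl fun i hi => ?_
      simp [Pi.single_eq_of_ne (Finset.ne_of_mem_erase hi)]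
  have h2 : sinProd s θ = Real.sin (c * θ j) * R := by
    rw [sinProd, ← Finset.mul_prod_erase _ _ (Finset.mem_univ j)]
  have h3 : ∀ x, HasDerivAt (fun t : ℝ => Real.sin (c * (θ j + t)) * R)
      (Real.cos (c * (θ j + x)) * c * R) x := fun x => by
    have := (((((hasDerivAt_id x).const_add (θ j)).const_mul c).sin).mul_const R)
    simpa using this
  have h4 : HasDerivAt (fun t : ℝ => Real.cos (c * (θ j + t)) * c * R)
      (-Real.sin (c * (θ j + 0)) * c * c * R) 0 := by
    have := ((((((hasDerivAt_id (0 : ℝ)).const_add (θ j)).const_mul c).cos).mul_const c).mul_const R)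
    simpa using this
  rw [h1, h2, funext fun x => (h3 x).deriv, h4.deriv, add_zero]
  ring

lemma lap_sum {ι : Type*} (S : Finset ι) {f : ι → (Fin N → ℝ) → ℝ}
    (hf : ∀ i ∈ S, ContDiff ℝ 2 (f i)) (θ : Fin N → ℝ) :
    lap (fun θ => ∑ i ∈ S, f i θ) θ = ∑ i ∈ S, lap (f i) θ := by
  classical
  induction S using Finset.induction_on with
  | empty => simp [lap]
  | insert i S hi ih =>
    simp only [Finset.sum_insert hi]
    rw [lap_add (hf i (by simp)) (ContDiff.sum fun j hj => hf j (by simp [hj])),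
      ih fun j hj => hf j (by simp [hj])]

lemma lap_realize (Ψ : (Fin N → Fin (N + M)) → ℝ) (θ : Fin N → ℝ) :
    lap (realize Ψ) θ = -realize (fun s => (∑ i, ((s i : ℕ) + 1 / 2 : ℝ) ^ 2) * Ψ s) θ := by
  have h : lap (realize Ψ) θ = ∑ s, lap (fun θ => Ψ s * sinProd s θ) θ :=
    lap_sum _ (fun s _ => contDiff_const.mul (contDiff_sinProd s)) θ
  rw [h, realize, ← Finset.sum_neg_distrib]
  refine Finset.sum_congr rfl fun s _ => ?_
  rw [lap_const_mul, lap_sinProd]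
  ring

/-- The lowest eigenvalue of the Laplacian on antisymmetric tensors. -/
def rhoSq (N : ℕ) : ℝ := ∑ i : Fin N, ((i : ℕ) + 1 / 2 : ℝ) ^ 2

lemma kappa_pos : 0 < ∏ i : Fin N, (2 : ℝ) ^ (i : ℕ) := Finset.prod_pos fun _ _ => by positivity

lemma lap_weyl (θ : Fin N → ℝ) : lap weyl θ = -rhoSq N * weyl θ := by
  have h1 := lap_realize (M := 0) (vac (N := N)) θ
  have h2 : (fun s : Fin N → Fin (N + 0) => (∑ i, ((s i : ℕ) + 1 / 2 : ℝ) ^ 2) * vac s) =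
      fun s => rhoSq N * vac s := by
    funext s
    by_cases hs : ∃ τ : Equiv.Perm (Fin N), s = ground N 0 ∘ τ
    · obtain ⟨τ, rfl⟩ := hs
      congr 1
      exact Equiv.sum_comp τ fun i : Fin N => ((i : ℕ) + 1 / 2 : ℝ) ^ 2
    · push Not at hs
      rw [vac_eq_zero hs, mul_zero, mul_zero]
  have h3 : realize (fun s : Fin N → Fin (N + 0) => rhoSq N * vac s) θ =
      rhoSq N * realize (M := 0) vac θ := by
    simp only [realize, Finset.mul_sum, mul_assoc]
  have h4 : realize (M := 0) (vac (N := N)) =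
      fun θ => (∏ i : Fin N, (2 : ℝ) ^ (i : ℕ)) * weyl θ := funext realize_vac
  rw [h2, h3, h4, lap_const_mul] at h1
  have := kappa_pos (N := N)
  refine mul_left_cancel₀ this.ne' ?_
  rw [h1]
  ring

end Tensor

section Projection

open MvPolynomial

variable {N M : ℕ}

lemma exists_weyl_ne_zero (N : ℕ) : ∃ θ : Fin N → ℝ, weyl θ ≠ 0 := by
  have hN : (0 : ℝ) < N + 1 := by positivity
  have hπ := Real.pi_pos
  have hlt : ∀ i : Fin N, ((i : ℕ) : ℝ) + 1 < N + 1 := fun i => by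
    have := i.2
    have h : ((i : ℕ) : ℝ) < N := by exact_mod_cast this
    linarith
  have hpos : ∀ i : Fin N, 0 < ((i : ℕ) + 1 : ℝ) * Real.pi / (N + 1) := fun i => by positivity
  have hle : ∀ i : Fin N, ((i : ℕ) + 1 : ℝ) * Real.pi / (N + 1) < Real.pi := fun i => by
    rw [div_lt_iff₀ hN]
    nlinarith [hlt i]
  refine ⟨fun i => ((i : ℕ) + 1 : ℝ) * Real.pi / (N + 1), ?_⟩
  refine mul_ne_zero (Finset.prod_ne_zero_iff.2 fun i _ => ?_)
    (Finset.prod_ne_zero_iff.2 fun i _ => Finset.prod_ne_zero_iff.2 fun j hj => ?_)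
  · have h1 := hpos i
    have h2 := hle i
    exact (Real.sin_pos_of_pos_of_lt_pi (by linarith) (by linarith)).ne'
  · rw [sub_ne_zero]
    intro h
    have h1 := Real.injOn_cos ⟨(hpos j).le, (hle j).le⟩ ⟨(hpos i).le, (hle i).le⟩ h
    rw [div_left_inj' hN.ne', mul_left_inj' hπ.ne', add_left_inj] at h1
    have h2 : (j : ℕ) = i := by exact_mod_cast h1
    exact (Finset.mem_Ioi.1 hj).ne' (Fin.ext h2)

lemma analyticOnNhd_weyl_line (θ v : Fin N → ℝ) :
    AnalyticOnNhd ℝ (fun t : ℝ => weyl (θ + t • v)) Set.univ := by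
  intro x _
  unfold weyl
  simp only [Pi.add_apply, Pi.smul_apply, smul_eq_mul]
  refine AnalyticAt.mul (Finset.analyticAt_fun_prod _ fun i _ => ?_)
    (Finset.analyticAt_fun_prod _ fun i _ => Finset.analyticAt_fun_prod _ fun j _ => ?_)
  · fun_prop
  · fun_prop

lemma analyticOnNhd_evT_line (F : MvPolynomial ℕ ℝ) (θ v : Fin N → ℝ) :
    AnalyticOnNhd ℝ (fun t : ℝ => evT (θ + t • v) F) Set.univ := by
  induction F using MvPolynomial.induction_on with
  | C c => simpa [evT] using analyticOnNhd_const
  | add p q hp hq =>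
    simp only [map_add]
    exact hp.add hq
  | mul_X p l hp =>
    have e : ∀ θ : Fin N → ℝ, evT θ (X l) = pT l θ := fun θ => by simp [evT]
    simp only [map_mul, e]
    refine hp.mul fun x _ => ?_
    unfold pT
    simp only [Pi.add_apply, Pi.smul_apply, smul_eq_mul]
    fun_prop

lemma evT_eq_const {F : MvPolynomial ℕ ℝ} {c : ℝ}
    (h : ∀ θ : Fin N → ℝ, weyl θ * evT θ F = c * weyl θ) (θ : Fin N → ℝ) : evT θ F = c := by
  obtain ⟨θ', hθ'⟩ := exists_weyl_ne_zero N
  have h1 := analyticOnNhd_weyl_line θ (θ' - θ)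
  have h2 : AnalyticOnNhd ℝ (fun t : ℝ => evT (θ + t • (θ' - θ)) F - c) Set.univ :=
    (analyticOnNhd_evT_line F θ (θ' - θ)).sub analyticOnNhd_const
  rcases h1.eq_zero_or_eq_zero_of_mul_eq_zero h2 (fun t _ => by
    rw [mul_sub, h]; ring) isPreconnected_univ with h3 | h3
  · exact absurd (by simpa using h3 1 (Set.mem_univ _)) hθ'
  · have := h3 0 (Set.mem_univ _)
    simp only [zero_smul, add_zero] at this
    linarith

lemma sum_range_lt_sum {S : Finset ℕ} {f : ℕ → ℕ} (hf : StrictMono f)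
    (hS : S ≠ Finset.range S.card) : ∑ i ∈ Finset.range S.card, f i < ∑ i ∈ S, f i := by
  set n := S.card with hn
  have h1 : (S \ Finset.range n).card = (Finset.range n \ S).card := by
    have := Finset.card_sdiff_add_card_inter S (Finset.range n)
    have h2 := Finset.card_sdiff_add_card_inter (Finset.range n) S
    rw [Finset.inter_comm] at h2
    rw [Finset.card_range] at h2
    omega
  have h2 : (S \ Finset.range n).Nonempty := by
    rw [Finset.sdiff_nonempty]
    intro h
    exact hS (Finset.eq_of_subset_of_card_le h (by simp [hn]))
  have h3 : (Finset.range n \ S).Nonempty := by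
    rw [← Finset.card_pos] at h2 ⊢
    omega
  rw [← Finset.sum_sdiff_lt_sum_sdiff]
  calc ∑ i ∈ Finset.range n \ S, f i < ∑ _i ∈ Finset.range n \ S, f n :=
        Finset.sum_lt_sum_of_nonempty h3 fun i hi =>
          hf (Finset.mem_range.1 (Finset.mem_sdiff.1 hi).1)
    _ = ∑ _i ∈ S \ Finset.range n, f n := by simp [h1]
    _ ≤ ∑ i ∈ S \ Finset.range n, f i := Finset.sum_le_sum fun i hi =>
          hf.monotone (by simpa using (Finset.mem_sdiff.1 hi).2)

/-- The excitation energy of a multi-index. -/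
def energy (s : Fin N → Fin (N + M)) : ℤ :=
  ∑ i, ((s i : ℤ) * (s i + 1)) - ∑ i : Fin N, ((i : ℤ) * (i + 1))

lemma energy_eq (s : Fin N → Fin (N + M)) :
    (energy s : ℝ) = (∑ i, ((s i : ℕ) + 1 / 2 : ℝ) ^ 2) - rhoSq N := by
  rw [energy, rhoSq]
  push_cast
  rw [← Finset.sum_sub_distrib, ← Finset.sum_sub_distrib]
  exact Finset.sum_congr rfl fun i _ => by ring

lemma energy_nonneg {s : Fin N → Fin (N + M)} (hs : Function.Injective s) :
    0 ≤ energy s ∧ (energy s = 0 → ∃ σ : Equiv.Perm (Fin N), s = ground N M ∘ σ) := by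
  have hf : StrictMono fun n : ℕ => n * (n + 1) := fun a b h => by
    have : a < b := h
    show a * (a + 1) < b * (b + 1)
    nlinarith
  have hinj : Function.Injective fun i => (s i : ℕ) := fun i j h => hs (Fin.ext h)
  set S : Finset ℕ := Finset.univ.image fun i => (s i : ℕ) with hS
  have hcard : S.card = N := by
    rw [hS, Finset.card_image_of_injective _ hinj]; simp
  have h1 : energy s = ((∑ i ∈ S, i * (i + 1) : ℕ) : ℤ) -
      ((∑ i ∈ Finset.range S.card, i * (i + 1) : ℕ) : ℤ) := by
    rw [energy, hS, Finset.sum_image fun i _ j _ h => hinj h, ← hS, hcard, Finset.sum_range]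
    push_cast
    rfl
  by_cases h : S = Finset.range S.card
  · refine ⟨by rw [h1, ← h]; simp, fun _ => exists_perm hs fun i => ?_⟩
    have : (s i : ℕ) ∈ S := Finset.mem_image_of_mem _ (Finset.mem_univ i)
    rw [h, hcard] at this
    exact Finset.mem_range.1 this
  · have h2 := sum_range_lt_sum hf h
    have h3 : 0 < energy s := by rw [h1]; omega
    exact ⟨h3.le, fun h0 => absurd h0 h3.ne'⟩

lemma exists_project {Ψ : (Fin N → Fin (N + M)) → ℝ} {F : MvPolynomial ℕ ℝ} {κ : ℝ}
    (h : ∀ θ, realize Ψ θ = κ * (weyl θ * evT θ F))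
    {n : Type*} [Fintype n] [DecidableEq n]
    {μ : Measure (Matrix n n ℝ)} [IsProbabilityMeasure μ]
    (hμ : ∀ᵐ A ∂μ, A ∈ specialOrthogonalGroup n ℝ)
    (hinv : ∀ g ∈ specialOrthogonalGroup n ℝ, μ.map (fun A => g * A) = μ) (L : ℕ) :
    ∃ G : MvPolynomial ℕ ℝ, (∀ θ, realize (fun s =>
      (∏ c ∈ Finset.range L, (1 - (energy s : ℝ) / (c + 1))) * Ψ s) θ =
        κ * (weyl θ * evT θ G)) ∧ ∫ A, evM A G ∂μ = ∫ A, evM A F ∂μ := by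
  induction L with
  | zero => exact ⟨F, by simpa using h, rfl⟩
  | succ L ih =>
    obtain ⟨G, hG, hInt⟩ := ih
    obtain ⟨K, hK⟩ := lap_weyl_mul_evT (fun θ => lap_weyl (N := N) θ) G
    refine ⟨G + C (1 / (L + 1 : ℝ)) * lapPoly K G, fun θ => ?_, ?_⟩
    · set Φ : (Fin N → Fin (N + M)) → ℝ :=
        fun s => (∏ c ∈ Finset.range L, (1 - (energy s : ℝ) / (c + 1))) * Ψ s with hΦ
      have h1 := lap_realize Φ θ
      have h2 : realize Φ = fun θ => κ * (weyl θ * evT θ G) := funext hG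
      have h3 := hK K le_rfl θ
      rw [h2, lap_const_mul] at h1
      have h4 : realize (fun s => (∏ c ∈ Finset.range (L + 1), (1 - (energy s : ℝ) / (c + 1))) *
          Ψ s) θ = realize Φ θ - 1 / (L + 1) *
            (realize (fun s => (∑ i, ((s i : ℕ) + 1 / 2 : ℝ) ^ 2) * Φ s) θ -
              rhoSq N * realize Φ θ) := by
        simp only [realize, Finset.mul_sum, ← Finset.sum_sub_distrib]
        refine Finset.sum_congr rfl fun s _ => ?_
        have e : ∑ i, ((s i : ℕ) + 1 / 2 : ℝ) ^ 2 = energy s + rhoSq N := by rw [energy_eq]; ring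
        rw [Finset.prod_range_succ, hΦ, e]
        ring
      have h5 : evT θ (C (1 / (L + 1 : ℝ)) : MvPolynomial ℕ ℝ) = 1 / (L + 1 : ℝ) := by simp [evT]
      rw [h4, map_add, map_mul, h5, hG θ]
      linear_combination (-1 / (L + 1 : ℝ)) * h1 + κ / (L + 1 : ℝ) * h3
    · have h5 : ∀ A : Matrix n n ℝ, evM A (C (1 / (L + 1 : ℝ)) : MvPolynomial ℕ ℝ) =
          1 / (L + 1 : ℝ) := fun A => by simp [evM]
      simp only [map_add, map_mul, h5]
      rw [integral_add (integrable_evM hμ G) ((integrable_evM hμ _).const_mul _),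
        integral_const_mul, integral_lapPoly hμ hinv, mul_zero, add_zero, hInt]

lemma prod_energy {s : Fin N → Fin (N + M)} {L : ℕ} (h0 : 0 < energy s) (hL : energy s ≤ L) :
    ∏ c ∈ Finset.range L, (1 - (energy s : ℝ) / (c + 1)) = 0 := by
  obtain ⟨m, hm⟩ : ∃ m : ℕ, energy s = m + 1 := ⟨(energy s - 1).toNat, by omega⟩
  refine Finset.prod_eq_zero (Finset.mem_range.2 (by omega : m < L)) ?_
  rw [hm]
  push_cast
  rw [div_self (by positivity), sub_self]

theorem integral_evM_eq_ground {μ : Measure (Matrix (Fin (2 * N + 1)) (Fin (2 * N + 1)) ℝ)}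
    [IsProbabilityMeasure μ] (hμ : ∀ᵐ A ∂μ, A ∈ specialOrthogonalGroup (Fin (2 * N + 1)) ℝ)
    (hinv : ∀ g ∈ specialOrthogonalGroup (Fin (2 * N + 1)) ℝ, μ.map (fun A => g * A) = μ)
    {Ψ : (Fin N → Fin (N + M)) → ℝ} (hΨ : Antisymm Ψ) {F : MvPolynomial ℕ ℝ}
    (h : ∀ θ, realize Ψ θ = evT θ F * realize (M := M) vac θ) :
    ∫ A, evM A F ∂μ = Ψ (ground N M) := by
  set κ := ∏ i : Fin N, (2 : ℝ) ^ (i : ℕ) with hκ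
  have hκ0 : 0 < κ := kappa_pos
  obtain ⟨L, hL⟩ : ∃ L : ℕ, ∀ s : Fin N → Fin (N + M), energy s ≤ L := by
    refine ⟨∑ s : Fin N → Fin (N + M), (energy s).toNat, fun s => ?_⟩
    have := Finset.single_le_sum (f := fun s : Fin N → Fin (N + M) => (energy s).toNat)
      (fun _ _ => Nat.zero_le _) (Finset.mem_univ s)
    have h2 := Int.self_le_toNat (energy s)
    omega
  obtain ⟨G, hG, hInt⟩ := exists_project (κ := κ) (Ψ := Ψ) (F := F)
    (fun θ => by rw [h, realize_vac]; ring) hμ hinv L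
  have h1 : (fun s => (∏ c ∈ Finset.range L, (1 - (energy s : ℝ) / (c + 1))) * Ψ s) =
      fun s => Ψ (ground N M) * vac s := by
    funext s
    by_cases hs : Function.Injective s
    · obtain ⟨h2, h3⟩ := energy_nonneg hs
      by_cases h4 : energy s = 0
      · obtain ⟨σ, rfl⟩ := h3 h4
        rw [h4, hΨ, vac_ground_comp]
        simp [mul_comm]
      · rw [prod_energy (lt_of_le_of_ne h2 (Ne.symm h4)) (hL s), zero_mul, vac_eq_zero, mul_zero]
        rintro σ rfl
        refine h4 ?_
        rw [energy, sub_eq_zero]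
        exact Equiv.sum_comp σ fun i : Fin N => ((i : ℤ) * (i + 1))
    · rw [hΨ.eq_zero hs, antisymm_vac.eq_zero hs, mul_zero, mul_zero]
  have h2 : ∀ θ : Fin N → ℝ, evT θ G = Ψ (ground N M) := evT_eq_const fun θ => by
    have h3 := hG θ
    rw [h1] at h3
    have h4 : realize (M := M) (fun s => Ψ (ground N M) * vac s) θ =
        Ψ (ground N M) * realize (M := M) vac θ := by
      simp only [realize, Finset.mul_sum, mul_assoc]
    rw [h4, realize_vac] at h3
    refine mul_left_cancel₀ hκ0.ne' ?_
    rw [← h3]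
    ring
  have h5 : ∀ᵐ A ∂μ, evM A G = Ψ (ground N M) := by
    filter_upwards [hμ] with A hA
    obtain ⟨θ, hθ⟩ := exists_angles hA
    rw [← h2 θ]
    have : (fun k => (A ^ k).trace) = fun k => pT k θ := funext hθ
    rw [evM, evT, this]
  rw [← hInt, integral_congr_ae h5]
  simp

end Projection

section Derivation

variable {N : ℕ} {ι : Type*} [Fintype ι] [DecidableEq ι]

/-- The action of a matrix on the `i`-th tensor factor. -/
def tauAt (i : Fin N) (O : Matrix ι ι ℝ) (Ψ : (Fin N → ι) → ℝ) (s : Fin N → ι) : ℝ :=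
  ∑ t, O (s i) t * Ψ (Function.update s i t)

/-- The action of a matrix on tensors as a derivation. -/
def tau (O : Matrix ι ι ℝ) (Ψ : (Fin N → ι) → ℝ) (s : Fin N → ι) : ℝ :=
  ∑ i, tauAt i O Ψ s

lemma tauAt_tauAt_self (i : Fin N) (O O' : Matrix ι ι ℝ) (Ψ : (Fin N → ι) → ℝ) :
    tauAt i O (tauAt i O' Ψ) = tauAt i (O * O') Ψ := by
  funext s
  simp only [tauAt, Function.update_self, Function.update_idem, mul_apply, Finset.sum_mul,
    Finset.mul_sum]
  rw [Finset.sum_comm]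
  simp only [mul_assoc]

lemma tauAt_comm {i j : Fin N} (hij : i ≠ j) (O O' : Matrix ι ι ℝ) (Ψ : (Fin N → ι) → ℝ) :
    tauAt i O (tauAt j O' Ψ) = tauAt j O' (tauAt i O Ψ) := by
  funext s
  simp only [tauAt, Function.update_of_ne hij, Function.update_of_ne hij.symm, Finset.mul_sum]
  rw [Finset.sum_comm]
  refine Finset.sum_congr rfl fun t _ => Finset.sum_congr rfl fun u _ => ?_
  rw [Function.update_comm hij]
  ring

lemma tauAt_sum {α : Type*} (S : Finset α) (i : Fin N) (O : Matrix ι ι ℝ)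
    (Ψ : α → (Fin N → ι) → ℝ) (s : Fin N → ι) :
    tauAt i O (fun s => ∑ a ∈ S, Ψ a s) s = ∑ a ∈ S, tauAt i O (Ψ a) s := by
  simp only [tauAt, Finset.mul_sum]
  rw [Finset.sum_comm]

lemma tau_commutator (O O' : Matrix ι ι ℝ) (Ψ : (Fin N → ι) → ℝ) :
    tau O (tau O' Ψ) = tau (O * O' - O' * O) Ψ + tau O' (tau O Ψ) := by
  have h : ∀ O O' : Matrix ι ι ℝ, ∀ s, tau O (tau O' Ψ) s =
      ∑ i, ∑ j, tauAt i O (tauAt j O' Ψ) s := by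
    intro O O' s
    exact Finset.sum_congr rfl fun i _ => tauAt_sum _ i O _ s
  funext s
  rw [Pi.add_apply, h, h O' O, Finset.sum_comm (s := Finset.univ) (t := Finset.univ)
    (f := fun i j => tauAt i O' (tauAt j O Ψ) s), tau, ← Finset.sum_add_distrib]
  refine Finset.sum_congr rfl fun i _ => ?_
  rw [← Finset.add_sum_erase _ _ (Finset.mem_univ i),
    ← Finset.add_sum_erase _ (fun j => tauAt j O' (tauAt i O Ψ) s) (Finset.mem_univ i),
    Finset.sum_congr rfl fun j hj =>
      congrFun (tauAt_comm (Finset.ne_of_mem_erase hj).symm O O' Ψ) s, ← add_assoc,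
    tauAt_tauAt_self, tauAt_tauAt_self]
  congr 1
  simp only [tauAt, Matrix.sub_apply, sub_mul, Finset.sum_sub_distrib]
  ring

lemma tau_add (O : Matrix ι ι ℝ) (Ψ Φ : (Fin N → ι) → ℝ) :
    tau O (Ψ + Φ) = tau O Ψ + tau O Φ := by
  funext s
  simp only [tau, tauAt, Pi.add_apply, mul_add, Finset.sum_add_distrib]

lemma tau_smul (O : Matrix ι ι ℝ) (c : ℝ) (Ψ : (Fin N → ι) → ℝ) :
    tau O (c • Ψ) = c • tau O Ψ := by
  funext s
  simp only [tau, tauAt, Pi.smul_apply, smul_eq_mul, Finset.mul_sum]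
  exact Finset.sum_congr rfl fun i _ => Finset.sum_congr rfl fun t _ => by ring

lemma add_tau (O O' : Matrix ι ι ℝ) (Ψ : (Fin N → ι) → ℝ) :
    tau (O + O') Ψ = tau O Ψ + tau O' Ψ := by
  funext s
  simp only [tau, tauAt, Pi.add_apply, Matrix.add_apply, add_mul, Finset.sum_add_distrib]

lemma sum_update {α : Type*} [AddCommMonoid α] (i : Fin N) (G : (Fin N → ι) → ι → α) :
    ∑ s, ∑ t, G s t = ∑ s, ∑ t, G (Function.update s i t) (s i) := by
  rw [← Fintype.sum_prod_type',
    ← Fintype.sum_prod_type' (f := fun s t => G (Function.update s i t) (s i))]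
  refine Finset.sum_nbij' (fun p => (Function.update p.1 i p.2, p.1 i))
    (fun p => (Function.update p.1 i p.2, p.1 i)) ?_ ?_ ?_ ?_ ?_
  all_goals simp

/-- The Euclidean inner product of tensors. -/
def ip (Ψ Φ : (Fin N → ι) → ℝ) : ℝ := ∑ s, Ψ s * Φ s

lemma ip_tau (O : Matrix ι ι ℝ) (Ψ Φ : (Fin N → ι) → ℝ) :
    ip (tau O Ψ) Φ = ip Ψ (tau Oᵀ Φ) := by
  simp only [ip, tau, Finset.sum_mul, Finset.mul_sum]
  rw [Finset.sum_comm, Finset.sum_comm (t := Finset.univ) (f := fun s i => Ψ s * tauAt i Oᵀ Φ s)]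
  refine Finset.sum_congr rfl fun i _ => ?_
  simp only [tauAt, Finset.sum_mul, Finset.mul_sum]
  rw [sum_update i]
  refine Finset.sum_congr rfl fun s _ => Finset.sum_congr rfl fun t _ => ?_
  simp
  ring

lemma ip_comm (Ψ Φ : (Fin N → ι) → ℝ) : ip Ψ Φ = ip Φ Ψ :=
  Finset.sum_congr rfl fun _ _ => mul_comm _ _

lemma ip_add (Ψ Φ Φ' : (Fin N → ι) → ℝ) : ip Ψ (Φ + Φ') = ip Ψ Φ + ip Ψ Φ' := by
  simp only [ip, Pi.add_apply, mul_add, Finset.sum_add_distrib]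

lemma ip_smul (Ψ Φ : (Fin N → ι) → ℝ) (c : ℝ) : ip Ψ (c • Φ) = c * ip Ψ Φ := by
  simp only [ip, Pi.smul_apply, smul_eq_mul, Finset.mul_sum]
  exact Finset.sum_congr rfl fun _ _ => by ring

end Derivation

section Vacuum

variable {N M : ℕ}

lemma Antisymm.tau {Ψ : (Fin N → Fin (N + M)) → ℝ} (hΨ : Antisymm Ψ)
    (O : Matrix (Fin (N + M)) (Fin (N + M)) ℝ) : Antisymm (tau O Ψ) := by
  intro σ s
  rw [SOOdd.tau, SOOdd.tau, Finset.mul_sum, ← Equiv.sum_comp σ fun i => _ * tauAt i O Ψ s]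
  refine Finset.sum_congr rfl fun i _ => ?_
  simp only [tauAt, Finset.mul_sum]
  refine Finset.sum_congr rfl fun t _ => ?_
  have h : Function.update (s ∘ σ) i t = Function.update s (σ i) t ∘ σ := by
    funext j
    by_cases hj : j = i
    · subst hj; simp
    · simp [Function.update_of_ne hj, Function.update_of_ne (σ.injective.ne hj)]
  rw [h, hΨ]
  simp only [Function.comp_apply]
  ring

lemma vac_ne_zero {s : Fin N → Fin (N + M)} (h : vac s ≠ 0) (i : Fin N) : (s i : ℕ) < N := by
  by_contra hi
  refine h (vac_eq_zero fun σ hσ => hi ?_)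
  rw [hσ]
  exact (σ i).2

lemma ip_vac {Ψ : (Fin N → Fin (N + M)) → ℝ} (hΨ : Antisymm Ψ) :
    ip vac Ψ = N.factorial * Ψ (ground N M) := by
  rw [ip, sum_vac_mul]
  have : ∀ σ : Equiv.Perm (Fin N), ((σ.sign : ℤ) : ℝ) * Ψ (ground N M ∘ σ) =
      Ψ (ground N M) := by
    intro σ
    rw [hΨ, ← mul_assoc]
    have h : ((σ.sign : ℤ) : ℝ) * ((σ.sign : ℤ) : ℝ) = 1 := by
      rcases Int.units_eq_one_or σ.sign with h | h <;> simp [h]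
    rw [h, one_mul]
  simp only [this]
  simp [Fintype.card_perm]

/-- The trace over the occupied indices. -/
def trP (O : Matrix (Fin (N + M)) (Fin (N + M)) ℝ) : ℝ :=
  ∑ i : Fin N, O (Fin.castAdd M i) (Fin.castAdd M i)

lemma tau_vac {O : Matrix (Fin (N + M)) (Fin (N + M)) ℝ}
    (hO : ∀ i j : Fin (N + M), N ≤ (i : ℕ) → (j : ℕ) < N → O i j = 0) :
    tau O (vac (N := N)) = trP O • vac := by
  funext s
  rw [Pi.smul_apply, smul_eq_mul, (antisymm_vac.tau O).eq_vac]
  · congr 1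
    rw [tau, trP]
    refine Finset.sum_congr rfl fun i _ => ?_
    rw [tauAt, Finset.sum_eq_single_of_mem (ground N M i) (Finset.mem_univ _)]
    · rw [Function.update_eq_self, vac_ground, mul_one]; rfl
    · intro t _ ht
      suffices h : vac (Function.update (ground N M) i t) = 0 by rw [h, mul_zero]
      by_contra h
      have h1 := vac_ne_zero h i
      rw [Function.update_self] at h1
      have h2 : Function.Injective (Function.update (ground N M) i t) := by
        by_contra h2
        exact h (antisymm_vac.eq_zero h2)
      have h3 : (⟨t, h1⟩ : Fin N) ≠ i := fun e => ht (by
        rw [← e]; rfl)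
      refine h3 (h2 ?_)
      rw [Function.update_self, Function.update_of_ne h3]
      rfl
  · intro s hs i
    by_contra hi
    refine hs (Finset.sum_eq_zero fun j _ => Finset.sum_eq_zero fun t _ => ?_)
    by_cases hv : vac (Function.update s j t) = 0
    · rw [hv, mul_zero]
    have h1 := vac_ne_zero hv
    by_cases hij : i = j
    · subst hij
      have h2 := h1 i
      rw [Function.update_self] at h2
      rw [hO _ _ (not_lt.1 hi) h2, zero_mul]
    · have h2 := h1 i
      rw [Function.update_of_ne hij] at h2
      exact absurd h2 hi

/-- Multiplication by `p_a - 1` in the sine basis. -/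
def shiftC (N M a : ℕ) : Matrix (Fin (N + M)) (Fin (N + M)) ℝ := fun i j =>
  (if (j : ℕ) = i + a then 1 else 0) + (if (i : ℕ) = j + a then 1 else 0) -
    (if (i : ℕ) + j + 1 = a then 1 else 0)

lemma shiftC_comm (a : ℕ) (i j : Fin (N + M)) : shiftC N M a i j = shiftC N M a j i := by
  simp only [shiftC, add_comm (j : ℕ) (i : ℕ)]
  ring

lemma shiftC_transpose (a : ℕ) : (shiftC N M a)ᵀ = shiftC N M a := by
  ext i j
  exact shiftC_comm a j i

lemma sum_shiftC_sin {a : ℕ} (ha : 1 ≤ a) {r : Fin (N + M)} (hr : (r : ℕ) + a < N + M) (x : ℝ) :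
    ∑ t, shiftC N M a t r * Real.sin (((t : ℕ) + 1 / 2 : ℝ) * x) =
      2 * Real.cos (a * x) * Real.sin (((r : ℕ) + 1 / 2 : ℝ) * x) := by
  have e1 : 2 * Real.cos (a * x) * Real.sin (((r : ℕ) + 1 / 2 : ℝ) * x) =
      Real.sin (((r : ℕ) + a + 1 / 2 : ℝ) * x) + Real.sin (((r : ℕ) - a + 1 / 2 : ℝ) * x) := by
    have h1 : ((r : ℕ) + a + 1 / 2 : ℝ) * x = ((r : ℕ) + 1 / 2 : ℝ) * x + a * x := by ring
    have h2 : ((r : ℕ) - a + 1 / 2 : ℝ) * x = ((r : ℕ) + 1 / 2 : ℝ) * x - a * x := by ring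
    rw [h1, h2, Real.sin_add, Real.sin_sub]
    ring
  have h1 : ∑ t : Fin (N + M), (if (t : ℕ) = r + a then (1 : ℝ) else 0) *
      Real.sin (((t : ℕ) + 1 / 2 : ℝ) * x) = Real.sin (((r : ℕ) + a + 1 / 2 : ℝ) * x) := by
    rw [Finset.sum_eq_single_of_mem ⟨r + a, hr⟩ (Finset.mem_univ _)]
    · simp
    · intro t _ ht
      rw [if_neg (fun h => ht (Fin.ext h)), zero_mul]
  have h2 : ∑ t : Fin (N + M), ((if (r : ℕ) = t + a then (1 : ℝ) else 0) -
      (if (t : ℕ) + r + 1 = a then 1 else 0)) *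
      Real.sin (((t : ℕ) + 1 / 2 : ℝ) * x) = Real.sin (((r : ℕ) - a + 1 / 2 : ℝ) * x) := by
    rcases le_or_gt a r with h | h
    · rw [Finset.sum_eq_single_of_mem ⟨r - a, by omega⟩ (Finset.mem_univ _)]
      · rw [if_pos (by simp; omega), if_neg (by simp; omega)]
        simp only [Nat.cast_sub h]
        simp
      · intro t _ ht
        have : (t : ℕ) ≠ r - a := fun h => ht (Fin.ext h)
        rw [if_neg (by omega), if_neg (by omega)]
        simp
    · rw [Finset.sum_eq_single_of_mem ⟨a - 1 - r, by omega⟩ (Finset.mem_univ _)]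
      · rw [if_neg (by simp; omega), if_pos (by simp; omega)]
        have h3 : (((a - 1 - r : ℕ) : ℝ)) = a - 1 - (r : ℕ) := by
          rw [Nat.cast_sub (by omega), Nat.cast_sub ha]; simp
        simp only [h3, zero_sub, neg_mul, one_mul, ← Real.sin_neg]
        congr 1
        ring
      · intro t _ ht
        have : (t : ℕ) ≠ a - 1 - r := fun h => ht (Fin.ext h)
        rw [if_neg (by omega), if_neg (by omega)]
        simp
  rw [e1, ← h1, ← h2, ← Finset.sum_add_distrib]
  refine Finset.sum_congr rfl fun t _ => ?_
  simp only [shiftC]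
  ring

lemma realize_tau_shiftC {a : ℕ} (ha : 1 ≤ a) {Ψ : (Fin N → Fin (N + M)) → ℝ}
    (hΨ : ∀ s, Ψ s ≠ 0 → ∀ i, (s i : ℕ) + a < N + M) (θ : Fin N → ℝ) :
    realize (tau (shiftC N M a) Ψ) θ = (pT a θ - 1) * realize Ψ θ := by
  have h1 : realize (tau (shiftC N M a) Ψ) θ =
      ∑ i, ∑ s, Ψ s * ∑ t, shiftC N M a t (s i) * sinProd (Function.update s i t) θ := by
    simp only [realize, tau, Finset.sum_mul]
    rw [Finset.sum_comm]
    refine Finset.sum_congr rfl fun i _ => ?_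
    simp only [tauAt, Finset.sum_mul, Finset.mul_sum]
    rw [sum_update i]
    refine Finset.sum_congr rfl fun s _ => Finset.sum_congr rfl fun t _ => ?_
    simp
    ring
  rw [h1, realize, Finset.mul_sum, Finset.sum_comm]
  refine Finset.sum_congr rfl fun s _ => ?_
  by_cases hs : Ψ s = 0
  · simp [hs]
  have h2 : ∀ i, ∑ t, shiftC N M a t (s i) * sinProd (Function.update s i t) θ =
      2 * Real.cos (a * θ i) * sinProd s θ := by
    intro i
    have h3 : ∀ t, sinProd (Function.update s i t) θ =
        Real.sin (((t : ℕ) + 1 / 2 : ℝ) * θ i) *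
          ∏ j ∈ Finset.univ.erase i, Real.sin (((s j : ℕ) + 1 / 2 : ℝ) * θ j) := by
      intro t
      rw [sinProd, ← Finset.mul_prod_erase _ _ (Finset.mem_univ i)]
      congr 1
      · simp
      · refine Finset.prod_congr rfl fun j hj => ?_
        rw [Function.update_of_ne (Finset.ne_of_mem_erase hj)]
    have h4 := sum_shiftC_sin ha (hΨ s hs i) (θ i)
    simp only [h3, ← mul_assoc, ← Finset.sum_mul, h4]
    rw [sinProd, ← Finset.mul_prod_erase _ _ (Finset.mem_univ i)]
    ring
  simp only [h2]
  rw [pT, ← Finset.mul_sum, ← Finset.sum_mul, ← Finset.mul_sum]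
  ring

lemma tau_shiftC_support {a L : ℕ} {Ψ : (Fin N → Fin (N + M)) → ℝ}
    (hΨ : ∀ s, Ψ s ≠ 0 → ∀ i, (s i : ℕ) < L) (s)
    (hs : tau (shiftC N M a) Ψ s ≠ 0) (i : Fin N) : (s i : ℕ) < L + a := by
  by_contra hi
  refine hs (Finset.sum_eq_zero fun j _ => Finset.sum_eq_zero fun t _ => ?_)
  by_cases hv : Ψ (Function.update s j t) = 0
  · rw [hv, mul_zero]
  have h1 := hΨ _ hv i
  by_cases hij : i = j
  · subst hij
    rw [Function.update_self] at h1
    rw [shiftC, if_neg (by omega), if_neg (by omega), if_neg (by omega)]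
    simp
  · rw [Function.update_of_ne hij] at h1
    omega

end Vacuum

section Fock

variable {N M : ℕ}

/-- Matrices mapping occupied to unoccupied indices. -/
def Lower (O : Matrix (Fin (N + M)) (Fin (N + M)) ℝ) : Prop :=
  ∀ i j : Fin (N + M), (i : ℕ) < N ∨ N ≤ (j : ℕ) → O i j = 0

/-- The part of a matrix mapping occupied to unoccupied indices. -/
def low (O : Matrix (Fin (N + M)) (Fin (N + M)) ℝ) : Matrix (Fin (N + M)) (Fin (N + M)) ℝ :=
  fun i j => if N ≤ (i : ℕ) ∧ (j : ℕ) < N then O i j else 0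

lemma lower_low (O : Matrix (Fin (N + M)) (Fin (N + M)) ℝ) : Lower (low O) := fun i j h =>
  if_neg (by omega)

variable {A B X O : Matrix (Fin (N + M)) (Fin (N + M)) ℝ}

lemma Lower.mul_eq_zero (hA : Lower A) (hB : Lower B) : A * B = 0 := by
  ext i j
  rw [mul_apply, Finset.sum_eq_zero, Matrix.zero_apply]
  intro k _
  rcases lt_or_ge (k : ℕ) N with h | h
  · rw [hB _ _ (Or.inl h), mul_zero]
  · rw [hA _ _ (Or.inr h), zero_mul]

lemma Lower.mul_mul (hA : Lower A) (hB : Lower B) : Lower (A * O * B) := by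
  intro i j h
  rcases h with h | h
  · rw [mul_assoc, mul_apply]
    exact Finset.sum_eq_zero fun k _ => by rw [hA _ _ (Or.inl h), zero_mul]
  · rw [mul_apply]
    exact Finset.sum_eq_zero fun k _ => by rw [hB _ _ (Or.inr h), mul_zero]

lemma trP_sub : trP (A - B) = trP A - trP B := by
  simp [trP, Finset.sum_sub_distrib]

lemma Lower.trP_mul (hA : Lower A) (O) : trP (A * O) = 0 :=
  Finset.sum_eq_zero fun i _ => by
    rw [mul_apply]
    exact Finset.sum_eq_zero fun k _ => by
      rw [hA _ _ (Or.inl (by simp)), zero_mul]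

lemma Lower.trP_mul' (hA : Lower A) (O) : trP (O * A) = (O * A).trace := by
  rw [trP, trace, Fin.sum_univ_add]
  simp only [diag_apply]
  rw [left_eq_add]
  refine Finset.sum_eq_zero fun i _ => ?_
  rw [mul_apply]
  exact Finset.sum_eq_zero fun k _ => by rw [hA _ _ (Or.inr (by simp)), mul_zero]

lemma Lower.trP_eq (hA : Lower A) : trP A = 0 := by
  simpa using hA.trP_mul 1

lemma tau_vac_eq (O : Matrix (Fin (N + M)) (Fin (N + M)) ℝ) :
    tau O (vac (N := N)) = tau (low O) vac + trP O • vac := by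
  have h : O = low O + (O - low O) := by abel
  conv_lhs => rw [h]
  rw [add_tau, tau_vac (O := O - low O), trP_sub, (lower_low O).trP_eq, sub_zero]
  intro i j hi hj
  simp [low, hi, hj]

lemma Lower.tau_transpose (hA : Lower A) : tau Aᵀ (vac (N := N)) = 0 := by
  rw [tau_vac]
  · have : trP Aᵀ = trP A := rfl
    rw [this, hA.trP_eq, zero_smul]
  · intro i j hi hj
    exact hA _ _ (Or.inl hj)

lemma Lower.tau_transpose_tau (hA : Lower A) (hX : Lower X) :
    tau Aᵀ (tau X (vac (N := N))) = (Aᵀ * X).trace • vac := by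
  rw [tau_commutator, hA.tau_transpose, tau_vac, trP_sub, hX.trP_mul, hX.trP_mul', sub_zero]
  · have h0 : tau X (0 : (Fin N → Fin (N + M)) → ℝ) = 0 := by
      have := tau_smul (N := N) X 0 0
      simpa using this
    rw [h0, add_zero]
  · intro i j hi hj
    rw [Matrix.sub_apply, mul_apply, mul_apply, Finset.sum_eq_zero, Finset.sum_eq_zero, sub_zero]
    · intro k _
      rw [transpose_apply, hA _ _ (Or.inl hj), mul_zero]
    · intro k _
      rw [transpose_apply, hA _ _ (Or.inr hi), zero_mul]

lemma ip_vac_vac : ip (vac (N := N) (M := M)) vac = N.factorial := by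
  rw [ip_vac antisymm_vac, vac_ground, mul_one]

lemma Lower.ip_vac_tau (hA : Lower A) (Φ : (Fin N → Fin (N + M)) → ℝ) :
    ip vac (tau A Φ) = 0 := by
  rw [ip_comm, ip_tau, ip_comm]
  have h := hA.tau_transpose
  rw [h]
  simp [ip]

lemma Lower.ip_tau_tau (hA : Lower A) (hX : Lower X) :
    ip (tau A (vac (N := N))) (tau X vac) = N.factorial * (Aᵀ * X).trace := by
  rw [ip_tau, hA.tau_transpose_tau hX, ip_smul, ip_vac_vac, mul_comm]

lemma Lower.ip_tau_tau_tau (hA : Lower A) (hB : Lower B) (hX : Lower X) :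
    ip (tau X (vac (N := N))) (tau A (tau B vac)) = 0 := by
  rw [ip_comm, ip_tau, hA.tau_transpose_tau hX, ip_smul, ip_comm, hB.ip_vac_tau, mul_zero]

lemma Lower.ip_tau_tau_self (hA : Lower A) (hB : Lower B) :
    ip (tau A (tau B (vac (N := N)))) (tau A (tau B vac)) = N.factorial *
      ((Aᵀ * A).trace * (Bᵀ * B).trace + (Aᵀ * B).trace ^ 2 -
        (Bᵀ * (A * Aᵀ * B)).trace - (Bᵀ * (B * Aᵀ * A)).trace) := by
  have h1 : tau (Aᵀ * A - A * Aᵀ) (vac (N := N)) = (Aᵀ * A).trace • vac := by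
    have h := hA.tau_transpose_tau hA
    rw [tau_commutator, hA.tau_transpose] at h
    have h0 : tau A (0 : (Fin N → Fin (N + M)) → ℝ) = 0 := by
      have := tau_smul (N := N) A 0 0
      simpa using this
    rwa [h0, add_zero] at h
  have h2 : (Aᵀ * A - A * Aᵀ) * B - B * (Aᵀ * A - A * Aᵀ) =
      (-1 : ℝ) • (A * Aᵀ * B) + (-1 : ℝ) • (B * Aᵀ * A) := by
    have e1 : Aᵀ * A * B = 0 := by rw [mul_assoc, hA.mul_eq_zero hB, mul_zero]
    have e2 : B * (A * Aᵀ) = 0 := by rw [← mul_assoc, hB.mul_eq_zero hA, zero_mul]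
    rw [sub_mul, mul_sub, e1, e2, neg_one_smul, neg_one_smul, ← mul_assoc]
    abel
  have smul_tau : ∀ (c : ℝ) (O : Matrix (Fin (N + M)) (Fin (N + M)) ℝ),
      tau (c • O) (vac (N := N)) = c • tau O vac := by
    intro c O
    funext s
    simp [tau, tauAt, Finset.mul_sum, mul_assoc]
  rw [ip_tau, tau_commutator Aᵀ A, hA.tau_transpose_tau hB, tau_commutator _ B, h1, h2, add_tau,
    tau_smul, tau_smul, smul_tau, smul_tau]
  simp only [ip_add, ip_smul]
  rw [hB.ip_tau_tau (hA.mul_mul hB), hB.ip_tau_tau (hB.mul_mul hA), hB.ip_tau_tau hB,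
    hB.ip_tau_tau hA]
  have h3 : (Bᵀ * A).trace = (Aᵀ * B).trace := by
    rw [← trace_transpose, transpose_mul, transpose_transpose]
  rw [h3]
  ring

lemma trace_low_mul_low {C D : Matrix (Fin (N + M)) (Fin (N + M)) ℝ} (hD : Dᵀ = D) :
    trP (D * low C) = ((low D)ᵀ * low C).trace := by
  rw [(lower_low C).trP_mul', trace, trace]
  refine Finset.sum_congr rfl fun i _ => ?_
  simp only [diag_apply, mul_apply]
  refine Finset.sum_congr rfl fun k _ => ?_
  have h : D i k = D k i := congrFun (congrFun hD k) i
  by_cases hk : N ≤ (k : ℕ) ∧ (i : ℕ) < N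
  · simp [low, hk, h]
  · simp [low, hk]

/-- The off-diagonal part of the commutator. -/
def comm (C D : Matrix (Fin (N + M)) (Fin (N + M)) ℝ) : Matrix (Fin (N + M)) (Fin (N + M)) ℝ :=
  low (D * low C - low C * D)

lemma tau_tau_vac {C D : Matrix (Fin (N + M)) (Fin (N + M)) ℝ} (hD : Dᵀ = D) :
    tau D (tau C (vac (N := N))) = tau (low C) (tau (low D) vac) + tau (comm C D) vac +
      trP D • tau (low C) vac + trP C • tau (low D) vac +
      (trP C * trP D + ((low D)ᵀ * low C).trace) • vac := by
  rw [tau_vac_eq C, tau_add, tau_smul, tau_commutator D, tau_vac_eq D, tau_vac_eq (_ - _),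
    trP_sub, (lower_low C).trP_mul, trace_low_mul_low hD, tau_add, tau_smul, comm]
  module

/-- The second moment of a one-body operator. -/
lemma ip_one {C : Matrix (Fin (N + M)) (Fin (N + M)) ℝ} :
    ip (tau C (vac (N := N))) (tau C vac) = N.factorial *
      (trP C ^ 2 + ((low C)ᵀ * low C).trace) := by
  have hC := lower_low C
  rw [tau_vac_eq C]
  rw [ip_add, ip_smul, ip_comm _ (tau (low C) vac), ip_comm _ vac]
  simp only [ip_add, ip_smul]
  rw [hC.ip_tau_tau hC, ip_vac_vac, hC.ip_vac_tau, ip_comm, hC.ip_vac_tau]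
  ring

/-- The fourth moment of two one-body operators. -/
lemma ip_two {C D : Matrix (Fin (N + M)) (Fin (N + M)) ℝ} (hD : Dᵀ = D) :
    ip (tau D (tau C (vac (N := N)))) (tau D (tau C vac)) = N.factorial *
      ((trP C ^ 2 + ((low C)ᵀ * low C).trace) * (trP D ^ 2 + ((low D)ᵀ * low D).trace) +
        2 * ((low C)ᵀ * low D).trace ^ 2 +
        4 * trP C * trP D * ((low C)ᵀ * low D).trace +
        2 * trP D * ((low C)ᵀ * comm C D).trace + 2 * trP C * ((low D)ᵀ * comm C D).trace +
        (((comm C D)ᵀ * comm C D).trace - ((low D)ᵀ * (low C * (low C)ᵀ * low D)).trace -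
          ((low D)ᵀ * (low D * (low C)ᵀ * low C)).trace)) := by
  have hA := lower_low C
  have hB := lower_low D
  have hX : Lower (comm C D) := lower_low _
  have h3 : ((low D)ᵀ * low C).trace = ((low C)ᵀ * low D).trace := by
    rw [← trace_transpose, transpose_mul, transpose_transpose]
  rw [tau_tau_vac hD]
  set W := tau (low C) (tau (low D) (vac (N := N))) with hW
  set x := tau (comm C D) (vac (N := N)) with hx
  set y := tau (low C) (vac (N := N)) with hy
  set z := tau (low D) (vac (N := N)) with hz
  have e1 : ip W W = _ := hA.ip_tau_tau_self hB
  have e2 : ip x W = 0 := hA.ip_tau_tau_tau hB hX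
  have e3 : ip y W = 0 := hA.ip_tau_tau_tau hB hA
  have e4 : ip z W = 0 := hA.ip_tau_tau_tau hB hB
  have e5 : ip vac W = 0 := hA.ip_vac_tau _
  have e6 : ip x x = _ := hX.ip_tau_tau hX
  have e7 : ip y x = _ := hA.ip_tau_tau hX
  have e8 : ip z x = _ := hB.ip_tau_tau hX
  have e9 : ip vac x = 0 := hX.ip_vac_tau _
  have e10 : ip y y = _ := hA.ip_tau_tau hA
  have e11 : ip z z = _ := hB.ip_tau_tau hB
  have e12 : ip y z = _ := hA.ip_tau_tau hB
  have e13 : ip vac y = 0 := hA.ip_vac_tau _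
  have e14 : ip vac z = 0 := hB.ip_vac_tau _
  have e15 := ip_vac_vac (N := N) (M := M)
  have hl : ∀ a b c : (Fin N → Fin (N + M)) → ℝ, ip (a + b) c = ip a c + ip b c := by
    intro a b c; rw [ip_comm, ip_add, ip_comm c, ip_comm c]
  have hs : ∀ (r : ℝ) (a c : (Fin N → Fin (N + M)) → ℝ), ip (r • a) c = r * ip a c := by
    intro r a c; rw [ip_comm, ip_smul, ip_comm c]
  simp only [ip_add, ip_smul, hl, hs]
  rw [ip_comm W x, ip_comm W y, ip_comm W z, ip_comm W vac, ip_comm x y, ip_comm x z,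
    ip_comm x vac, ip_comm y vac, ip_comm z vac, ip_comm z y, e1, e2, e3, e4, e5, e6, e7, e8, e9,
    e10, e11, e12, e13, e14, e15, h3]
  ring

end Fock

section Moments

open MvPolynomial

variable {N M : ℕ}

/-- The centred power traces. -/
def ptr (k : ℕ) (A : Matrix (Fin (2 * N + 1)) (Fin (2 * N + 1)) ℝ) : ℝ := (A ^ k).trace - 1

/-- The state obtained by applying multiplication operators to the vacuum. -/
def stateL (N M : ℕ) (l : List ℕ) : (Fin N → Fin (N + M)) → ℝ :=
  l.foldr (fun a Ψ => tau (shiftC N M a) Ψ) vac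

lemma stateL_cons (a : ℕ) (l : List ℕ) :
    stateL N M (a :: l) = tau (shiftC N M a) (stateL N M l) := rfl

lemma stateL_nil : stateL N M [] = vac := rfl

lemma antisymm_stateL (l : List ℕ) : Antisymm (stateL N M l) := by
  induction l with
  | nil => exact antisymm_vac
  | cons a l ih => exact ih.tau _

lemma stateL_support (l : List ℕ) : ∀ s, stateL N M l s ≠ 0 → ∀ i, (s i : ℕ) < N + l.sum := by
  induction l with
  | nil => exact fun s hs i => vac_ne_zero hs i
  | cons a l ih =>
    intro s hs i
    have := tau_shiftC_support ih s hs i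
    rw [List.sum_cons]
    omega

lemma realize_stateL {l : List ℕ} (hl : ∀ a ∈ l, 1 ≤ a) (hM : l.sum ≤ M) (θ : Fin N → ℝ) :
    realize (stateL N M l) θ =
      evT θ (l.map fun a => X a - 1 : List (MvPolynomial ℕ ℝ)).prod * realize (M := M) vac θ := by
  induction l with
  | nil => simp [stateL]
  | cons a l ih =>
    rw [List.sum_cons] at hM
    have ha : 1 ≤ a := hl a (by simp)
    rw [stateL_cons, realize_tau_shiftC ha, ih (fun b hb => hl b (by simp [hb])) (by omega),
      List.map_cons, List.prod_cons, map_mul, map_sub, map_one]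
    · simp only [evT, aeval_X]
      ring
    · intro s hs i
      have := stateL_support l s hs i
      omega

lemma evM_prod (l : List ℕ) (A : Matrix (Fin (2 * N + 1)) (Fin (2 * N + 1)) ℝ) :
    evM A (l.map fun a => X a - 1 : List (MvPolynomial ℕ ℝ)).prod =
      (l.map fun a => ptr a A).prod := by
  rw [map_list_prod, List.map_map]
  congr 2
  funext a
  simp [evM, ptr]

variable {μ : Measure (Matrix (Fin (2 * N + 1)) (Fin (2 * N + 1)) ℝ)} [IsProbabilityMeasure μ]

lemma integrable_prod_ptr (hμ : ∀ᵐ A ∂μ, A ∈ specialOrthogonalGroup (Fin (2 * N + 1)) ℝ)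
    (l : List ℕ) : Integrable (fun A => (l.map fun a => ptr a A).prod) μ := by
  have h := integrable_evM hμ (l.map fun a => X a - 1 : List (MvPolynomial ℕ ℝ)).prod
  rwa [funext (evM_prod l)] at h

variable (hμ : ∀ᵐ A ∂μ, A ∈ specialOrthogonalGroup (Fin (2 * N + 1)) ℝ)
  (hinv : ∀ g ∈ specialOrthogonalGroup (Fin (2 * N + 1)) ℝ, μ.map (fun A => g * A) = μ)

include hμ hinv

lemma integral_prod_ptr {l : List ℕ} (hl : ∀ a ∈ l, 1 ≤ a) (hM : l.sum ≤ M) :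
    ∫ A, (l.map fun a => ptr a A).prod ∂μ = stateL N M l (ground N M) := by
  simp only [← evM_prod]
  exact integral_evM_eq_ground hμ hinv (antisymm_stateL l) (realize_stateL hl hM)

lemma integral_ptr_sq {a : ℕ} (ha : 1 ≤ a) (hM : 2 * a ≤ M) :
    ∫ A, ptr a A ^ 2 ∂μ = trP (shiftC N M a) ^ 2 +
      ((low (shiftC N M a))ᵀ * low (shiftC N M a)).trace := by
  have h := integral_prod_ptr (M := M) hμ hinv (l := [a, a]) (by simpa using ha) (by simp; omega)
  have h1 := ip_vac (antisymm_stateL (N := N) (M := M) [a, a])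
  rw [stateL_cons, ip_comm, ip_tau, shiftC_transpose, stateL_cons, stateL_nil, ip_one] at h1
  have h0 : (N.factorial : ℝ) ≠ 0 := by positivity
  have h2 := mul_left_cancel₀ h0 h1
  rw [h2]
  refine Eq.trans ?_ h
  refine integral_congr_ae (Filter.Eventually.of_forall fun A => ?_)
  simp [sq]

lemma integral_ptr_sq_mul_ptr_sq {a b : ℕ} (ha : 1 ≤ a) (hb : 1 ≤ b) (hM : 2 * a + 2 * b ≤ M) :
    ∫ A, ptr a A ^ 2 * ptr b A ^ 2 ∂μ =
      (trP (shiftC N M a) ^ 2 + ((low (shiftC N M a))ᵀ * low (shiftC N M a)).trace) *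
        (trP (shiftC N M b) ^ 2 + ((low (shiftC N M b))ᵀ * low (shiftC N M b)).trace) +
      2 * ((low (shiftC N M a))ᵀ * low (shiftC N M b)).trace ^ 2 +
      4 * trP (shiftC N M a) * trP (shiftC N M b) *
        ((low (shiftC N M a))ᵀ * low (shiftC N M b)).trace +
      2 * trP (shiftC N M b) *
        ((low (shiftC N M a))ᵀ * comm (shiftC N M a) (shiftC N M b)).trace +
      2 * trP (shiftC N M a) *
        ((low (shiftC N M b))ᵀ * comm (shiftC N M a) (shiftC N M b)).trace +
      (((comm (shiftC N M a) (shiftC N M b))ᵀ * comm (shiftC N M a) (shiftC N M b)).trace -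
        ((low (shiftC N M b))ᵀ *
          (low (shiftC N M a) * (low (shiftC N M a))ᵀ * low (shiftC N M b))).trace -
        ((low (shiftC N M b))ᵀ *
          (low (shiftC N M b) * (low (shiftC N M a))ᵀ * low (shiftC N M a))).trace) := by
  have h := integral_prod_ptr (M := M) hμ hinv (l := [a, b, b, a]) (by simp [ha, hb])
    (by simp; omega)
  have h1 := ip_vac (antisymm_stateL (N := N) (M := M) [a, b, b, a])
  rw [stateL_cons, ip_comm, ip_tau, shiftC_transpose, stateL_cons, ip_tau, shiftC_transpose,
    stateL_cons, stateL_cons, stateL_nil, ip_two (shiftC_transpose b)] at h1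
  have h0 : (N.factorial : ℝ) ≠ 0 := by positivity
  have h2 := mul_left_cancel₀ h0 h1
  rw [h2]
  refine Eq.trans ?_ h
  refine integral_congr_ae (Filter.Eventually.of_forall fun A => ?_)
  simp
  ring

end Moments

section Frobenius

variable {ι : Type*} [Fintype ι] [DecidableEq ι] {O O' Y Z : Matrix ι ι ℝ}

lemma trace_transpose_mul_eq (Y Z : Matrix ι ι ℝ) :
    (Yᵀ * Z).trace = ∑ i, ∑ j, Y i j * Z i j := by
  simp only [trace, diag_apply, mul_apply, transpose_apply]
  exact Finset.sum_comm

/-- The squared Frobenius norm. -/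
def frob (Z : Matrix ι ι ℝ) : ℝ := ∑ i, ∑ j, Z i j ^ 2

lemma trace_transpose_mul_self_eq (Z : Matrix ι ι ℝ) : (Zᵀ * Z).trace = frob Z := by
  simp only [trace_transpose_mul_eq, frob, sq]

lemma frob_nonneg (Z : Matrix ι ι ℝ) : 0 ≤ frob Z :=
  Finset.sum_nonneg fun _ _ => Finset.sum_nonneg fun _ _ => sq_nonneg _

lemma frob_transpose (Z : Matrix ι ι ℝ) : frob Zᵀ = frob Z := Finset.sum_comm

/-- Bounded absolute row and column sums. -/
structure RowCol (O : Matrix ι ι ℝ) (r : ℝ) : Prop where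
  row : ∀ i, ∑ j, |O i j| ≤ r
  col : ∀ j, ∑ i, |O i j| ≤ r

lemma RowCol.transpose {r : ℝ} (h : RowCol O r) : RowCol Oᵀ r := ⟨h.col, h.row⟩

lemma RowCol.mono {r : ℝ} (h : RowCol O r) (hO : ∀ i j, |O' i j| ≤ |O i j|) : RowCol O' r :=
  ⟨fun i => (Finset.sum_le_sum fun j _ => hO i j).trans (h.row i),
    fun j => (Finset.sum_le_sum fun i _ => hO i j).trans (h.col j)⟩

lemma RowCol.frob_mul_le {r : ℝ} (h : RowCol O r) (hr : 0 ≤ r) (Z : Matrix ι ι ℝ) :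
    frob (O * Z) ≤ r ^ 2 * frob Z := by
  have h1 : ∀ i j, (O * Z) i j ^ 2 ≤ r * ∑ k, |O i k| * Z k j ^ 2 := by
    intro i j
    have h2 := Finset.sum_sq_le_sum_mul_sum_of_sq_le_mul Finset.univ
      (r := fun k => O i k * Z k j) (f := fun k => |O i k|) (g := fun k => |O i k| * Z k j ^ 2)
      (fun k _ => abs_nonneg _) (fun k _ => by positivity)
      (fun k _ => le_of_eq (by rw [mul_pow, ← sq_abs (O i k)]; ring))
    rw [mul_apply]
    refine h2.trans (mul_le_mul_of_nonneg_right (h.row i) ?_)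
    exact Finset.sum_nonneg fun k _ => by positivity
  calc frob (O * Z) ≤ ∑ i, ∑ j, r * ∑ k, |O i k| * Z k j ^ 2 :=
        Finset.sum_le_sum fun i _ => Finset.sum_le_sum fun j _ => h1 i j
    _ = r * ∑ k, (∑ i, |O i k|) * ∑ j, Z k j ^ 2 := by
        simp only [← Finset.mul_sum, Finset.sum_mul]
        congr 1
        rw [Finset.sum_comm (s := Finset.univ) (t := Finset.univ)
          (f := fun k i => |O i k| * ∑ j, Z k j ^ 2)]
        refine Finset.sum_congr rfl fun i _ => ?_
        rw [Finset.sum_comm]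
        simp only [Finset.mul_sum]
    _ ≤ r * ∑ k, r * ∑ j, Z k j ^ 2 := by
        refine mul_le_mul_of_nonneg_left (Finset.sum_le_sum fun k _ => ?_) hr
        exact mul_le_mul_of_nonneg_right (h.col k) (Finset.sum_nonneg fun _ _ => sq_nonneg _)
    _ = r ^ 2 * frob Z := by rw [← Finset.mul_sum, frob]; ring

lemma RowCol.frob_mul_le' {r : ℝ} (h : RowCol O r) (hr : 0 ≤ r) (Z : Matrix ι ι ℝ) :
    frob (Z * O) ≤ r ^ 2 * frob Z := by
  rw [← frob_transpose, transpose_mul, ← frob_transpose Z]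
  exact h.transpose.frob_mul_le hr _

lemma RowCol.abs_le {r : ℝ} (h : RowCol O r) (i j) : |O i j| ≤ r :=
  (Finset.single_le_sum (f := fun j => |O i j|) (fun _ _ => abs_nonneg _)
    (Finset.mem_univ j)).trans (h.row i)

lemma RowCol.abs_mul_le {r : ℝ} (h : RowCol O r) (h' : RowCol O' r) (hr : 0 ≤ r) (i j) :
    |(O * O') i j| ≤ r ^ 2 := by
  rw [mul_apply]
  calc |∑ k, O i k * O' k j| ≤ ∑ k, |O i k| * |O' k j| := by
        simpa only [abs_mul] using Finset.abs_sum_le_sum_abs (fun k => O i k * O' k j) Finset.univ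
    _ ≤ ∑ k, |O i k| * r := Finset.sum_le_sum fun k _ =>
        mul_le_mul_of_nonneg_left (h'.abs_le k j) (abs_nonneg _)
    _ ≤ r ^ 2 := by
        rw [← Finset.sum_mul, sq]
        exact mul_le_mul_of_nonneg_right (h.row i) hr

lemma abs_trace_le_frob (Y Z : Matrix ι ι ℝ) :
    |(Yᵀ * Z).trace| ≤ (frob Y + frob Z) / 2 := by
  have h : ∀ x y : ℝ, |x * y| ≤ (x ^ 2 + y ^ 2) / 2 := by
    intro x y
    rw [abs_le]
    constructor <;> nlinarith [sq_nonneg (x + y), sq_nonneg (x - y)]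
  rw [trace_transpose_mul_eq]
  calc |∑ i, ∑ j, Y i j * Z i j| ≤ ∑ i, ∑ j, |Y i j * Z i j| :=
        (Finset.abs_sum_le_sum_abs _ _).trans
          (Finset.sum_le_sum fun i _ => Finset.abs_sum_le_sum_abs _ _)
    _ ≤ ∑ i, ∑ j, (Y i j ^ 2 + Z i j ^ 2) / 2 :=
        Finset.sum_le_sum fun i _ => Finset.sum_le_sum fun j _ => h _ _
    _ = (frob Y + frob Z) / 2 := by
        simp only [frob, ← Finset.sum_div, Finset.sum_add_distrib]

lemma abs_trace_le {c : ℝ} (hY : ∀ i j, |Y i j| ≤ c) (hZ : ∀ i j, |Z i j| ≤ Z i j ^ 2) :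
    |(Yᵀ * Z).trace| ≤ c * frob Z := by
  rw [trace_transpose_mul_eq]
  calc |∑ i, ∑ j, Y i j * Z i j| ≤ ∑ i, ∑ j, |Y i j * Z i j| :=
        (Finset.abs_sum_le_sum_abs _ _).trans
          (Finset.sum_le_sum fun i _ => Finset.abs_sum_le_sum_abs _ _)
    _ ≤ ∑ i, ∑ j, c * Z i j ^ 2 := by
        refine Finset.sum_le_sum fun i _ => Finset.sum_le_sum fun j _ => ?_
        rw [abs_mul]
        exact mul_le_mul (hY i j) (hZ i j) (abs_nonneg _) ((abs_nonneg _).trans (hY i j))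
    _ = c * frob Z := by simp only [frob, ← Finset.mul_sum]

lemma frob_sub_le (Y Z : Matrix ι ι ℝ) : frob (Y - Z) ≤ 2 * frob Y + 2 * frob Z := by
  simp only [frob, Finset.mul_sum, ← Finset.sum_add_distrib, Matrix.sub_apply]
  refine Finset.sum_le_sum fun i _ => Finset.sum_le_sum fun j _ => ?_
  nlinarith [sq_nonneg (Y i j + Z i j)]

end Frobenius

lemma sum_ite_le_one {ι : Type*} [Fintype ι] (p : ι → Prop) [DecidablePred p]
    (h : ∀ x y, p x → p y → x = y) : ∑ x, (if p x then (1 : ℝ) else 0) ≤ 1 := by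
  rw [Finset.sum_boole]
  have : (Finset.univ.filter p).card ≤ 1 := Finset.card_le_one.2 fun x hx y hy => by
    simp only [Finset.mem_filter, Finset.mem_univ, true_and] at hx hy
    exact h x y hx hy
  exact_mod_cast this

section Bounds

variable {N M : ℕ}

lemma low_sub_trace (O Y : Matrix (Fin (N + M)) (Fin (N + M)) ℝ) :
    ((low O)ᵀ * low Y).trace = ((low O)ᵀ * Y).trace := by
  simp only [trace_transpose_mul_eq]
  refine Finset.sum_congr rfl fun i _ => Finset.sum_congr rfl fun j _ => ?_
  simp only [low]
  split_ifs <;> simp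

lemma frob_low_le (O : Matrix (Fin (N + M)) (Fin (N + M)) ℝ) : frob (low O) ≤ frob O := by
  refine Finset.sum_le_sum fun i _ => Finset.sum_le_sum fun j _ => ?_
  simp only [low]
  split_ifs
  · exact le_rfl
  · rw [zero_pow two_ne_zero]
    exact sq_nonneg _

lemma rowCol_shiftC (a : ℕ) : RowCol (shiftC N M a) 3 := by
  have h : ∀ i, ∑ j, |shiftC N M a i j| ≤ 3 := by
    intro i
    have h1 := sum_ite_le_one (fun j : Fin (N + M) => (j : ℕ) = i + a) (by
      intro x y hx hy; exact Fin.ext (by omega))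
    have h2 := sum_ite_le_one (fun j : Fin (N + M) => (i : ℕ) = j + a) (by
      intro x y hx hy; exact Fin.ext (by omega))
    have h3 := sum_ite_le_one (fun j : Fin (N + M) => (i : ℕ) + j + 1 = a) (by
      intro x y hx hy; exact Fin.ext (by omega))
    calc ∑ j, |shiftC N M a i j| ≤ ∑ j : Fin (N + M), ((if (j : ℕ) = i + a then (1 : ℝ) else 0) +
          (if (i : ℕ) = j + a then 1 else 0) + (if (i : ℕ) + j + 1 = a then 1 else 0)) := by
          refine Finset.sum_le_sum fun j _ => ?_
          simp only [shiftC]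
          split_ifs <;> norm_num
      _ ≤ 3 := by
          simp only [Finset.sum_add_distrib]
          linarith
  exact ⟨h, fun j => by simpa only [shiftC_comm a _ j] using h j⟩

lemma rowCol_low_shiftC (a : ℕ) : RowCol (low (shiftC N M a)) 3 := by
  refine (rowCol_shiftC a).mono fun i j => ?_
  simp only [low]
  split_ifs <;> simp

lemma abs_low_shiftC_le (a : ℕ) (i j : Fin (N + M)) :
    |low (shiftC N M a) i j| ≤ low (shiftC N M a) i j ^ 2 := by
  simp only [low, shiftC]
  split_ifs <;> norm_num

/-- The connected part of the fourth moment. -/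
def kappaFour (C D : Matrix (Fin (N + M)) (Fin (N + M)) ℝ) : ℝ :=
  ((comm C D)ᵀ * comm C D).trace - ((low D)ᵀ * (low C * (low C)ᵀ * low D)).trace -
    ((low D)ᵀ * (low D * (low C)ᵀ * low C)).trace

lemma frob_comm_le (a b : ℕ) : frob (comm (shiftC N M a) (shiftC N M b)) ≤
    36 * frob (low (shiftC N M a)) := by
  have h1 := (rowCol_shiftC (N := N) (M := M) b).frob_mul_le (by norm_num) (low (shiftC N M a))
  have h2 := (rowCol_shiftC (N := N) (M := M) b).frob_mul_le' (by norm_num) (low (shiftC N M a))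
  have h3 := (frob_low_le _).trans (frob_sub_le (shiftC N M b * low (shiftC N M a))
    (low (shiftC N M a) * shiftC N M b))
  rw [comm]
  linarith

lemma abs_kappaFour_le (a b : ℕ) : |kappaFour (shiftC N M a) (shiftC N M b)| ≤
    54 * frob (low (shiftC N M a)) := by
  have h1 := frob_comm_le (N := N) (M := M) a b
  have h2 : ((low (shiftC N M b))ᵀ * (low (shiftC N M a) * (low (shiftC N M a))ᵀ *
      low (shiftC N M b))).trace = frob ((low (shiftC N M a))ᵀ * low (shiftC N M b)) := by
    rw [← trace_transpose_mul_self_eq, transpose_mul, transpose_transpose]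
    simp only [Matrix.mul_assoc]
  have h3 : ((low (shiftC N M b))ᵀ * (low (shiftC N M b) * (low (shiftC N M a))ᵀ *
      low (shiftC N M a))).trace = frob (low (shiftC N M b) * (low (shiftC N M a))ᵀ) := by
    rw [← trace_transpose_mul_self_eq, transpose_mul, transpose_transpose]
    simp only [Matrix.mul_assoc]
    rw [trace_mul_comm (low (shiftC N M a))]
    simp only [Matrix.mul_assoc]
  have h4 := (rowCol_low_shiftC (N := N) (M := M) b).frob_mul_le' (by norm_num)
    (low (shiftC N M a))ᵀ
  have h5 := (rowCol_low_shiftC (N := N) (M := M) b).frob_mul_le (by norm_num)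
    (low (shiftC N M a))ᵀ
  have h6 := frob_nonneg (comm (shiftC N M a) (shiftC N M b))
  have h7 := frob_nonneg ((low (shiftC N M a))ᵀ * low (shiftC N M b))
  have h8 := frob_nonneg (low (shiftC N M b) * (low (shiftC N M a))ᵀ)
  rw [frob_transpose] at h4 h5
  rw [kappaFour, h2, h3, trace_transpose_mul_self_eq, abs_le]
  constructor <;> linarith

lemma abs_trace_comm_left_le (a b : ℕ) :
    |((low (shiftC N M a))ᵀ * comm (shiftC N M a) (shiftC N M b)).trace| ≤
      19 * frob (low (shiftC N M a)) := by
  have h1 := frob_comm_le (N := N) (M := M) a b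
  have h2 := abs_trace_le_frob (low (shiftC N M a)) (comm (shiftC N M a) (shiftC N M b))
  have h3 := frob_nonneg (low (shiftC N M a))
  linarith

lemma abs_trace_comm_right_le (a b : ℕ) :
    |((low (shiftC N M b))ᵀ * comm (shiftC N M a) (shiftC N M b)).trace| ≤
      18 * frob (low (shiftC N M a)) := by
  have h1 := rowCol_shiftC (N := N) (M := M) b
  have h2 := rowCol_low_shiftC (N := N) (M := M) b
  have h3 := abs_trace_le (h1.abs_mul_le h2 (by norm_num)) (abs_low_shiftC_le (N := N) (M := M) a)
  have h4 := abs_trace_le (h2.abs_mul_le h1 (by norm_num)) (abs_low_shiftC_le (N := N) (M := M) a)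
  have h5 : ((low (shiftC N M b))ᵀ * comm (shiftC N M a) (shiftC N M b)).trace =
      ((shiftC N M b * low (shiftC N M b))ᵀ * low (shiftC N M a)).trace -
        ((low (shiftC N M b) * shiftC N M b)ᵀ * low (shiftC N M a)).trace := by
    rw [comm, low_sub_trace, mul_sub, trace_sub, transpose_mul, transpose_mul, shiftC_transpose,
      ← Matrix.mul_assoc, ← Matrix.mul_assoc, trace_mul_comm _ (shiftC N M b),
      Matrix.mul_assoc (shiftC N M b)]
  rw [h5]
  refine (abs_sub _ _).trans ?_
  linarith

lemma trace_low_low_of_lt {a b : ℕ} (hab : a < b) :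
    |((low (shiftC N M a))ᵀ * low (shiftC N M b)).trace| ≤ 1 := by
  rw [trace_transpose_mul_eq, ← Fintype.sum_prod_type']
  have h := sum_ite_le_one (fun p : Fin (N + M) × Fin (N + M) =>
    (p.1 : ℕ) = p.2 + a ∧ (p.1 : ℕ) + p.2 + 1 = b) (by
      rintro ⟨x, y⟩ ⟨z, w⟩ h1 h2
      simp only at h1 h2
      exact Prod.ext (Fin.ext (by simp; omega)) (Fin.ext (by simp; omega)))
  refine (Finset.abs_sum_le_sum_abs _ _).trans (le_trans (Finset.sum_le_sum fun p _ => ?_) h)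
  simp only [low, shiftC]
  by_cases hp : N ≤ (p.1 : ℕ) ∧ (p.2 : ℕ) < N
  · rw [if_pos hp, if_pos hp]
    split_ifs <;> first | omega | norm_num
  · rw [if_neg hp, if_neg hp]
    split_ifs <;> norm_num

lemma trP_shiftC {a : ℕ} (ha : 1 ≤ a) :
    trP (shiftC N M a) = -(if Odd a ∧ a < 2 * N then 1 else 0) := by
  have h1 : ∀ i : Fin N, shiftC N M a (Fin.castAdd M i) (Fin.castAdd M i) =
      -(if 2 * (i : ℕ) + 1 = a then (1 : ℝ) else 0) := by
    intro i
    simp only [shiftC, Fin.val_castAdd]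
    split_ifs <;> first | omega | norm_num
  rw [trP, Finset.sum_congr rfl fun i _ => h1 i, Finset.sum_neg_distrib]
  congr 1
  split_ifs with h
  · obtain ⟨⟨k, hk⟩, h2⟩ := h
    rw [Finset.sum_eq_single_of_mem ⟨k, by omega⟩ (Finset.mem_univ _)]
    · simp [hk]
    · intro i _ hi
      have : (i : ℕ) ≠ k := fun h => hi (Fin.ext h)
      exact if_neg (by omega)
  · refine Finset.sum_eq_zero fun i _ => if_neg fun hi => h ⟨⟨i, hi.symm⟩, ?_⟩
    have := i.2
    omega

lemma sum_range_ite_lt (n c : ℕ) :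
    ∑ j ∈ Finset.range n, (if j < c then (1 : ℝ) else 0) = (min c n : ℕ) := by
  induction n with
  | zero => simp
  | succ n ih =>
    rw [Finset.sum_range_succ, ih]
    split_ifs with h
    · rw [min_eq_right (by omega), min_eq_right (by omega)]; push_cast; ring
    · rw [min_eq_left (by omega), min_eq_left (by omega)]; simp

lemma frob_low_shiftC {a : ℕ} (hM : a ≤ M) :
    frob (low (shiftC N M a)) = (min a (2 * N) : ℕ) := by
  have h1 : ∀ j : Fin N, ∑ i, low (shiftC N M a) i (Fin.castAdd M j) ^ 2 =
      (if N - 1 - (j : ℕ) < a then 1 else 0) + (if (j : ℕ) < a - N then 1 else 0) := by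
    intro j
    have hj := j.2
    have h2 : ∀ i, low (shiftC N M a) i (Fin.castAdd M j) ^ 2 =
        (if N ≤ (i : ℕ) ∧ (i : ℕ) = j + a then 1 else 0) +
          (if N ≤ (i : ℕ) ∧ (i : ℕ) + j + 1 = a then 1 else 0) := by
      intro i
      simp only [low, shiftC, Fin.val_castAdd]
      split_ifs <;> first | omega | norm_num
    rw [Finset.sum_congr rfl fun i _ => h2 i, Finset.sum_add_distrib]
    congr 1
    · split_ifs with h
      · rw [Finset.sum_eq_single_of_mem (⟨j + a, by omega⟩ : Fin (N + M)) (Finset.mem_univ _)]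
        · exact if_pos ⟨by simp; omega, rfl⟩
        · intro i _ hi
          exact if_neg fun h => hi (Fin.ext h.2)
      · exact Finset.sum_eq_zero fun i _ => if_neg (by omega)
    · split_ifs with h
      · rw [Finset.sum_eq_single_of_mem (⟨a - 1 - j, by omega⟩ : Fin (N + M)) (Finset.mem_univ _)]
        · exact if_pos ⟨by simp; omega, by simp; omega⟩
        · intro i _ hi
          exact if_neg fun h => hi (Fin.ext (by simp; omega))
      · exact Finset.sum_eq_zero fun i _ => if_neg (by omega)
  have h3 : ∀ j : Fin M, ∑ i, low (shiftC N M a) i (Fin.natAdd N j) ^ 2 = 0 := by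
    intro j
    refine Finset.sum_eq_zero fun i _ => ?_
    simp [low]
  rw [frob, Finset.sum_comm, Fin.sum_univ_add, Finset.sum_congr rfl fun j _ => h1 j,
    Finset.sum_congr rfl fun j _ => h3 j, Finset.sum_const_zero, add_zero,
    Finset.sum_add_distrib,
    Fin.sum_univ_eq_sum_range (fun j => if N - 1 - j < a then (1 : ℝ) else 0),
    Finset.sum_range_reflect (fun j => if j < a then (1 : ℝ) else 0),
    Fin.sum_univ_eq_sum_range (fun j => if j < a - N then (1 : ℝ) else 0),
    sum_range_ite_lt, sum_range_ite_lt, ← Nat.cast_add]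
  congr 1
  omega

end Bounds

section Select

variable {ι κ : Type*} [Fintype ι] [DecidableEq ι] [Fintype κ] [DecidableEq κ]

/-- The matrix with unit columns indexed by `u`. -/
def sel (u : κ → ι) : Matrix ι κ ℝ := fun i t => if i = u t then 1 else 0

lemma sel_transpose_mul_mul (u v : κ → ι) (Z : Matrix ι ι ℝ) :
    (sel u)ᵀ * Z * sel v = Z.submatrix u v := by
  ext s t
  simp [mul_apply, sel]

lemma sel_transpose_mul_self {u : κ → ι} (hu : Function.Injective u) : (sel u)ᵀ * sel u = 1 := by
  have h := sel_transpose_mul_mul u u 1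
  rw [Matrix.mul_one, submatrix_one u hu] at h
  exact h

lemma trace_sel_mul (u v : κ → ι) (Z : Matrix ι ι ℝ) :
    ((sel u * (sel v)ᵀ)ᵀ * Z).trace = ∑ t, Z (u t) (v t) := by
  rw [transpose_mul, transpose_transpose, Matrix.mul_assoc, trace_mul_comm,
    sel_transpose_mul_mul]
  rfl

lemma transpose_mul_mul_sel (u v : κ → ι) (Z : Matrix ι ι ℝ) :
    (sel u * (sel v)ᵀ)ᵀ * Z * (sel u * (sel v)ᵀ) = sel v * Z.submatrix u u * (sel v)ᵀ := by
  rw [← sel_transpose_mul_mul, transpose_mul, transpose_transpose]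
  simp only [Matrix.mul_assoc]

lemma trace_transpose_mul_mul_sel (u : κ → ι) {v : κ → ι} (hv : Function.Injective v)
    (Z : Matrix ι ι ℝ) :
    ((sel u * (sel v)ᵀ)ᵀ * Z * (sel u * (sel v)ᵀ)).trace = ∑ t, Z (u t) (u t) := by
  rw [transpose_mul_mul_sel, Matrix.mul_assoc, trace_mul_comm, Matrix.mul_assoc,
    sel_transpose_mul_self hv, Matrix.mul_one]
  rfl

end Select

section Small

variable {N M : ℕ}

/-- The projection onto the occupied indices. -/
def projP (N M : ℕ) : Matrix (Fin (N + M)) (Fin (N + M)) ℝ :=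
  diagonal fun i => if (i : ℕ) < N then 1 else 0

/-- The projection onto the unoccupied indices. -/
def projQ (N M : ℕ) : Matrix (Fin (N + M)) (Fin (N + M)) ℝ :=
  diagonal fun i => if N ≤ (i : ℕ) then 1 else 0

lemma low_eq (O : Matrix (Fin (N + M)) (Fin (N + M)) ℝ) : low O = projQ N M * O * projP N M := by
  ext i j
  simp only [projP, projQ, mul_diagonal, diagonal_mul, low]
  split_ifs <;> first | omega | simp

lemma projP_transpose : (projP N M)ᵀ = projP N M := diagonal_transpose _

lemma projQ_transpose : (projQ N M)ᵀ = projQ N M := diagonal_transpose _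

lemma projP_mul_self : projP N M * projP N M = projP N M := by
  rw [projP, diagonal_mul_diagonal]
  simp

lemma projQ_mul_self : projQ N M * projQ N M = projQ N M := by
  rw [projQ, diagonal_mul_diagonal]
  simp

lemma projQ_mul_low (O : Matrix (Fin (N + M)) (Fin (N + M)) ℝ) : projQ N M * low O = low O := by
  rw [low_eq, ← Matrix.mul_assoc, ← Matrix.mul_assoc, projQ_mul_self]

lemma low_mul_projP (O : Matrix (Fin (N + M)) (Fin (N + M)) ℝ) : low O * projP N M = low O := by
  rw [low_eq, Matrix.mul_assoc, projP_mul_self]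

variable {C D : Matrix (Fin (N + M)) (Fin (N + M)) ℝ}

lemma kappaFour_eq_zero {κ : Type*} [Fintype κ] [DecidableEq κ] {u v : κ → Fin (N + M)}
    (hC : low C = sel u * (sel v)ᵀ) (hu : Function.Injective u) (hv : Function.Injective v)
    (hD : Dᵀ = D) (hDu : ∀ s t, D (u s) (u t) = 0) {c : ℝ}
    (hKu : ∀ t, (D * projQ N M * D) (u t) (u t) - (D * projP N M * D) (u t) (u t) = c)
    (hKv : ∀ t, (D * projQ N M * D) (v t) (v t) - (D * projP N M * D) (v t) (v t) = c) :
    kappaFour C D = 0 := by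
  have hA0 : (low C)ᵀ * D * low C = 0 := by
    rw [hC, transpose_mul_mul_sel]
    have : D.submatrix u u = 0 := by ext s t; exact hDu s t
    rw [this, Matrix.mul_zero, Matrix.zero_mul]
  have tu : ∀ Z, ((low C)ᵀ * Z * low C).trace = ∑ t, Z (u t) (u t) := fun Z => by
    rw [hC, trace_transpose_mul_mul_sel u hv]
  have tv : ∀ Z, (low C * Z * (low C)ᵀ).trace = ∑ t, Z (v t) (v t) := fun Z => by
    have h := trace_transpose_mul_mul_sel v hu Z
    have h1 : (sel v * (sel u)ᵀ) = (low C)ᵀ := by rw [hC, transpose_mul, transpose_transpose]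
    rwa [h1, transpose_transpose] at h
  have hQA := projQ_mul_low C
  have hAP := low_mul_projP C
  have hAQ : (low C)ᵀ * projQ N M = (low C)ᵀ := by
    conv_rhs => rw [← hQA, transpose_mul, projQ_transpose]
  have hPA : projP N M * (low C)ᵀ = (low C)ᵀ := by
    conv_rhs => rw [← hAP, transpose_mul, projP_transpose]
  have hX : comm C D = projQ N M * D * low C - low C * D * projP N M := by
    rw [comm, low_eq (D * low C - low C * D), mul_sub, sub_mul]
    congr 1
    · rw [← Matrix.mul_assoc, Matrix.mul_assoc _ (low C), hAP]
    · rw [← Matrix.mul_assoc, hQA]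
  have hB : (low D)ᵀ = projP N M * D * projQ N M := by
    rw [low_eq, transpose_mul, transpose_mul, projP_transpose, projQ_transpose, hD,
      Matrix.mul_assoc]
  have e1 : ((comm C D)ᵀ * comm C D).trace = ∑ t, (D * projQ N M * D) (u t) (u t) +
      ∑ t, (D * projP N M * D) (v t) (v t) := by
    rw [← tu, ← tv, hX, transpose_sub, transpose_mul, transpose_mul, transpose_mul, transpose_mul,
      hD, projP_transpose, projQ_transpose, sub_mul, mul_sub, mul_sub]
    have f1 : (low C)ᵀ * (D * projQ N M) * (low C * D * projP N M) = 0 := by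
      calc _ = (low C)ᵀ * D * (projQ N M * low C) * D * projP N M := by
            simp only [Matrix.mul_assoc]
        _ = 0 := by rw [hQA, hA0, Matrix.zero_mul, Matrix.zero_mul]
    have f2 : projP N M * (D * (low C)ᵀ) * (projQ N M * D * low C) = 0 := by
      calc _ = projP N M * D * (((low C)ᵀ * projQ N M) * D * low C) := by
            simp only [Matrix.mul_assoc]
        _ = 0 := by rw [hAQ, hA0, Matrix.mul_zero]
    have f3 : (low C)ᵀ * (D * projQ N M) * (projQ N M * D * low C) =
        (low C)ᵀ * (D * projQ N M * D) * low C := by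
      calc _ = (low C)ᵀ * D * (projQ N M * projQ N M) * D * low C := by
            simp only [Matrix.mul_assoc]
        _ = _ := by rw [projQ_mul_self]; simp only [Matrix.mul_assoc]
    have f4 : (projP N M * (D * (low C)ᵀ) * (low C * D * projP N M)).trace =
        (low C * (D * projP N M * D) * (low C)ᵀ).trace := by
      calc _ = ((projP N M * D * (low C)ᵀ) * (low C * D * projP N M)).trace := by
            simp only [Matrix.mul_assoc]
        _ = (low C * D * (projP N M * projP N M) * D * (low C)ᵀ).trace := by
            rw [trace_mul_comm]; simp only [Matrix.mul_assoc]
        _ = _ := by rw [projP_mul_self]; simp only [Matrix.mul_assoc]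
    rw [f1, f2, f3, sub_zero, zero_sub, sub_neg_eq_add, trace_add, f4]
  have e2 : ((low D)ᵀ * (low C * (low C)ᵀ * low D)).trace =
      ∑ t, (D * projP N M * D) (u t) (u t) := by
    rw [← tu, hB, low_eq D]
    calc _ = ((projP N M * D * (projQ N M * low C)) *
          (((low C)ᵀ * projQ N M) * D * projP N M)).trace := by simp only [Matrix.mul_assoc]
      _ = ((low C)ᵀ * D * (projP N M * projP N M) * D * low C).trace := by
        rw [hQA, hAQ, trace_mul_comm]; simp only [Matrix.mul_assoc]
      _ = _ := by rw [projP_mul_self]; simp only [Matrix.mul_assoc]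
  have e3 : ((low D)ᵀ * (low D * (low C)ᵀ * low C)).trace =
      ∑ t, (D * projQ N M * D) (v t) (v t) := by
    rw [← tv, hB, low_eq D]
    calc _ = (projP N M * (D * (projQ N M * projQ N M) * D * (projP N M * (low C)ᵀ) *
          low C)).trace := by simp only [Matrix.mul_assoc]
      _ = ((D * projQ N M * D * (low C)ᵀ) * (low C * projP N M)).trace := by
        rw [projQ_mul_self, hPA, trace_mul_comm]; simp only [Matrix.mul_assoc]
      _ = _ := by rw [hAP, trace_mul_comm]; simp only [Matrix.mul_assoc]
  rw [kappaFour, e1, e2, e3]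
  have h1 := Finset.sum_congr rfl fun t (_ : t ∈ Finset.univ) => hKu t
  have h2 := Finset.sum_congr rfl fun t (_ : t ∈ Finset.univ) => hKv t
  rw [Finset.sum_sub_distrib] at h1 h2
  linarith

lemma trace_comm_left_eq_zero {κ : Type*} [Fintype κ] [DecidableEq κ] {u v : κ → Fin (N + M)}
    (hC : low C = sel u * (sel v)ᵀ) (hu : Function.Injective u) (hv : Function.Injective v)
    (hDu : ∀ t, D (u t) (u t) = 0) (hDv : ∀ t, D (v t) (v t) = 0) :
    ((low C)ᵀ * comm C D).trace = 0 := by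
  have h1 := trace_transpose_mul_mul_sel u hv D
  have h2 := trace_transpose_mul_mul_sel v hu D
  have h3 : (sel v * (sel u)ᵀ) = (low C)ᵀ := by rw [hC, transpose_mul, transpose_transpose]
  rw [h3, transpose_transpose] at h2
  rw [← hC] at h1
  rw [comm, low_sub_trace, mul_sub, trace_sub, ← Matrix.mul_assoc, h1, ← Matrix.mul_assoc,
    trace_mul_comm ((low C)ᵀ * low C), trace_mul_comm D, Matrix.mul_assoc, trace_mul_comm, h2]
  simp [hDu, hDv]

lemma trace_comm_right_eq_zero {κ : Type*} [Fintype κ] [DecidableEq κ] {u v : κ → Fin (N + M)}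
    (hC : low C = sel u * (sel v)ᵀ) (hD : Dᵀ = D) (h : ∀ t k, D (v t) k * D k (u t) = 0) :
    ((low D)ᵀ * comm C D).trace = 0 := by
  have hB : (low D)ᵀ = projP N M * D * projQ N M := by
    rw [low_eq, transpose_mul, transpose_mul, projP_transpose, projQ_transpose, hD,
      Matrix.mul_assoc]
  have hz : ∀ q : Fin (N + M) → ℝ, ((D * diagonal q * D) * low C).trace = 0 := by
    intro q
    have h3 : low C = (sel v * (sel u)ᵀ)ᵀ := by rw [hC, transpose_mul, transpose_transpose]
    rw [trace_mul_comm, h3, trace_sel_mul]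
    refine Finset.sum_eq_zero fun t _ => ?_
    rw [mul_apply]
    refine Finset.sum_eq_zero fun k _ => ?_
    rw [mul_diagonal, mul_right_comm, h, zero_mul]
  rw [comm, low_sub_trace, mul_sub, trace_sub, hB]
  have e1 : (projP N M * D * projQ N M * (D * low C)).trace =
      ((D * projQ N M * D) * (low C * projP N M)).trace := by
    rw [Matrix.mul_assoc, Matrix.mul_assoc, trace_mul_comm]
    simp only [Matrix.mul_assoc]
  have e2 : (projP N M * D * projQ N M * (low C * D)).trace =
      ((D * projP N M * D) * (projQ N M * low C)).trace := by
    calc _ = ((projP N M * D * (projQ N M * low C)) * D).trace := by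
          simp only [Matrix.mul_assoc]
      _ = _ := by rw [trace_mul_comm]; simp only [Matrix.mul_assoc]
  rw [e1, e2, low_mul_projP, projQ_mul_low, projQ, projP, hz, hz, sub_zero]

/-- The first `a` unoccupied indices. -/
def idxJ {a : ℕ} (N : ℕ) {M : ℕ} (h : a ≤ M) (t : Fin a) : Fin (N + M) := ⟨N + t, by omega⟩

/-- The last `a` occupied indices. -/
def idxI {a N : ℕ} (M : ℕ) (h : a ≤ N) (t : Fin a) : Fin (N + M) := ⟨N - a + t, by omega⟩

lemma val_idxJ {a : ℕ} (h : a ≤ M) (t : Fin a) : (idxJ N h t : ℕ) = N + t := rfl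

lemma val_idxI {a : ℕ} (h : a ≤ N) (t : Fin a) : (idxI M h t : ℕ) = N - a + t := rfl

lemma idxJ_injective {a : ℕ} (h : a ≤ M) : Function.Injective (idxJ N h) := by
  intro s t hst
  simp only [idxJ, Fin.mk.injEq] at hst
  exact Fin.ext (by omega)

lemma idxI_injective {a : ℕ} (h : a ≤ N) : Function.Injective (idxI M h) := by
  intro s t hst
  simp only [idxI, Fin.mk.injEq] at hst
  exact Fin.ext (by omega)

lemma low_shiftC_eq_sel {a : ℕ} (haN : a ≤ N) (haM : a ≤ M) :
    low (shiftC N M a) = sel (idxJ N haM) * (sel (idxI M haN))ᵀ := by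
  ext i j
  simp only [mul_apply, transpose_apply, sel]
  have eJ := fun t => val_idxJ (N := N) haM t
  have eI := fun t => val_idxI (M := M) haN t
  by_cases h : N ≤ (i : ℕ) ∧ (j : ℕ) < N ∧ (i : ℕ) = j + a
  · rw [Finset.sum_eq_single_of_mem ⟨i - N, by omega⟩ (Finset.mem_univ _)]
    · rw [if_pos (Fin.ext (by rw [eJ]; simp only; omega)),
        if_pos (Fin.ext (by rw [eI]; simp only; omega)), low,
        if_pos ⟨h.1, h.2.1⟩, shiftC, if_neg (by omega), if_pos h.2.2, if_neg (by omega)]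
      norm_num
    · intro t _ ht
      rw [if_neg, zero_mul]
      intro h1
      refine ht (Fin.ext ?_)
      have e1 := eJ t
      rw [← h1] at e1
      simp only
      omega
  · rw [Finset.sum_eq_zero]
    · simp only [low, shiftC]
      split_ifs <;> first | omega | norm_num
    · intro t _
      rw [mul_eq_zero, ite_eq_right_iff, ite_eq_right_iff]
      by_contra h1
      push Not at h1
      have e1 := eJ t
      have e2 := eI t
      rw [← h1.1.1] at e1
      rw [← h1.2.1] at e2
      omega

lemma sum_ite_eq_one {L p : ℕ} (hp : p < L) (P : Fin L → Prop) [DecidablePred P]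
    (hP : ∀ k : Fin L, P k ↔ (k : ℕ) = p) : ∑ k, (if P k then (1 : ℝ) else 0) = 1 := by
  rw [Finset.sum_eq_single_of_mem ⟨p, hp⟩ (Finset.mem_univ _)]
  · exact if_pos ((hP _).2 rfl)
  · intro k _ hk
    exact if_neg fun h => hk (Fin.ext ((hP k).1 h))

/-- The pairs for which the squared traces are uncorrelated up to the diagonal. -/
def Good (N a b : ℕ) : Prop :=
  b + 2 * a ≤ N ∨ (N + 2 * a ≤ b ∧ b + 2 * a ≤ 2 * N) ∨ 2 * N + 2 * a ≤ b

lemma exists_const {a b : ℕ} (ha : 1 ≤ a) (hab : a ≤ b) (haN : 2 * a ≤ N)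
    (hM : a + b ≤ M) (hg : Good N a b) : ∃ c : ℝ, ∀ i : Fin (N + M), N - a ≤ (i : ℕ) →
      (i : ℕ) < N + a → (shiftC N M b * projQ N M * shiftC N M b) i i -
        (shiftC N M b * projP N M * shiftC N M b) i i = c := by
  have h : ∀ i : Fin (N + M), (shiftC N M b * projQ N M * shiftC N M b) i i -
      (shiftC N M b * projP N M * shiftC N M b) i i =
      ∑ k : Fin (N + M), (if N ≤ (k : ℕ) then 1 else -1) * shiftC N M b i k ^ 2 := by
    intro i
    rw [mul_apply, mul_apply, ← Finset.sum_sub_distrib]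
    refine Finset.sum_congr rfl fun k _ => ?_
    rw [projP, projQ, mul_diagonal, mul_diagonal, shiftC_comm b k i]
    split_ifs <;> first | omega | ring
  simp only [h]
  rcases hg with hg | hg | hg
  · refine ⟨0, fun i h1 h2 => ?_⟩
    have h3 : ∀ k : Fin (N + M), (if N ≤ (k : ℕ) then 1 else -1) * shiftC N M b i k ^ 2 =
        (if (k : ℕ) = i + b then (1 : ℝ) else 0) - (if (i : ℕ) = k + b then 1 else 0) := by
      intro k
      simp only [shiftC]
      split_ifs <;> first | omega | norm_num
    rw [Finset.sum_congr rfl fun k _ => h3 k, Finset.sum_sub_distrib,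
      sum_ite_eq_one (p := i + b) (by omega) _ (by intro k; omega),
      sum_ite_eq_one (p := i - b) (by omega) _ (by intro k; omega), sub_self]
  · refine ⟨0, fun i h1 h2 => ?_⟩
    have h3 : ∀ k : Fin (N + M), (if N ≤ (k : ℕ) then 1 else -1) * shiftC N M b i k ^ 2 =
        (if (k : ℕ) = i + b then (1 : ℝ) else 0) - (if (i : ℕ) + k + 1 = b then 1 else 0) := by
      intro k
      simp only [shiftC]
      split_ifs <;> first | omega | norm_num
    rw [Finset.sum_congr rfl fun k _ => h3 k, Finset.sum_sub_distrib,
      sum_ite_eq_one (p := i + b) (by omega) _ (by intro k; omega),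
      sum_ite_eq_one (p := b - 1 - i) (by omega) _ (by intro k; omega), sub_self]
  · refine ⟨2, fun i h1 h2 => ?_⟩
    have h3 : ∀ k : Fin (N + M), (if N ≤ (k : ℕ) then 1 else -1) * shiftC N M b i k ^ 2 =
        (if (k : ℕ) = i + b then (1 : ℝ) else 0) + (if (i : ℕ) + k + 1 = b then 1 else 0) := by
      intro k
      simp only [shiftC]
      split_ifs <;> first | omega | norm_num
    rw [Finset.sum_congr rfl fun k _ => h3 k, Finset.sum_add_distrib,
      sum_ite_eq_one (p := i + b) (by omega) _ (by intro k; omega),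
      sum_ite_eq_one (p := b - 1 - i) (by omega) _ (by intro k; omega)]
    norm_num

lemma small_vanishing {a b : ℕ} (ha : 1 ≤ a) (hab : a ≤ b) (haN : 2 * a ≤ N)
    (hM : a + b ≤ M) (hg : Good N a b) :
    kappaFour (shiftC N M a) (shiftC N M b) = 0 ∧
      ((low (shiftC N M a))ᵀ * comm (shiftC N M a) (shiftC N M b)).trace = 0 ∧
      ((low (shiftC N M b))ᵀ * comm (shiftC N M a) (shiftC N M b)).trace = 0 ∧
      (a < b → ((low (shiftC N M a))ᵀ * low (shiftC N M b)).trace = 0) := by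
  have h1 : a ≤ N := by omega
  have h2 : a ≤ M := by omega
  have hC := low_shiftC_eq_sel h1 h2
  have hJ := idxJ_injective (N := N) h2
  have hI := idxI_injective (M := M) h1
  have hDu : ∀ s t, shiftC N M b (idxJ N h2 s) (idxJ N h2 t) = 0 := by
    intro s t
    have := s.2
    have := t.2
    have e1 := val_idxJ (N := N) h2 s
    have e2 := val_idxJ (N := N) h2 t
    rw [shiftC, if_neg (by omega), if_neg (by omega), if_neg (by unfold Good at hg; omega)]
    norm_num
  have hDv : ∀ s t, shiftC N M b (idxI M h1 s) (idxI M h1 t) = 0 := by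
    intro s t
    have := s.2
    have := t.2
    have e1 := val_idxI (M := M) h1 s
    have e2 := val_idxI (M := M) h1 t
    rw [shiftC, if_neg (by omega), if_neg (by omega), if_neg (by unfold Good at hg; omega)]
    norm_num
  obtain ⟨c, hc⟩ := exists_const ha hab haN hM hg
  refine ⟨kappaFour_eq_zero hC hJ hI (shiftC_transpose b) hDu (c := c) (fun t => hc _ ?_ ?_)
    (fun t => hc _ ?_ ?_), trace_comm_left_eq_zero hC hJ hI (fun t => hDu t t) (fun t => hDv t t),
    trace_comm_right_eq_zero hC (shiftC_transpose b) fun t k => ?_, fun hlt => ?_⟩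
  · rw [val_idxJ]; omega
  · rw [val_idxJ]; omega
  · rw [val_idxI]; omega
  · rw [val_idxI]; omega
  · have := t.2
    have e1 := val_idxI (M := M) h1 t
    have e2 := val_idxJ (N := N) h2 t
    simp only [shiftC]
    unfold Good at hg
    split_ifs <;> first | omega | norm_num
  · rw [hC, trace_sel_mul]
    refine Finset.sum_eq_zero fun t _ => ?_
    have := t.2
    have e1 := val_idxI (M := M) h1 t
    have e2 := val_idxJ (N := N) h2 t
    simp only [low, shiftC]
    unfold Good at hg
    split_ifs <;> first | omega | norm_num

end Small

section Covariance

variable {N : ℕ}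

/-- The covariance of squared centred power traces. -/
def covSq (μ : Measure (Matrix (Fin (2 * N + 1)) (Fin (2 * N + 1)) ℝ)) (a b : ℕ) : ℝ :=
  ∫ A, ptr a A ^ 2 * ptr b A ^ 2 ∂μ - (∫ A, ptr a A ^ 2 ∂μ) * ∫ A, ptr b A ^ 2 ∂μ

variable {μ : Measure (Matrix (Fin (2 * N + 1)) (Fin (2 * N + 1)) ℝ)} [IsProbabilityMeasure μ]

lemma covSq_comm (a b : ℕ) : covSq μ a b = covSq μ b a := by
  simp only [covSq, mul_comm (ptr a _ ^ 2), mul_comm (∫ A, ptr a A ^ 2 ∂μ)]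

variable (hμ : ∀ᵐ A ∂μ, A ∈ specialOrthogonalGroup (Fin (2 * N + 1)) ℝ)
  (hinv : ∀ g ∈ specialOrthogonalGroup (Fin (2 * N + 1)) ℝ, μ.map (fun A => g * A) = μ)

include hμ hinv

lemma integral_ptr_sq_eq {a : ℕ} (ha : 1 ≤ a) :
    ∫ A, ptr a A ^ 2 ∂μ = (if Odd a ∧ a < 2 * N then 1 else 0) + (min a (2 * N) : ℕ) := by
  rw [integral_ptr_sq (M := 2 * a) hμ hinv ha le_rfl, trP_shiftC ha,
    trace_transpose_mul_self_eq, frob_low_shiftC (by omega), neg_sq]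
  split_ifs <;> simp

lemma covSq_eq {M a b : ℕ} (ha : 1 ≤ a) (hb : 1 ≤ b) (hM : 2 * a + 2 * b ≤ M) :
    covSq μ a b = 2 * ((low (shiftC N M a))ᵀ * low (shiftC N M b)).trace ^ 2 +
      4 * trP (shiftC N M a) * trP (shiftC N M b) *
        ((low (shiftC N M a))ᵀ * low (shiftC N M b)).trace +
      2 * trP (shiftC N M b) *
        ((low (shiftC N M a))ᵀ * comm (shiftC N M a) (shiftC N M b)).trace +
      2 * trP (shiftC N M a) *
        ((low (shiftC N M b))ᵀ * comm (shiftC N M a) (shiftC N M b)).trace +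
      kappaFour (shiftC N M a) (shiftC N M b) := by
  rw [covSq, integral_ptr_sq_mul_ptr_sq hμ hinv ha hb hM,
    integral_ptr_sq (M := M) hμ hinv ha (by omega),
    integral_ptr_sq (M := M) hμ hinv hb (by omega), kappaFour]
  ring

omit hμ hinv in
lemma abs_trP_shiftC_le {M a : ℕ} (ha : 1 ≤ a) : |trP (shiftC N M a)| ≤ 1 := by
  rw [trP_shiftC ha]
  split_ifs <;> norm_num

lemma abs_covSq_le {a b : ℕ} (ha : 1 ≤ a) (hb : 1 ≤ b) {κ : ℝ}
    (hκ : ∀ M : ℕ, a ≤ M → |((low (shiftC N M a))ᵀ * low (shiftC N M b)).trace| ≤ κ) :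
    |covSq μ a b| ≤ 2 * κ ^ 2 + 4 * κ + 128 * (min a (2 * N) : ℕ) := by
  rw [covSq_eq (M := 2 * a + 2 * b) hμ hinv ha hb le_rfl]
  have h0 := hκ (2 * a + 2 * b) (by omega)
  have h1 := abs_trP_shiftC_le (N := N) (M := 2 * a + 2 * b) ha
  have h2 := abs_trP_shiftC_le (N := N) (M := 2 * a + 2 * b) hb
  have h3 := abs_trace_comm_left_le (N := N) (M := 2 * a + 2 * b) a b
  have h4 := abs_trace_comm_right_le (N := N) (M := 2 * a + 2 * b) a b
  have h5 := abs_kappaFour_le (N := N) (M := 2 * a + 2 * b) a b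
  rw [frob_low_shiftC (by omega)] at h3 h4 h5
  set m : ℝ := ((min a (2 * N) : ℕ) : ℝ) with hm
  generalize ((low (shiftC N (2 * a + 2 * b) a))ᵀ * low (shiftC N (2 * a + 2 * b) b)).trace = t at *
  generalize trP (shiftC N (2 * a + 2 * b) a) = p at *
  generalize trP (shiftC N (2 * a + 2 * b) b) = q at *
  generalize ((low (shiftC N (2 * a + 2 * b) a))ᵀ *
    comm (shiftC N (2 * a + 2 * b) a) (shiftC N (2 * a + 2 * b) b)).trace = x at *
  generalize ((low (shiftC N (2 * a + 2 * b) b))ᵀ *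
    comm (shiftC N (2 * a + 2 * b) a) (shiftC N (2 * a + 2 * b) b)).trace = y at *
  have g1 : |2 * t ^ 2| ≤ 2 * κ ^ 2 := by
    rw [abs_mul, abs_pow, abs_two]
    gcongr
  have g2 : |4 * p * q * t| ≤ 4 * κ := by
    have : |p| * |q| * |t| ≤ 1 * 1 * κ := by gcongr
    rw [abs_mul, abs_mul, abs_mul, abs_of_pos (by norm_num : (0 : ℝ) < 4)]
    linarith
  have g3 : |2 * q * x| ≤ 2 * (19 * m) := by
    have : |q| * |x| ≤ 1 * (19 * m) := by gcongr
    rw [abs_mul, abs_mul, abs_two]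
    linarith
  have g4 : |2 * p * y| ≤ 2 * (18 * m) := by
    have : |p| * |y| ≤ 1 * (18 * m) := by gcongr
    rw [abs_mul, abs_mul, abs_two]
    linarith
  refine (abs_add_le _ _).trans ?_
  refine (add_le_add_left (abs_add_le _ _) _).trans ?_
  refine (add_le_add_left (add_le_add_left (abs_add_le _ _) _) _).trans ?_
  refine (add_le_add_left (add_le_add_left (add_le_add_left (abs_add_le _ _) _) _) _).trans ?_
  linarith

lemma abs_covSq_le_of_lt {a b : ℕ} (hN : 1 ≤ N) (ha : 1 ≤ a) (hab : a < b) :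
    |covSq μ a b| ≤ 134 * (min a (2 * N) : ℕ) := by
  have h := abs_covSq_le hμ hinv ha (by omega) fun M _ => trace_low_low_of_lt (N := N) (M := M) hab
  have h1 : (1 : ℝ) ≤ (min a (2 * N) : ℕ) := by exact_mod_cast (show 1 ≤ min a (2 * N) by omega)
  linarith

lemma abs_covSq_self_le {a : ℕ} (hN : 1 ≤ N) (ha : 1 ≤ a) :
    |covSq μ a a| ≤ 134 * (min a (2 * N) : ℕ) ^ 2 := by
  have h1 : (1 : ℝ) ≤ (min a (2 * N) : ℕ) := by exact_mod_cast (show 1 ≤ min a (2 * N) by omega)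
  have h := abs_covSq_le hμ hinv ha ha (κ := (min a (2 * N) : ℕ)) fun M hM => by
    rw [trace_transpose_mul_self_eq, frob_low_shiftC hM, abs_of_nonneg (by positivity)]
  nlinarith

lemma covSq_eq_zero {a b : ℕ} (ha : 1 ≤ a) (hab : a < b) (haN : 2 * a ≤ N) (hg : Good N a b) :
    covSq μ a b = 0 := by
  obtain ⟨h1, h2, h3, h4⟩ := small_vanishing (M := 2 * a + 2 * b) ha hab.le haN (by omega) hg
  rw [covSq_eq (M := 2 * a + 2 * b) hμ hinv ha (by omega) le_rfl, h1, h2, h3, h4 hab]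
  ring

lemma covSq_self_eq {a : ℕ} (ha : 1 ≤ a) (haN : 3 * a ≤ N) :
    covSq μ a a = 2 * (a : ℝ) ^ 2 + 4 * (if Odd a then (a : ℝ) else 0) := by
  obtain ⟨h1, h2, -, -⟩ := small_vanishing (N := N) (M := 2 * a + 2 * a) ha le_rfl (by omega)
    (by omega) (Or.inl (by omega))
  rw [covSq_eq (M := 2 * a + 2 * a) hμ hinv ha ha le_rfl, h1, h2, trace_transpose_mul_self_eq,
    frob_low_shiftC (by omega), trP_shiftC ha, min_eq_left (by omega)]
  by_cases h : Odd a
  · rw [if_pos ⟨h, by omega⟩, if_pos h]; ring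
  · rw [if_neg (fun h' => h h'.1), if_neg h]; ring

end Covariance

section Truncation

variable {N : ℕ}

/-- The truncations of the series defining `Q N`. -/
def truncQ (N n : ℕ) (A : Matrix (Fin (2 * N + 1)) (Fin (2 * N + 1)) ℝ) : ℝ :=
  2 * ∑ k ∈ Finset.range n, ptr (k + 1) A ^ 2 / ((k : ℝ) + 1) ^ 2

lemma abs_ptr_le {A : Matrix (Fin (2 * N + 1)) (Fin (2 * N + 1)) ℝ}
    (hA : A ∈ specialOrthogonalGroup (Fin (2 * N + 1)) ℝ) (k : ℕ) : |ptr k A| ≤ 2 * N := by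
  obtain ⟨θ, hθ⟩ := exists_angles hA
  rw [ptr, hθ, add_sub_cancel_left, abs_mul, abs_two]
  gcongr
  refine (Finset.abs_sum_le_sum_abs _ _).trans ?_
  refine (Finset.sum_le_sum fun j _ => Real.abs_cos_le_one _).trans ?_
  simp

lemma summable_ptr_term {A : Matrix (Fin (2 * N + 1)) (Fin (2 * N + 1)) ℝ}
    (hA : A ∈ specialOrthogonalGroup (Fin (2 * N + 1)) ℝ) :
    Summable fun k : ℕ => ptr (k + 1) A ^ 2 / ((k : ℝ) + 1) ^ 2 := by
  have h : Summable fun k : ℕ => (2 * (N : ℝ)) ^ 2 * (1 / ((k : ℝ) + 1) ^ 2) := by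
    refine Summable.mul_left _ ?_
    have := (summable_nat_add_iff 1).mpr (Real.summable_one_div_nat_pow.mpr one_lt_two)
    simpa using this
  refine Summable.of_nonneg_of_le (fun k => by positivity) (fun k => ?_) h
  rw [mul_one_div]
  gcongr ?_ / _
  exact sq_le_sq' (abs_le.mp (abs_ptr_le hA _)).1 (abs_le.mp (abs_ptr_le hA _)).2

lemma truncQ_nonneg (n : ℕ) (A : Matrix (Fin (2 * N + 1)) (Fin (2 * N + 1)) ℝ) :
    0 ≤ truncQ N n A :=
  mul_nonneg zero_le_two (Finset.sum_nonneg fun k _ => by positivity)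

lemma tendsto_truncQ {A : Matrix (Fin (2 * N + 1)) (Fin (2 * N + 1)) ℝ}
    (hA : A ∈ specialOrthogonalGroup (Fin (2 * N + 1)) ℝ) :
    Filter.Tendsto (fun n => truncQ N n A) Filter.atTop (nhds (Q N A)) :=
  ((summable_ptr_term hA).hasSum.tendsto_sum_nat).const_mul 2

lemma truncQ_le {A : Matrix (Fin (2 * N + 1)) (Fin (2 * N + 1)) ℝ}
    (hA : A ∈ specialOrthogonalGroup (Fin (2 * N + 1)) ℝ) (n : ℕ) :
    truncQ N n A ≤ 2 * ∑' k : ℕ, (2 * (N : ℝ)) ^ 2 * (1 / ((k : ℝ) + 1) ^ 2) := by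
  have h : Summable fun k : ℕ => (2 * (N : ℝ)) ^ 2 * (1 / ((k : ℝ) + 1) ^ 2) := by
    refine Summable.mul_left _ ?_
    have := (summable_nat_add_iff 1).mpr (Real.summable_one_div_nat_pow.mpr one_lt_two)
    simpa using this
  rw [truncQ]
  gcongr
  refine (Finset.sum_le_sum fun k _ => ?_).trans
    (h.sum_le_tsum (Finset.range n) fun k _ => by positivity)
  rw [mul_one_div]
  gcongr ?_ / _
  exact sq_le_sq' (abs_le.mp (abs_ptr_le hA _)).1 (abs_le.mp (abs_ptr_le hA _)).2

variable {μ : Measure (Matrix (Fin (2 * N + 1)) (Fin (2 * N + 1)) ℝ)} [IsProbabilityMeasure μ]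
  (hμ : ∀ᵐ A ∂μ, A ∈ specialOrthogonalGroup (Fin (2 * N + 1)) ℝ)

include hμ

lemma integrable_ptr_sq (a : ℕ) : Integrable (fun A => ptr a A ^ 2) μ := by
  simpa [sq] using integrable_prod_ptr hμ [a, a]

lemma integrable_ptr_sq_mul_ptr_sq (a b : ℕ) :
    Integrable (fun A => ptr a A ^ 2 * ptr b A ^ 2) μ := by
  simpa [sq, mul_assoc] using integrable_prod_ptr hμ [a, a, b, b]

lemma integrable_truncQ (n : ℕ) : Integrable (truncQ N n) μ :=
  (integrable_finsetSum _ fun k _ => (integrable_ptr_sq hμ (k + 1)).div_const _).const_mul 2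

lemma integral_truncQ (n : ℕ) :
    ∫ A, truncQ N n A ∂μ =
      2 * ∑ k ∈ Finset.range n, (∫ A, ptr (k + 1) A ^ 2 ∂μ) / ((k : ℝ) + 1) ^ 2 := by
  simp only [truncQ]
  rw [integral_const_mul,
    integral_finsetSum _ fun k _ => (integrable_ptr_sq hμ (k + 1)).div_const _]
  simp only [integral_div]

lemma integral_truncQ_sq_sub (n : ℕ) :
    ∫ A, truncQ N n A ^ 2 ∂μ - (∫ A, truncQ N n A ∂μ) ^ 2 =
      4 * ∑ j ∈ Finset.range n, ∑ k ∈ Finset.range n,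
        covSq μ (j + 1) (k + 1) * (1 / ((j : ℝ) + 1) ^ 2 * (1 / ((k : ℝ) + 1) ^ 2)) := by
  have h1 : ∀ A : Matrix (Fin (2 * N + 1)) (Fin (2 * N + 1)) ℝ, truncQ N n A ^ 2 =
      4 * ∑ j ∈ Finset.range n, ∑ k ∈ Finset.range n,
        ptr (j + 1) A ^ 2 * ptr (k + 1) A ^ 2 *
          (1 / ((j : ℝ) + 1) ^ 2 * (1 / ((k : ℝ) + 1) ^ 2)) := by
    intro A
    rw [truncQ, mul_pow, sq (∑ k ∈ Finset.range n, _), Finset.sum_mul_sum]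
    norm_num
    refine Finset.sum_congr rfl fun j _ => Finset.sum_congr rfl fun k _ => ?_
    ring
  have hi : ∀ j k : ℕ, Integrable (fun A => ptr (j + 1) A ^ 2 * ptr (k + 1) A ^ 2 *
      (1 / ((j : ℝ) + 1) ^ 2 * (1 / ((k : ℝ) + 1) ^ 2))) μ :=
    fun j k => (integrable_ptr_sq_mul_ptr_sq hμ _ _).mul_const _
  simp only [h1]
  rw [integral_const_mul, integral_finsetSum _ fun j _ => integrable_finsetSum _ fun k _ => hi j k,
    integral_truncQ hμ, mul_pow, sq (∑ k ∈ Finset.range n, _), Finset.sum_mul_sum,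
    show (2 : ℝ) ^ 2 = 4 by norm_num, ← mul_sub, ← Finset.sum_sub_distrib]
  congr 1
  refine Finset.sum_congr rfl fun j _ => ?_
  rw [integral_finsetSum _ fun k _ => hi j k, ← Finset.sum_sub_distrib]
  refine Finset.sum_congr rfl fun k _ => ?_
  rw [integral_mul_const, covSq]
  ring

lemma aestronglyMeasurable_Q : AEStronglyMeasurable (Q N) μ :=
  aestronglyMeasurable_of_tendsto_ae Filter.atTop
    (fun n => (integrable_truncQ hμ n).aestronglyMeasurable)
    (hμ.mono fun _ hA => tendsto_truncQ hA)

lemma tendsto_integral_truncQ :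
    Filter.Tendsto (fun n => ∫ A, truncQ N n A ∂μ) Filter.atTop (nhds (∫ A, Q N A ∂μ)) := by
  refine tendsto_integral_of_dominated_convergence
    (fun _ => 2 * ∑' k : ℕ, (2 * (N : ℝ)) ^ 2 * (1 / ((k : ℝ) + 1) ^ 2))
    (fun n => (integrable_truncQ hμ n).aestronglyMeasurable) (integrable_const _) (fun n => ?_)
    (hμ.mono fun _ hA => tendsto_truncQ hA)
  filter_upwards [hμ] with A hA
  rw [Real.norm_of_nonneg (truncQ_nonneg n A)]
  exact truncQ_le hA n

lemma tendsto_integral_truncQ_sq :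
    Filter.Tendsto (fun n => ∫ A, truncQ N n A ^ 2 ∂μ) Filter.atTop (nhds (∫ A, Q N A ^ 2 ∂μ)) := by
  refine tendsto_integral_of_dominated_convergence
    (fun _ => (2 * ∑' k : ℕ, (2 * (N : ℝ)) ^ 2 * (1 / ((k : ℝ) + 1) ^ 2)) ^ 2)
    (fun n => (integrable_truncQ hμ n).aestronglyMeasurable.pow 2) (integrable_const _)
    (fun n => ?_) (hμ.mono fun _ hA => (tendsto_truncQ hA).pow 2)
  filter_upwards [hμ] with A hA
  rw [Real.norm_of_nonneg (sq_nonneg _)]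
  exact pow_le_pow_left₀ (truncQ_nonneg n A) (truncQ_le hA n) 2

lemma memLp_Q : MemLp (Q N) 2 μ := by
  refine MemLp.of_bound (aestronglyMeasurable_Q hμ)
    (2 * ∑' k : ℕ, (2 * (N : ℝ)) ^ 2 * (1 / ((k : ℝ) + 1) ^ 2)) ?_
  filter_upwards [hμ] with A hA
  rw [Real.norm_eq_abs]
  refine le_of_tendsto (tendsto_truncQ hA).abs (Filter.Eventually.of_forall fun n => ?_)
  rw [abs_of_nonneg (truncQ_nonneg n A)]
  exact truncQ_le hA n

lemma tendsto_variance_Q :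
    Filter.Tendsto (fun n : ℕ => 4 * ∑ j ∈ Finset.range n, ∑ k ∈ Finset.range n,
        covSq μ (j + 1) (k + 1) * (1 / ((j : ℝ) + 1) ^ 2 * (1 / ((k : ℝ) + 1) ^ 2)))
      Filter.atTop (nhds (variance (Q N) μ)) := by
  simp only [← integral_truncQ_sq_sub hμ]
  rw [variance_eq_sub (memLp_Q hμ)]
  exact (tendsto_integral_truncQ_sq hμ).sub ((tendsto_integral_truncQ hμ).pow 2)

end Truncation

section Series

lemma sum_Ico_inv_sq_le {m n : ℕ} (hm : 1 ≤ m) (hmn : m ≤ n) :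
    ∑ k ∈ Finset.Ico m n, 1 / ((k : ℝ) + 1) ^ 2 ≤ (1 : ℝ) / m - 1 / n := by
  induction n, hmn using Nat.le_induction with
  | base => simp
  | succ n hmn ih =>
    rw [Finset.sum_Ico_succ_top hmn]
    have hn : (0 : ℝ) < n := by exact_mod_cast (show 0 < n by omega)
    have : 1 / ((n : ℝ) + 1) ^ 2 ≤ 1 / n - 1 / (n + 1) := by
      rw [div_sub_div _ _ (by positivity) (by positivity),
        div_le_div_iff₀ (by positivity) (by positivity)]
      nlinarith
    push_cast
    linarith

lemma le_sum_Ico_inv_sq {m n : ℕ} (hmn : m ≤ n) :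
    1 / ((m : ℝ) + 1) - 1 / (n + 1) ≤ ∑ k ∈ Finset.Ico m n, 1 / ((k : ℝ) + 1) ^ 2 := by
  induction n, hmn using Nat.le_induction with
  | base => simp
  | succ n hmn ih =>
    rw [Finset.sum_Ico_succ_top hmn]
    have : 1 / ((n : ℝ) + 1) - 1 / (n + 1 + 1) ≤ 1 / ((n : ℝ) + 1) ^ 2 := by
      rw [div_sub_div _ _ (by positivity) (by positivity),
        div_le_div_iff₀ (by positivity) (by positivity)]
      have hn : (0 : ℝ) ≤ n := by positivity
      nlinarith
    push_cast
    linarith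

lemma sum_Ico_inv_sq_le_two_div (m n : ℕ) :
    ∑ k ∈ Finset.Ico m n, 1 / ((k : ℝ) + 1) ^ 2 ≤ (2 : ℝ) / (m + 1) := by
  rcases le_total n m with h | h
  · rw [Finset.Ico_eq_empty_of_le h, Finset.sum_empty]
    positivity
  suffices H : ∑ k ∈ Finset.Ico m n, 1 / ((k : ℝ) + 1) ^ 2 ≤ (2 : ℝ) / (m + 1) - 2 / (n + 1) by
    have : (0 : ℝ) ≤ 2 / (n + 1) := by positivity
    linarith
  induction n, h using Nat.le_induction with
  | base => simp
  | succ n hmn ih =>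
    rw [Finset.sum_Ico_succ_top hmn]
    have : 1 / ((n : ℝ) + 1) ^ 2 ≤ 2 / (n + 1) - 2 / (n + 1 + 1) := by
      rw [div_sub_div _ _ (by positivity) (by positivity),
        div_le_div_iff₀ (by positivity) (by positivity)]
      have hn : (0 : ℝ) ≤ n := by positivity
      nlinarith [pow_nonneg hn 3, pow_nonneg hn 2]
    push_cast
    linarith

lemma hasSum_odd_of_hasSum {p : ℕ} (hp : p ≠ 0) {Z : ℝ}
    (hZ : HasSum (fun n : ℕ => 1 / (n : ℝ) ^ p) Z) :
    HasSum (fun k : ℕ => if Odd (k + 1) then 1 / ((k : ℝ) + 1) ^ p else 0) (Z - Z / 2 ^ p) := by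
  have hinj : Function.Injective fun n : ℕ => 2 * n := fun a b h => by simpa using h
  have he : HasSum (fun n : ℕ => if Even n then 1 / (n : ℝ) ^ p else 0) (Z / 2 ^ p) := by
    rw [← hinj.hasSum_iff]
    · refine (hZ.div_const (2 ^ p)).congr_fun fun n => ?_
      simp [mul_pow, div_eq_mul_inv, mul_comm]
    · intro n hn
      rw [if_neg]
      rintro ⟨m, rfl⟩
      exact hn ⟨m, by simp; ring⟩
  have h := (hasSum_nat_add_iff' 1).mpr (hZ.sub he)
  simp only [Finset.sum_range_one, Nat.cast_zero, zero_pow hp, div_zero, ite_self, sub_zero] at h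
  refine h.congr_fun fun k => ?_
  by_cases hk : Even (k + 1)
  · rw [if_pos hk, if_neg (Nat.not_odd_iff_even.mpr hk), sub_self]
  · rw [if_neg hk, if_pos (Nat.not_even_iff_odd.mp hk), sub_zero]
    push_cast
    rfl

lemma hasSum_odd_inv_sq :
    HasSum (fun k : ℕ => if Odd (k + 1) then 1 / ((k : ℝ) + 1) ^ 2 else 0) (Real.pi ^ 2 / 8) := by
  convert hasSum_odd_of_hasSum two_ne_zero hasSum_zeta_two using 1
  ring

lemma abs_harmonic_sub_log_sub_le {n : ℕ} (hn : 1 ≤ n) :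
    |∑ k ∈ Finset.range n, 1 / ((k : ℝ) + 1) - Real.log n - Real.eulerMascheroniConstant| ≤
      (1 : ℝ) / n := by
  have hn' : (0 : ℝ) < n := by exact_mod_cast hn
  have h1 := Real.eulerMascheroniSeq_lt_eulerMascheroniConstant n
  have h2 := Real.eulerMascheroniConstant_lt_eulerMascheroniSeq' n
  rw [Real.eulerMascheroniSeq] at h1
  rw [Real.eulerMascheroniSeq', if_neg (by omega)] at h2
  have h3 : ((harmonic n : ℚ) : ℝ) = ∑ k ∈ Finset.range n, 1 / ((k : ℝ) + 1) := by
    simp [harmonic]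
  rw [h3] at h1 h2
  have h4 : Real.log (n + 1) ≤ Real.log n + 1 / n := by
    have := Real.log_le_sub_one_of_pos (x := ((n : ℝ) + 1) / n) (by positivity)
    rw [Real.log_div (by positivity) hn'.ne', add_div, div_self hn'.ne'] at this
    linarith
  rw [abs_le]
  have : (0 : ℝ) < 1 / n := by positivity
  constructor <;> linarith

lemma abs_sum_odd_sub_le {m : ℕ} (hm : 1 ≤ m) :
    |∑ k ∈ Finset.range m, (if Odd (k + 1) then 1 / ((k : ℝ) + 1) ^ 2 else 0) - Real.pi ^ 2 / 8| ≤
      (1 : ℝ) / m := by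
  have h := hasSum_odd_inv_sq.tendsto_sum_nat
  rw [abs_sub_comm]
  refine le_of_tendsto ((h.sub_const _).abs) ?_
  filter_upwards [Filter.eventually_ge_atTop m] with n hn
  rw [← Finset.sum_range_add_sum_Ico _ hn, add_sub_cancel_left, abs_of_nonneg]
  · refine (Finset.sum_le_sum fun k _ => ?_).trans ((sum_Ico_inv_sq_le hm hn).trans ?_)
    · split_ifs
      · exact le_rfl
      · positivity
    · have : (0 : ℝ) ≤ 1 / n := by positivity
      linarith
  · exact Finset.sum_nonneg fun k _ => by split_ifs <;> positivity

lemma abs_mean_sum_sub_le {N n : ℕ} (hN : 1 ≤ N) (hn : 2 * N ≤ n) (hn' : N * N ≤ n) :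
    |2 * ∑ k ∈ Finset.range n, ((if Odd (k + 1) ∧ k + 1 < 2 * N then (1 : ℝ) else 0) +
        ((min (k + 1) (2 * N) : ℕ) : ℝ)) / ((k : ℝ) + 1) ^ 2 - 2 * Real.log (2 * N) -
        (2 * Real.eulerMascheroniConstant + 2 + Real.pi ^ 2 / 4)| ≤
      (10 : ℝ) / N := by
  have hN' : (1 : ℝ) ≤ N := by exact_mod_cast hN
  have hn1 : (2 * N : ℝ) ≤ n := by exact_mod_cast hn
  have hn2 : (N * N : ℝ) ≤ n := by exact_mod_cast hn'
  have e1 : ∑ k ∈ Finset.range n, ((if Odd (k + 1) ∧ k + 1 < 2 * N then (1 : ℝ) else 0) +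
        ((min (k + 1) (2 * N) : ℕ) : ℝ)) / ((k : ℝ) + 1) ^ 2 =
      (∑ k ∈ Finset.range (2 * N), (if Odd (k + 1) then 1 / ((k : ℝ) + 1) ^ 2 else 0) +
        ∑ k ∈ Finset.range (2 * N), 1 / ((k : ℝ) + 1)) +
        2 * N * ∑ k ∈ Finset.Ico (2 * N) n, 1 / ((k : ℝ) + 1) ^ 2 := by
    rw [← Finset.sum_range_add_sum_Ico _ hn, ← Finset.sum_add_distrib, Finset.mul_sum]
    congr 1
    · refine Finset.sum_congr rfl fun k hk => ?_
      rw [Finset.mem_range] at hk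
      rw [min_eq_left (by omega)]
      have h0 : (k : ℝ) + 1 ≠ 0 := by positivity
      by_cases ho : Odd (k + 1)
      · have : k + 1 < 2 * N := by
          obtain ⟨r, hr⟩ := ho
          omega
        rw [if_pos ⟨ho, this⟩, if_pos ho]
        push_cast
        field_simp
      · rw [if_neg (fun h => ho h.1), if_neg ho]
        push_cast
        field_simp
        ring
    · refine Finset.sum_congr rfl fun k hk => ?_
      rw [Finset.mem_Ico] at hk
      rw [min_eq_right (by omega), if_neg (by omega)]
      push_cast
      ring
  have h1 := abs_harmonic_sub_log_sub_le (n := 2 * N) (by omega)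
  have h2 := abs_sum_odd_sub_le (m := 2 * N) (by omega)
  have h3 := sum_Ico_inv_sq_le (m := 2 * N) (n := n) (by omega) hn
  have h4 := le_sum_Ico_inv_sq hn
  rw [e1]
  push_cast at h1 h2 h3 h4
  generalize ∑ k ∈ Finset.range (2 * N), 1 / ((k : ℝ) + 1) = H at *
  generalize ∑ k ∈ Finset.range (2 * N), (if Odd (k + 1) then 1 / ((k : ℝ) + 1) ^ 2 else 0) = O at *
  generalize ∑ k ∈ Finset.Ico (2 * N) n, 1 / ((k : ℝ) + 1) ^ 2 = S at *
  have hn0 : (0 : ℝ) < n := by linarith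
  have h5 : 2 * N * S ≤ 1 := by
    have : S ≤ 1 / (2 * N) := h3.trans (by have : (0 : ℝ) ≤ 1 / n := by positivity
                                           linarith)
    calc 2 * N * S ≤ 2 * N * (1 / (2 * N)) := by gcongr
      _ = 1 := by field_simp
  have h6 : 1 - 3 / N ≤ 2 * N * S := by
    have i1 : (1 : ℝ) / (n + 1) ≤ 1 / (N * N) := by
      gcongr
      linarith
    have i2 : 1 - 1 / N ≤ 2 * N * (1 / (2 * N + 1 : ℝ)) := by
      rw [one_sub_div (by positivity), mul_one_div, div_le_div_iff₀ (by positivity) (by positivity)]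
      nlinarith
    have i3 : 2 * N * (1 / (N * N : ℝ)) = 2 / N := by field_simp
    have i4 : 2 * N * (1 / (2 * N + 1 : ℝ) - 1 / (n + 1)) ≤ 2 * N * S := by gcongr
    have i5 : 2 * N * (1 / (n + 1 : ℝ)) ≤ 2 * N * (1 / (N * N)) := by gcongr
    have i6 : (3 : ℝ) / N = 1 / N + 2 / N := by ring
    rw [mul_sub] at i4
    linarith
  have h7 : (1 : ℝ) / (2 * N) = (1 / N) / 2 := by ring
  have h8 : (10 : ℝ) / N = 10 * (1 / N) := by ring
  have h9 : (3 : ℝ) / N = 3 * (1 / N) := by ring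
  have h10 : (0 : ℝ) < 1 / N := by positivity
  rw [h7] at h1 h2
  rw [h9] at h6
  rw [h8]
  rw [abs_le] at *
  constructor <;> linarith [h1.1, h1.2, h2.1, h2.2]

/-- The limiting covariance kernel summed along the diagonal. -/
lemma hasSum_limit_variance :
    HasSum (fun k : ℕ => (2 * ((k : ℝ) + 1) ^ 2 + 4 * (if Odd (k + 1) then (k : ℝ) + 1 else 0)) *
      (1 / ((k : ℝ) + 1) ^ 2) ^ 2) (Real.pi ^ 2 / 3 + 7 / 2 * (riemannZeta 3).re) := by
  have h3 : HasSum (fun n : ℕ => 1 / (n : ℝ) ^ 3) (riemannZeta 3).re := by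
    have hs : Summable fun n : ℕ => 1 / (n : ℝ) ^ 3 :=
      Real.summable_one_div_nat_pow.mpr (by norm_num)
    convert hs.hasSum using 1
    have := zeta_nat_eq_tsum_of_gt_one (k := 3) (by norm_num)
    push_cast at this
    rw [this]
    rw [← Complex.ofReal_re (∑' n : ℕ, 1 / (n : ℝ) ^ 3), Complex.ofReal_tsum]
    push_cast
    rfl
  have h2 := (hasSum_nat_add_iff' 1).mpr hasSum_zeta_two
  simp only [Finset.sum_range_one, Nat.cast_zero, zero_pow two_ne_zero, div_zero, sub_zero] at h2
  have h := (h2.mul_left 2).add ((hasSum_odd_of_hasSum three_ne_zero h3).mul_left 4)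
  rw [show 2 * (Real.pi ^ 2 / 6) + 4 * ((riemannZeta 3).re - (riemannZeta 3).re / 2 ^ 3) =
    Real.pi ^ 2 / 3 + 7 / 2 * (riemannZeta 3).re by ring] at h
  refine h.congr_fun fun k => ?_
  have h0 : (k : ℝ) + 1 ≠ 0 := by positivity
  push_cast
  split_ifs <;> field_simp
  ring

end Series

section DoubleSum

/-- A majorant of the sizes of covariances of a short power trace with a power trace whose index is
close to `N` or `2 * N`. -/
def nearBound (N a b : ℕ) : ℝ :=
  if 8 * a ≤ N ∧ ((N < b + 2 * a ∧ b < N + 2 * a) ∨ (2 * N < b + 2 * a ∧ b < 2 * N + 2 * a)) then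
    268 / (a * (N : ℝ) ^ 2) else 0

/-- The weight `1 / a ^ 2` restricted to `8 * a > N`. -/
def farWeight (N a : ℕ) : ℝ := if N < 8 * a then 1 / (a : ℝ) ^ 2 else 0

lemma nearBound_nonneg (N a b : ℕ) : 0 ≤ nearBound N a b := by
  unfold nearBound; split_ifs <;> positivity

lemma farWeight_nonneg (N a : ℕ) : 0 ≤ farWeight N a := by
  unfold farWeight; split_ifs <;> positivity

lemma sum_farWeight_le {N : ℕ} (hN : 1 ≤ N) (n : ℕ) :
    ∑ k ∈ Finset.range n, farWeight N (k + 1) ≤ 16 / N := by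
  have hN' : (0 : ℝ) < N := by exact_mod_cast hN
  have h1 : ∑ k ∈ Finset.range n, farWeight N (k + 1) =
      ∑ k ∈ Finset.Ico (N / 8) n, 1 / ((k : ℝ) + 1) ^ 2 := by
    simp only [farWeight]
    rw [← Finset.sum_filter]
    refine Finset.sum_congr ?_ fun k _ => by push_cast; rfl
    ext k
    simp only [Finset.mem_filter, Finset.mem_range, Finset.mem_Ico]
    omega
  have h2 : (N : ℝ) ≤ 8 * ((N / 8 : ℕ) + 1) := by exact_mod_cast (show N ≤ 8 * (N / 8 + 1) by omega)
  rw [h1]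
  refine (sum_Ico_inv_sq_le_two_div _ _).trans ?_
  rw [div_le_div_iff₀ (by positivity) hN']
  linarith

lemma card_filter_near_le (n m a : ℕ) :
    ((Finset.range n).filter fun k => m < k + 1 + 2 * a ∧ k + 1 < m + 2 * a).card ≤ 4 * a := by
  refine (Finset.card_le_card (t := Finset.Ico (m - 2 * a) (m + 2 * a)) fun k hk => ?_).trans ?_
  · simp only [Finset.mem_filter, Finset.mem_range, Finset.mem_Ico] at hk ⊢
    omega
  · rw [Nat.card_Ico]
    omega

lemma sum_nearBound_le {N : ℕ} (hN : 1 ≤ N) (n a : ℕ) :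
    ∑ k ∈ Finset.range n, nearBound N (a + 1) (k + 1) ≤
      if 8 * (a + 1) ≤ N then 2144 / (N : ℝ) ^ 2 else 0 := by
  have hN' : (0 : ℝ) < N := by exact_mod_cast hN
  split_ifs with h
  · simp only [nearBound, h, true_and]
    rw [← Finset.sum_filter, Finset.sum_const, nsmul_eq_mul, Finset.filter_or]
    have hc := (Finset.card_union_le _ _).trans
      (add_le_add (card_filter_near_le n N (a + 1)) (card_filter_near_le n (2 * N) (a + 1)))
    refine (mul_le_mul_of_nonneg_right (Nat.cast_le.mpr hc) (by positivity)).trans (le_of_eq ?_)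
    push_cast
    field_simp
    norm_num
  · simp [nearBound, h]

lemma sum_sum_nearBound_le {N : ℕ} (hN : 1 ≤ N) (n : ℕ) :
    ∑ j ∈ Finset.range n, ∑ k ∈ Finset.range n, nearBound N (j + 1) (k + 1) ≤ 268 / N := by
  have hN' : (0 : ℝ) < N := by exact_mod_cast hN
  refine (Finset.sum_le_sum fun j _ => sum_nearBound_le hN n j).trans ?_
  rw [← Finset.sum_filter, Finset.sum_const, nsmul_eq_mul]
  have hc : 8 * ((Finset.range n).filter fun j => 8 * (j + 1) ≤ N).card ≤ N := by
    have : ((Finset.range n).filter fun j => 8 * (j + 1) ≤ N).card ≤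
        (Finset.range (N / 8)).card := by
      refine Finset.card_le_card fun k hk => ?_
      simp only [Finset.mem_filter, Finset.mem_range] at hk ⊢
      omega
    rw [Finset.card_range] at this
    omega
  have hc' : (((Finset.range n).filter fun j => 8 * (j + 1) ≤ N).card : ℝ) ≤ N / 8 := by
    rw [le_div_iff₀ (by norm_num), mul_comm]
    exact_mod_cast hc
  refine (mul_le_mul_of_nonneg_right hc' (by positivity)).trans (le_of_eq ?_)
  field_simp
  norm_num

lemma abs_sum_sum_le {N n : ℕ} (hN : 1 ≤ N) {X : ℕ → ℕ → ℝ}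
    (hX : ∀ j k, |X j k| ≤ (if j = k then 140 * farWeight N (j + 1) else 0) +
      268 * N * (farWeight N (j + 1) * farWeight N (k + 1)) +
      (nearBound N (j + 1) (k + 1) + nearBound N (k + 1) (j + 1))) :
    |∑ j ∈ Finset.range n, ∑ k ∈ Finset.range n, X j k| ≤ 71384 / N := by
  have hN' : (0 : ℝ) < N := by exact_mod_cast hN
  have h1 := sum_farWeight_le hN n
  have h2 := sum_sum_nearBound_le hN n
  have h3 := h2
  rw [Finset.sum_comm] at h3
  have h0 : 0 ≤ ∑ k ∈ Finset.range n, farWeight N (k + 1) :=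
    Finset.sum_nonneg fun k _ => farWeight_nonneg N (k + 1)
  calc |∑ j ∈ Finset.range n, ∑ k ∈ Finset.range n, X j k|
      ≤ ∑ j ∈ Finset.range n, ∑ k ∈ Finset.range n, |X j k| :=
        (Finset.abs_sum_le_sum_abs _ _).trans
          (Finset.sum_le_sum fun j _ => Finset.abs_sum_le_sum_abs _ _)
    _ ≤ ∑ j ∈ Finset.range n, ∑ k ∈ Finset.range n,
        ((if j = k then 140 * farWeight N (j + 1) else 0) +
          268 * N * (farWeight N (j + 1) * farWeight N (k + 1)) +
          (nearBound N (j + 1) (k + 1) + nearBound N (k + 1) (j + 1))) :=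
        Finset.sum_le_sum fun j _ => Finset.sum_le_sum fun k _ => hX j k
    _ = 140 * ∑ k ∈ Finset.range n, farWeight N (k + 1) +
        268 * N * ((∑ k ∈ Finset.range n, farWeight N (k + 1)) *
          ∑ k ∈ Finset.range n, farWeight N (k + 1)) +
        (∑ j ∈ Finset.range n, ∑ k ∈ Finset.range n, nearBound N (j + 1) (k + 1) +
          ∑ j ∈ Finset.range n, ∑ k ∈ Finset.range n, nearBound N (k + 1) (j + 1)) := by
        simp only [Finset.sum_add_distrib]
        rw [Finset.sum_mul_sum]
        simp only [Finset.mul_sum]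
        congr 2
        refine Finset.sum_congr rfl fun j hj => ?_
        rw [Finset.sum_ite_eq, if_pos hj]
    _ ≤ 140 * (16 / N) + 268 * N * ((16 / N) * (16 / N)) + (268 / N + 268 / N) := by
        gcongr
    _ = 71384 / N := by
        field_simp
        norm_num

end DoubleSum

section Asymptotics

variable {N : ℕ} {μ : Measure (Matrix (Fin (2 * N + 1)) (Fin (2 * N + 1)) ℝ)}
  [IsProbabilityMeasure μ]
  (hμ : ∀ᵐ A ∂μ, A ∈ specialOrthogonalGroup (Fin (2 * N + 1)) ℝ)
  (hinv : ∀ g ∈ specialOrthogonalGroup (Fin (2 * N + 1)) ℝ, μ.map (fun A => g * A) = μ)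

include hμ hinv

lemma abs_integral_Q_sub_le (hN : 1 ≤ N) :
    |(∫ A, Q N A ∂μ) - 2 * Real.log (2 * N) -
      (2 * Real.eulerMascheroniConstant + 2 + Real.pi ^ 2 / 4)| ≤ (10 : ℝ) / N := by
  refine le_of_tendsto (((tendsto_integral_truncQ hμ).sub_const _).sub_const _).abs ?_
  filter_upwards [Filter.eventually_ge_atTop (2 * N),
    Filter.eventually_ge_atTop (N * N)] with n h1 h2
  rw [integral_truncQ hμ]
  simp only [integral_ptr_sq_eq hμ hinv (Nat.le_add_left 1 _)]
  exact abs_mean_sum_sub_le hN h1 h2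

lemma abs_covSq_weighted_le_of_lt (hN : 1 ≤ N) {a b : ℕ} (ha : 1 ≤ a) (hab : a < b) :
    |covSq μ a b| * (1 / (a : ℝ) ^ 2 * (1 / (b : ℝ) ^ 2)) ≤
      268 * N * (farWeight N a * farWeight N b) + nearBound N a b := by
  have h := abs_covSq_le_of_lt hμ hinv hN ha hab
  have hw := farWeight_nonneg N
  have hN0 : (0 : ℝ) < N := by exact_mod_cast hN
  have ha0 : (0 : ℝ) < a := by exact_mod_cast ha
  have hb0 : (0 : ℝ) < b := by exact_mod_cast (show 0 < b by omega)
  by_cases hfar : N < 8 * a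
  · have hm : ((min a (2 * N) : ℕ) : ℝ) ≤ 2 * N := by exact_mod_cast min_le_right a (2 * N)
    have h2 := nearBound_nonneg N a b
    rw [farWeight, farWeight, if_pos hfar, if_pos (by omega)]
    have : |covSq μ a b| ≤ 268 * N := by linarith
    have := mul_le_mul_of_nonneg_right this
      (show 0 ≤ 1 / (a : ℝ) ^ 2 * (1 / (b : ℝ) ^ 2) by positivity)
    linarith
  · have h1 : 0 ≤ 268 * N * (farWeight N a * farWeight N b) :=
      mul_nonneg (by positivity) (mul_nonneg (hw a) (hw b))
    by_cases hg : Good N a b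
    · rw [covSq_eq_zero hμ hinv ha hab (by omega) hg, abs_zero, zero_mul]
      exact add_nonneg h1 (nearBound_nonneg N a b)
    · have hb : 3 * N ≤ 4 * b := by
        unfold Good at hg
        omega
      rw [nearBound, if_pos (by unfold Good at hg; omega)]
      refine le_add_of_nonneg_of_le h1 ?_
      have hm : ((min a (2 * N) : ℕ) : ℝ) ≤ a := by exact_mod_cast min_le_left a (2 * N)
      have hb' : 3 * (N : ℝ) ≤ 4 * b := by exact_mod_cast hb
      have hb2 : (N : ℝ) ^ 2 ≤ 2 * (b : ℝ) ^ 2 := by nlinarith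
      calc |covSq μ a b| * (1 / (a : ℝ) ^ 2 * (1 / (b : ℝ) ^ 2))
          ≤ (134 * a) * (1 / (a : ℝ) ^ 2 * (1 / (b : ℝ) ^ 2)) := by
            gcongr
            linarith
        _ = 268 / (a * (2 * (b : ℝ) ^ 2)) := by
            field_simp
            norm_num
        _ ≤ 268 / (a * (N : ℝ) ^ 2) := by gcongr

lemma abs_covSq_self_sub_weighted_le (hN : 1 ≤ N) {a : ℕ} (ha : 1 ≤ a) :
    |covSq μ a a - (2 * (a : ℝ) ^ 2 + 4 * (if Odd a then (a : ℝ) else 0))| *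
      (1 / (a : ℝ) ^ 2 * (1 / (a : ℝ) ^ 2)) ≤ 140 * farWeight N a := by
  have ha0 : (1 : ℝ) ≤ a := by exact_mod_cast ha
  by_cases h3 : 3 * a ≤ N
  · rw [covSq_self_eq hμ hinv ha h3, sub_self, abs_zero, zero_mul]
    exact mul_nonneg (by norm_num) (farWeight_nonneg N a)
  · have hm : ((min a (2 * N) : ℕ) : ℝ) ≤ a := by exact_mod_cast min_le_left a (2 * N)
    have h1 : |covSq μ a a| ≤ 134 * (a : ℝ) ^ 2 :=
      (abs_covSq_self_le hμ hinv hN ha).trans (by gcongr)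
    have h2 : |2 * (a : ℝ) ^ 2 + 4 * (if Odd a then (a : ℝ) else 0)| ≤ 6 * (a : ℝ) ^ 2 := by
      rw [abs_of_nonneg (by split_ifs <;> positivity)]
      split_ifs <;> nlinarith
    rw [farWeight, if_pos (show N < 8 * a by omega)]
    calc _ ≤ (134 * (a : ℝ) ^ 2 + 6 * (a : ℝ) ^ 2) * (1 / (a : ℝ) ^ 2 * (1 / (a : ℝ) ^ 2)) := by
          gcongr
          exact (abs_sub _ _).trans (add_le_add h1 h2)
      _ = 140 * (1 / (a : ℝ) ^ 2) := by
          field_simp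
          norm_num

lemma abs_variance_sum_sub_le (hN : 1 ≤ N) (n : ℕ) :
    |∑ j ∈ Finset.range n, ∑ k ∈ Finset.range n,
        covSq μ (j + 1) (k + 1) * (1 / ((j : ℝ) + 1) ^ 2 * (1 / ((k : ℝ) + 1) ^ 2)) -
      ∑ k ∈ Finset.range n, (2 * ((k : ℝ) + 1) ^ 2 + 4 * (if Odd (k + 1) then (k : ℝ) + 1 else 0)) *
        (1 / ((k : ℝ) + 1) ^ 2) ^ 2| ≤ (71384 : ℝ) / N := by
  have hX := abs_sum_sum_le (n := n) hN (X := fun j k =>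
    covSq μ (j + 1) (k + 1) * (1 / ((j : ℝ) + 1) ^ 2 * (1 / ((k : ℝ) + 1) ^ 2)) -
      if j = k then (2 * ((j : ℝ) + 1) ^ 2 + 4 * (if Odd (j + 1) then (j : ℝ) + 1 else 0)) *
        (1 / ((j : ℝ) + 1) ^ 2) ^ 2 else 0) ?_
  · convert hX using 2
    simp only [Finset.sum_sub_distrib]
    congr 1
    refine Finset.sum_congr rfl fun j hj => ?_
    rw [Finset.sum_ite_eq, if_pos hj]
  · intro j k
    have hfar := farWeight_nonneg N
    have hnear := nearBound_nonneg N
    have hmul : ∀ a b, 0 ≤ 268 * N * (farWeight N a * farWeight N b) := fun a b =>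
      mul_nonneg (by positivity) (mul_nonneg (hfar a) (hfar b))
    rcases lt_trichotomy j k with h | rfl | h
    · have := abs_covSq_weighted_le_of_lt hμ hinv hN (Nat.le_add_left 1 j) (Nat.succ_lt_succ h)
      push_cast at this
      rw [if_neg h.ne, if_neg h.ne, sub_zero, abs_mul, zero_add,
        abs_of_nonneg (show 0 ≤ 1 / ((j : ℝ) + 1) ^ 2 * (1 / ((k : ℝ) + 1) ^ 2) by positivity)]
      linarith [hnear (k + 1) (j + 1)]
    · have := abs_covSq_self_sub_weighted_le hμ hinv hN (Nat.le_add_left 1 j)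
      push_cast at this
      rw [if_pos rfl, if_pos rfl, sq (1 / ((j : ℝ) + 1) ^ 2), ← sub_mul, abs_mul,
        abs_of_nonneg (show 0 ≤ 1 / ((j : ℝ) + 1) ^ 2 * (1 / ((j : ℝ) + 1) ^ 2) by positivity)]
      linarith [hnear (j + 1) (j + 1), hmul (j + 1) (j + 1)]
    · have := abs_covSq_weighted_le_of_lt hμ hinv hN (Nat.le_add_left 1 k) (Nat.succ_lt_succ h)
      push_cast at this
      rw [if_neg h.ne', if_neg h.ne', sub_zero, abs_mul, zero_add, covSq_comm,
        abs_of_nonneg (show 0 ≤ 1 / ((j : ℝ) + 1) ^ 2 * (1 / ((k : ℝ) + 1) ^ 2) by positivity),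
        mul_comm (1 / ((j : ℝ) + 1) ^ 2), mul_comm (farWeight N (j + 1))]
      linarith [hnear (j + 1) (k + 1)]

lemma abs_variance_Q_sub_le (hN : 1 ≤ N) :
    |variance (Q N) μ - (4 * Real.pi ^ 2 / 3 + 14 * (riemannZeta 3).re)| ≤ (285536 : ℝ) / N := by
  have h1 := (tendsto_variance_Q hμ).sub (hasSum_limit_variance.tendsto_sum_nat.const_mul 4)
  rw [show 4 * (Real.pi ^ 2 / 3 + 7 / 2 * (riemannZeta 3).re) =
    4 * Real.pi ^ 2 / 3 + 14 * (riemannZeta 3).re by ring] at h1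
  refine le_of_tendsto h1.abs (Filter.Eventually.of_forall fun n => ?_)
  rw [← mul_sub, abs_mul, abs_of_pos (by norm_num : (0 : ℝ) < 4)]
  refine (mul_le_mul_of_nonneg_left (abs_variance_sum_sub_le hμ hinv hN n) (by norm_num)).trans
    (le_of_eq ?_)
  ring

end Asymptotics

lemma ae_mem_specialOrthogonalGroup {n : Type*} [Fintype n] [DecidableEq n]
    {μ : Measure (Matrix n n ℝ)} [IsProbabilityMeasure μ]
    (h : μ {A | A ∈ specialOrthogonalGroup n ℝ} = 1) :
    ∀ᵐ A ∂μ, A ∈ specialOrthogonalGroup n ℝ := by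
  have hm : MeasurableSet {A : Matrix n n ℝ | A ∈ specialOrthogonalGroup n ℝ} := by
    have hset : {A : Matrix n n ℝ | A ∈ specialOrthogonalGroup n ℝ} =
        (⋂ i, ⋂ j, {A : Matrix n n ℝ | (A * Aᵀ) i j = (1 : Matrix n n ℝ) i j}) ∩
          {A | A.det = 1} := by
      ext A
      simp only [Set.mem_ofPred_eq, Set.mem_inter_iff, Set.mem_iInter,
        mem_specialOrthogonalGroup_iff, mem_orthogonalGroup_iff, ← Matrix.ext_iff]
    rw [hset]
    refine (MeasurableSet.iInter fun i => MeasurableSet.iInter fun j =>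
      measurableSet_eq_fun ?_ measurable_const).inter (measurableSet_eq_fun ?_ measurable_const)
    · simp only [mul_apply, transpose_apply]
      exact Finset.measurable_sum _ fun l _ => (measurable_entry i l).mul (measurable_entry j l)
    · rw [show (det : Matrix n n ℝ → ℝ) = _ from funext det_apply']
      exact Finset.measurable_sum _ fun σ _ =>
        (Finset.measurable_prod _ fun l _ => measurable_entry (σ l) l).const_mul _
  exact (mem_ae_iff_prob_eq_one hm).mpr h

end SOOdd

/-- There is a universal constant `C > 0` such that for all `N ≥ 1` and `A` Haar-distributed
on `SO(2N+1)`: `|E[Q_N] − 2 log(2N) − (2γ + 2 + π²/4)| ≤ C/N` and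
`|Var(Q_N) − (4π²/3 + 14 ζ(3))| ≤ C/N`. -/
theorem expectation_variance_asymptotics_specialOrthogonal_odd :
    ∃ C : ℝ, 0 < C ∧ ∀ N : ℕ, 1 ≤ N →
      ∀ μ : Measure (Matrix (Fin (2 * N + 1)) (Fin (2 * N + 1)) ℝ), IsProbabilityMeasure μ →
        μ {A | A ∈ Matrix.specialOrthogonalGroup (Fin (2 * N + 1)) ℝ} = 1 →
        (∀ g ∈ Matrix.specialOrthogonalGroup (Fin (2 * N + 1)) ℝ,
          μ.map (fun A => g * A) = μ) →
        |(∫ A, Q N A ∂μ) - 2 * Real.log (2 * N)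
            - (2 * Real.eulerMascheroniConstant + 2 + Real.pi ^ 2 / 4)| ≤ C / N ∧
        |variance (Q N) μ - (4 * Real.pi ^ 2 / 3 + 14 * (riemannZeta 3).re)| ≤ C / N := by
  refine ⟨285536, by norm_num, fun N hN μ _ hSO hinv => ?_⟩
  have hμ := SOOdd.ae_mem_specialOrthogonalGroup hSO
  refine ⟨(SOOdd.abs_integral_Q_sub_le hμ hinv hN).trans ?_,
    SOOdd.abs_variance_Q_sub_le hμ hinv hN⟩
  gcongr
  norm_num
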